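/- Let q be a power of an odd prime, F_q a finite field with q elements, n ≥ 1, and let J ∈ M_{2n}(F_q) be an invertible symmetric matrix that is split. Let G = GO(J) and H = O(J) = {g ∈ G : μ(g) = 1}. Let R be a complete set of irreducible complex representations of G and S a complete set of irreducible complex representations of H. Then Σ_{ρ ∈ R, character of ρ real-valued} dim ρ = Σ_{σ ∈ S} dim σ + 2 q^{n(n−1)/2} ∏_{i=1}^{n−1} (q^i + 1). -/

import Mathlib

open Matrix CategoryTheory
open scoped Classical

noncomputable section

/-- The Frobenius–Schur indicator of a complex-valued function on a finite group. -/
def fsIndicator (G : Type*) [Group G] [Fintype G] (χ : G → ℂ) : ℂ :=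
  (Fintype.card G : ℂ)⁻¹ * ∑ g : G, χ (g * g)

/-- The twisted Frobenius–Schur indicator of a complex-valued function on a finite group,
with respect to a map `σ`. -/
def twistedFSIndicator (G : Type*) [Group G] [Fintype G] (σ : G → G) (χ : G → ℂ) : ℂ :=
  (Fintype.card G : ℂ)⁻¹ * ∑ g : G, χ (g * σ g)

/-- A complex-valued function is real-valued if all its values are real. -/
def IsRealValued {G : Type*} (χ : G → ℂ) : Prop := ∀ g : G, ∃ r : ℝ, χ g = (r : ℂ)

/-- The Gaussian binomial coefficient `binom(m,k)_q` as a real number. -/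
def gbinom (m k : ℕ) (q : ℝ) : ℝ := ∏ i ∈ Finset.Icc 1 k, (q ^ (m - k + i) - 1) / (q ^ i - 1)

section Groups

variable {N F : Type*} [Fintype N] [DecidableEq N] [Field F]

theorem sim_one (J : Matrix N N F) :
    ((1 : GL N F) : Matrix N N F)ᵀ * J * ((1 : GL N F) : Matrix N N F) = ((1 : Fˣ) : F) • J := by
  simp

theorem sim_mul {J : Matrix N N F} (a b : GL N F) (c d : Fˣ)
    (hc : (a : Matrix N N F)ᵀ * J * (a : Matrix N N F) = (c : F) • J)
    (hd : (b : Matrix N N F)ᵀ * J * (b : Matrix N N F) = (d : F) • J) :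
    ((a * b : GL N F) : Matrix N N F)ᵀ * J * ((a * b : GL N F) : Matrix N N F)
      = ((c * d : Fˣ) : F) • J := by
  calc ((a * b : GL N F) : Matrix N N F)ᵀ * J * ((a * b : GL N F) : Matrix N N F)
      = (b : Matrix N N F)ᵀ * ((a : Matrix N N F)ᵀ * J * (a : Matrix N N F)) *
          (b : Matrix N N F) := by
        rw [show ((a * b : GL N F) : Matrix N N F) = (a : Matrix N N F) * b from rfl,
          transpose_mul]
        simp only [Matrix.mul_assoc]
    _ = (b : Matrix N N F)ᵀ * ((c : F) • J) * (b : Matrix N N F) := by rw [hc]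
    _ = (c : F) • ((b : Matrix N N F)ᵀ * J * (b : Matrix N N F)) := by
        rw [Matrix.mul_smul, Matrix.smul_mul]
    _ = (c : F) • ((d : F) • J) := by rw [hd]
    _ = ((c * d : Fˣ) : F) • J := by rw [smul_smul, Units.val_mul]

theorem sim_inv {J : Matrix N N F} (a : GL N F) (c : Fˣ)
    (hc : (a : Matrix N N F)ᵀ * J * (a : Matrix N N F) = (c : F) • J) :
    ((a⁻¹ : GL N F) : Matrix N N F)ᵀ * J * ((a⁻¹ : GL N F) : Matrix N N F)
      = ((c⁻¹ : Fˣ) : F) • J := by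
  have ht : ((a⁻¹ : GL N F) : Matrix N N F)ᵀ * (a : Matrix N N F)ᵀ = 1 := by
    rw [← transpose_mul, a.mul_inv, transpose_one]
  have key : ((a⁻¹ : GL N F) : Matrix N N F)ᵀ * ((a : Matrix N N F)ᵀ * J * (a : Matrix N N F)) *
      ((a⁻¹ : GL N F) : Matrix N N F) = J := by
    calc ((a⁻¹ : GL N F) : Matrix N N F)ᵀ * ((a : Matrix N N F)ᵀ * J * (a : Matrix N N F)) *
        ((a⁻¹ : GL N F) : Matrix N N F)
        = (((a⁻¹ : GL N F) : Matrix N N F)ᵀ * (a : Matrix N N F)ᵀ) * J *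
          ((a : Matrix N N F) * ((a⁻¹ : GL N F) : Matrix N N F)) := by
          simp only [Matrix.mul_assoc]
      _ = J := by rw [ht, a.mul_inv, Matrix.one_mul, Matrix.mul_one]
  have key2 : ((a⁻¹ : GL N F) : Matrix N N F)ᵀ * ((c : F) • J) * ((a⁻¹ : GL N F) : Matrix N N F)
      = (c : F) • (((a⁻¹ : GL N F) : Matrix N N F)ᵀ * J * ((a⁻¹ : GL N F) : Matrix N N F)) := by
    rw [Matrix.mul_smul, Matrix.smul_mul]
  have h3 : (c : F) • (((a⁻¹ : GL N F) : Matrix N N F)ᵀ * J *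
      ((a⁻¹ : GL N F) : Matrix N N F)) = J := by rw [← key2, ← hc, key]
  calc ((a⁻¹ : GL N F) : Matrix N N F)ᵀ * J * ((a⁻¹ : GL N F) : Matrix N N F)
      = ((c⁻¹ : Fˣ) : F) • ((c : F) • (((a⁻¹ : GL N F) : Matrix N N F)ᵀ * J *
          ((a⁻¹ : GL N F) : Matrix N N F))) := by
        rw [smul_smul, ← Units.val_mul, inv_mul_cancel, Units.val_one, one_smul]
    _ = ((c⁻¹ : Fˣ) : F) • J := by rw [h3]

/-- The similitude group of the bilinear form given by the matrix `J`:  all invertible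
matrices `g` with `gᵀ * J * g = c • J` for some nonzero scalar `c` (the similitude of `g`). -/
def similitudeGroup (J : Matrix N N F) : Subgroup (GL N F) where
  carrier := {g | ∃ c : Fˣ, (g : Matrix N N F)ᵀ * J * (g : Matrix N N F) = (c : F) • J}
  one_mem' := ⟨1, sim_one J⟩
  mul_mem' := by rintro a b ⟨c, hc⟩ ⟨d, hd⟩; exact ⟨c * d, sim_mul a b c d hc hd⟩
  inv_mem' := by rintro a ⟨c, hc⟩; exact ⟨c⁻¹, sim_inv a c hc⟩

/-- The isometry group of the bilinear form given by the matrix `J`:  all invertible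
matrices `g` with `gᵀ * J * g = J`. -/
def fixGroup (J : Matrix N N F) : Subgroup (GL N F) where
  carrier := {g | (g : Matrix N N F)ᵀ * J * (g : Matrix N N F) = J}
  one_mem' := by simp
  mul_mem' := by
    intro a b ha hb
    have := sim_mul (J := J) a b 1 1 (by simpa using ha) (by simpa using hb)
    simpa using this
  inv_mem' := by
    intro a ha
    have := sim_inv (J := J) a 1 (by simpa using ha)
    simpa using this

/-- The group of isometries of determinant one of the bilinear form given by the matrix `J`. -/
def specialFixGroup (J : Matrix N N F) : Subgroup (GL N F) where
  carrier := {g | (g : Matrix N N F)ᵀ * J * (g : Matrix N N F) = J ∧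
    ((g : Matrix N N F)).det = 1}
  one_mem' := ⟨by simp, by simp⟩
  mul_mem' := by
    rintro a b ⟨ha1, ha2⟩ ⟨hb1, hb2⟩
    refine ⟨(fixGroup J).mul_mem ha1 hb1, ?_⟩
    rw [show ((a * b : GL N F) : Matrix N N F) = (a : Matrix N N F) * b from rfl,
      Matrix.det_mul, ha2, hb2, one_mul]
  inv_mem' := by
    rintro a ⟨ha1, ha2⟩
    refine ⟨(fixGroup J).inv_mem ha1, ?_⟩
    have h := congrArg Matrix.det a.mul_inv
    rw [Matrix.det_mul, ha2, one_mul, Matrix.det_one] at h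
    exact h

/-- The connected component of the similitude group of the symmetric bilinear form on a
`2 * m`-dimensional space given by the matrix `J`:  all similitudes `g`, with similitude
character `μ`, such that `det g = μ(g) ^ m`. -/
def connSimilitudeGroup (J : Matrix N N F) (m : ℕ) : Subgroup (GL N F) where
  carrier := {g | ∃ c : Fˣ, (g : Matrix N N F)ᵀ * J * (g : Matrix N N F) = (c : F) • J ∧
    ((g : Matrix N N F)).det = (c : F) ^ m}
  one_mem' := ⟨1, sim_one J, by simp⟩
  mul_mem' := by
    rintro a b ⟨c, hc1, hc2⟩ ⟨d, hd1, hd2⟩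
    refine ⟨c * d, sim_mul a b c d hc1 hd1, ?_⟩
    rw [show ((a * b : GL N F) : Matrix N N F) = (a : Matrix N N F) * b from rfl,
      Matrix.det_mul, hc2, hd2, Units.val_mul, mul_pow]
  inv_mem' := by
    rintro a ⟨c, hc1, hc2⟩
    refine ⟨c⁻¹, sim_inv a c hc1, ?_⟩
    have h := congrArg Matrix.det a.mul_inv
    rw [Matrix.det_mul, hc2, Matrix.det_one] at h
    have hc : ((c : F) ^ m)⁻¹ = ((c⁻¹ : Fˣ) : F) ^ m := by
      rw [← inv_pow]
      norm_cast
    rw [← hc]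
    exact (inv_eq_of_mul_eq_one_right h).symm

theorem neg_one_mem_similitudeGroup (J : Matrix N N F) : (-1 : GL N F) ∈ similitudeGroup J := by
  refine ⟨1, ?_⟩
  have h : ((-1 : GL N F) : Matrix N N F) = -1 := by simp
  rw [h]
  simp

/-- The standard symplectic form matrix `[[0, I], [-I, 0]]`. -/
def Jsp (n : ℕ) (F : Type*) [Field F] : Matrix (Fin n ⊕ Fin n) (Fin n ⊕ Fin n) F :=
  Matrix.fromBlocks 0 1 (-1) 0

/-- The standard split symmetric form matrix `[[0, I], [I, 0]]`. -/
def Jsplit (n : ℕ) (F : Type*) [Field F] : Matrix (Fin n ⊕ Fin n) (Fin n ⊕ Fin n) F :=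
  Matrix.fromBlocks 0 1 1 0

/-- A symmetric matrix `J` of size `2n` is split if it is congruent to `[[0, I], [I, 0]]`. -/
def IsSplit {n : ℕ} (J : Matrix (Fin n ⊕ Fin n) (Fin n ⊕ Fin n) F) : Prop :=
  ∃ P : GL (Fin n ⊕ Fin n) F,
    (P : Matrix (Fin n ⊕ Fin n) (Fin n ⊕ Fin n) F)ᵀ * J * P = Jsplit n F

/-- The symplectic similitude group `GSp(2n, F)`. -/
def GSp (n : ℕ) (F : Type*) [Field F] : Subgroup (GL (Fin n ⊕ Fin n) F) :=
  similitudeGroup (Jsp n F)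

/-- The symplectic group `Sp(2n, F)`. -/
def Sp (n : ℕ) (F : Type*) [Field F] : Subgroup (GL (Fin n ⊕ Fin n) F) :=
  fixGroup (Jsp n F)


/-- The underlying matrix of an element of a matrix subgroup. -/
def matOf {S : Subgroup (GL N F)} (g : ↥S) : Matrix N N F := ((g : GL N F) : Matrix N N F)

end Groups

noncomputable instance subgroupFintype {G : Type*} [Group G] [Finite G] (S : Subgroup G) :
    Fintype S := Fintype.ofFinite _

namespace OrthSim

section Irreducible

variable {M : Type} [Group M] {W : Type} [AddCommGroup W] [Module ℂ W]

/-- A map on a group whose restriction to the subgroup `K` is a linear representation. -/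
structure RepOn (K : Subgroup M) (ρ : M → W →ₗ[ℂ] W) : Prop where
  one : ρ 1 = 1
  mul : ∀ a ∈ K, ∀ b ∈ K, ρ (a * b) = ρ a * ρ b

/-- A subspace stable under all elements of `K`. -/
def Stable (K : Subgroup M) (ρ : M → W →ₗ[ℂ] W) (X : Submodule ℂ W) : Prop :=
  ∀ k ∈ K, ∀ x ∈ X, ρ k x ∈ X

/-- `ρ` restricts to an irreducible representation of `K`. -/
structure IrrOn (K : Subgroup M) (ρ : M → W →ₗ[ℂ] W) : Prop extends RepOn K ρ where
  nontriv : Nontrivial W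
  eq_bot_or_top : ∀ X, Stable K ρ X → X = ⊥ ∨ X = ⊤

/-- `b (k v) (hkh⁻¹ w) = b v w` for `k ∈ K`. -/
def TwInv (K : Subgroup M) (h : M) (ρ : M → W →ₗ[ℂ] W) (b : W →ₗ[ℂ] W →ₗ[ℂ] ℂ) : Prop :=
  ∀ k ∈ K, ∀ v w, b (ρ k v) (ρ (h * k * h⁻¹) w) = b v w

/-- Conjugation by `h` maps `K` to itself. -/
def Nrm (h : M) (K : Subgroup M) : Prop := ∀ k ∈ K, h * k * h⁻¹ ∈ K

/-- No irreducible representation of `K` carries a nonzero skew `h`-twisted invariant form. -/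
def NoSkew (K : Subgroup M) (h : M) : Prop :=
  ∀ (W : Type) [AddCommGroup W] [Module ℂ W] [FiniteDimensional ℂ W] (ρ : M → W →ₗ[ℂ] W),
    IrrOn K ρ → ∀ b : W →ₗ[ℂ] W →ₗ[ℂ] ℂ, TwInv K h ρ b → (∀ v w, b v w = -b w v) → b = 0

/-- Every irreducible representation of `K` carries a nonzero symmetric `h`-twisted
invariant form. -/
def HasSym (K : Subgroup M) (h : M) : Prop :=
  ∀ (W : Type) [AddCommGroup W] [Module ℂ W] [FiniteDimensional ℂ W] (ρ : M → W →ₗ[ℂ] W),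
    IrrOn K ρ → ∃ b : W →ₗ[ℂ] W →ₗ[ℂ] ℂ, TwInv K h ρ b ∧ (∀ v w, b v w = b w v) ∧ b ≠ 0

/-- A linear projection onto a subspace. -/
def prj (X : Submodule ℂ W) : W →ₗ[ℂ] X :=
  (X.subtype.exists_leftInverse_of_injective X.ker_subtype).choose

lemma prj_coe (X : Submodule ℂ W) (x : X) : prj X x = x :=
  LinearMap.congr_fun (X.subtype.exists_leftInverse_of_injective X.ker_subtype).choose_spec x

/-- The restriction of `ρ` to a subspace. -/
def subRep (ρ : M → W →ₗ[ℂ] W) (X : Submodule ℂ W) (g : M) : X →ₗ[ℂ] X :=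
  prj X ∘ₗ ρ g ∘ₗ X.subtype

variable {K : Subgroup M} {ρ : M → W →ₗ[ℂ] W}

lemma Stable.coe_subRep {X : Submodule ℂ W} (hX : Stable K ρ X) {k : M} (hk : k ∈ K) (x : X) :
    (subRep ρ X k x : W) = ρ k x := by
  have := prj_coe X ⟨ρ k x, hX k hk x x.2⟩
  simpa [subRep] using congrArg Subtype.val this

lemma RepOn.mono {K' : Subgroup M} (hρ : RepOn K ρ) (h : K' ≤ K) : RepOn K' ρ :=
  ⟨hρ.one, fun a ha b hb => hρ.mul a (h ha) b (h hb)⟩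

lemma RepOn.mul_apply (hρ : RepOn K ρ) {a b : M} (ha : a ∈ K) (hb : b ∈ K) (v : W) :
    ρ (a * b) v = ρ a (ρ b v) := by rw [hρ.mul a ha b hb]; rfl

lemma RepOn.inv_apply (hρ : RepOn K ρ) {a : M} (ha : a ∈ K) (v : W) :
    ρ a⁻¹ (ρ a v) = v := by
  rw [← hρ.mul_apply (K.inv_mem ha) ha, inv_mul_cancel, hρ.one]; rfl

lemma RepOn.apply_inv (hρ : RepOn K ρ) {a : M} (ha : a ∈ K) (v : W) :
    ρ a (ρ a⁻¹ v) = v := by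
  rw [← hρ.mul_apply ha (K.inv_mem ha), mul_inv_cancel, hρ.one]; rfl

lemma RepOn.subRep (hρ : RepOn K ρ) {X : Submodule ℂ W} (hX : Stable K ρ X) :
    RepOn K (subRep ρ X) where
  one := by
    ext x; rw [hX.coe_subRep K.one_mem, hρ.one]; rfl
  mul a ha b hb := by
    ext x
    rw [hX.coe_subRep (K.mul_mem ha hb), hρ.mul_apply ha hb, Module.End.mul_apply,
      hX.coe_subRep ha, hX.coe_subRep hb]

/-- The associated representation of the subgroup. -/
def RepOn.toRep (hρ : RepOn K ρ) : Representation ℂ K W where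
  toFun k := ρ k
  map_one' := hρ.one
  map_mul' a b := hρ.mul a a.2 b b.2

/-- Maschke's theorem. -/
lemma RepOn.exists_compl [Finite M] (hρ : RepOn K ρ) {X : Submodule ℂ W} (hX : Stable K ρ X) :
    ∃ Y, Stable K ρ Y ∧ IsCompl X Y := by
  have key := Subrepresentation.subrepresentationSubmoduleOrderIso (ρ := hρ.toRep)
  obtain ⟨Y, hY⟩ := (key.symm.complementedLattice).exists_isCompl
    (⟨X, fun k x hx => hX k k.2 x hx⟩ : Subrepresentation hρ.toRep)
  refine ⟨Y.toSubmodule, fun k hk x hx => Y.apply_mem_toSubmodule ⟨k, hk⟩ hx, ?_⟩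
  rw [isCompl_iff, disjoint_iff, codisjoint_iff] at hY ⊢
  exact ⟨congrArg Subrepresentation.toSubmodule hY.1, congrArg Subrepresentation.toSubmodule hY.2⟩

lemma stable_of_sub {X : Submodule ℂ W} (hX : Stable K ρ X) {Y : Submodule ℂ X}
    (hY : Stable K (subRep ρ X) Y) : Stable K ρ (Y.map X.subtype) := by
  rintro k hk _ ⟨y, hy, rfl⟩
  exact ⟨_, hY k hk y hy, hX.coe_subRep hk y⟩

/-- A nonzero stable subspace contains an irreducible one. -/
lemma RepOn.exists_irr [FiniteDimensional ℂ W] (hρ : RepOn K ρ) {Y : Submodule ℂ W}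
    (hY : Stable K ρ Y) (hY0 : Y ≠ ⊥) :
    ∃ X ≤ Y, X ≠ ⊥ ∧ Stable K ρ X ∧ IrrOn K (OrthSim.subRep ρ X) := by
  have := (wellFounded_lt (α := Submodule ℂ W)).has_min {X | X ≤ Y ∧ X ≠ ⊥ ∧ Stable K ρ X}
    ⟨Y, le_rfl, hY0, hY⟩
  obtain ⟨X, ⟨hXY, hX0, hX⟩, hmin⟩ := this
  refine ⟨X, hXY, hX0, hX, hρ.subRep hX, Submodule.nontrivial_iff_ne_bot.2 hX0, fun Z hZ => ?_⟩
  by_contra! hcon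
  have h1 := stable_of_sub hX hZ
  refine hmin (Z.map X.subtype) ⟨(Submodule.map_subtype_le _ _).trans hXY, ?_, h1⟩ ?_
  · intro h
    apply hcon.1
    apply Submodule.map_injective_of_injective X.injective_subtype
    rw [h, Submodule.map_bot]
  · refine lt_of_le_of_ne (Submodule.map_subtype_le _ _) fun h => hcon.2 ?_
    apply Submodule.map_injective_of_injective X.injective_subtype
    rw [h, Submodule.map_subtype_top]

variable {W' : Type} [AddCommGroup W'] [Module ℂ W'] {ρ' : M → W' →ₗ[ℂ] W'}

/-- Schur's lemma. -/
lemma IrrOn.scalar [FiniteDimensional ℂ W] (hρ : IrrOn K ρ) (f : W →ₗ[ℂ] W)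
    (hf : ∀ k ∈ K, ∀ v, f (ρ k v) = ρ k (f v)) : ∃ c : ℂ, ∀ v, f v = c • v := by
  have := hρ.nontriv
  obtain ⟨c, hc⟩ := Module.End.exists_eigenvalue f
  refine ⟨c, ?_⟩
  have hs : Stable K ρ (Module.End.eigenspace f c) := by
    intro k hk x hx
    rw [Module.End.mem_eigenspace_iff] at hx ⊢
    rw [hf k hk, hx, map_smul]
  rcases hρ.eq_bot_or_top _ hs with h | h
  · exact absurd h hc
  · intro v
    exact Module.End.mem_eigenspace_iff.1 (h ▸ Submodule.mem_top)

lemma IrrOn.injective_of_intertwine (hρ : IrrOn K ρ) (f : W →ₗ[ℂ] W')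
    (hf : ∀ k ∈ K, ∀ v, f (ρ k v) = ρ' k (f v)) (h0 : f ≠ 0) : Function.Injective f := by
  have hs : Stable K ρ (LinearMap.ker f) := by
    intro k hk x hx
    rw [LinearMap.mem_ker] at hx ⊢
    rw [hf k hk, hx, map_zero]
  rcases hρ.eq_bot_or_top _ hs with h | h
  · exact LinearMap.ker_eq_bot.1 h
  · exact absurd (LinearMap.ker_eq_top.1 h) h0

lemma IrrOn.surjective_of_intertwine (hρ : IrrOn K ρ') (f : W →ₗ[ℂ] W')
    (hf : ∀ k ∈ K, ∀ v, f (ρ k v) = ρ' k (f v)) (h0 : f ≠ 0) : Function.Surjective f := by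
  have hs : Stable K ρ' (LinearMap.range f) := by
    rintro k hk _ ⟨x, rfl⟩
    exact ⟨ρ k x, hf k hk x⟩
  rcases hρ.eq_bot_or_top _ hs with h | h
  · exact absurd (LinearMap.range_eq_bot.1 h) h0
  · exact LinearMap.range_eq_top.1 h

/-- A nonzero twisted invariant form on an irreducible representation is nondegenerate. -/
lemma IrrOn.form_injective (hρ : IrrOn K ρ) {h : M} (hh : Nrm h K) {b : W →ₗ[ℂ] W →ₗ[ℂ] ℂ}
    (hb : TwInv K h ρ b) (h0 : b ≠ 0) : Function.Injective b := by
  have hs : Stable K ρ (LinearMap.ker b) := by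
    intro k hk x hx
    rw [LinearMap.mem_ker] at hx ⊢
    ext w
    have := hb k hk x (ρ (h * k * h⁻¹)⁻¹ w)
    rw [hρ.apply_inv (hh k hk), hx] at this
    simpa using this
  rcases hρ.eq_bot_or_top _ hs with h | h
  · exact LinearMap.ker_eq_bot.1 h
  · exact absurd (LinearMap.ker_eq_top.1 h) h0

lemma form_bijective [FiniteDimensional ℂ W] {b : W →ₗ[ℂ] W →ₗ[ℂ] ℂ}
    (hb : Function.Injective b) : Function.Bijective b :=
  ⟨hb, (LinearMap.injective_iff_surjective_of_finrank_eq_finrank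
    (Subspace.dual_finrank_eq (K := ℂ) (V := W)).symm).1 hb⟩

/-- Twisted invariant forms on an irreducible representation are unique up to scalars. -/
lemma IrrOn.form_unique [FiniteDimensional ℂ W] (hρ : IrrOn K ρ) {h : M} (hh : Nrm h K)
    {b β : W →ₗ[ℂ] W →ₗ[ℂ] ℂ} (hb : TwInv K h ρ b) (h0 : b ≠ 0) (hβ : TwInv K h ρ β) :
    ∃ c : ℂ, ∀ v w, β v w = c * b v w := by
  let e := LinearEquiv.ofBijective b (form_bijective (hρ.form_injective hh hb h0))
  have he : ∀ x, b (e.symm x) = x := fun x => e.apply_symm_apply x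
  obtain ⟨c, hc⟩ := hρ.scalar (e.symm.toLinearMap ∘ₗ β) (by
    intro k hk v
    apply e.injective
    change b (e.symm (β (ρ k v))) = b (ρ k (e.symm (β v)))
    rw [he]
    ext w
    have h1 := hβ k hk v (ρ (h * k * h⁻¹)⁻¹ w)
    have h2 := hb k hk (e.symm (β v)) (ρ (h * k * h⁻¹)⁻¹ w)
    rw [hρ.apply_inv (hh k hk)] at h1 h2
    rw [h1, h2, he])
  refine ⟨c, fun v w => ?_⟩
  have := hc v
  simp only [LinearMap.comp_apply, LinearEquiv.coe_coe] at this
  rw [← he (β v), this, map_smul]; rfl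

end Irreducible

section TwistedForms

variable {M : Type} [Group M] {W : Type} [AddCommGroup W] [Module ℂ W]
variable {K : Subgroup M} {ρ : M → W →ₗ[ℂ] W}

lemma Nrm.conj_conj {h : M} (h2 : h * h = 1) (k : M) : h * (h * k * h⁻¹) * h⁻¹ = k := by
  have : h⁻¹ = h := inv_eq_of_mul_eq_one_left h2
  rw [this]
  calc h * (h * k * h) * h = (h * h) * k * (h * h) := by group
    _ = k := by rw [h2]; simp

/-- Multiplying the twist by an element of `K`. -/
lemma TwInv.exists_change {h h' : M} (hK : Nrm h K) (h2 : h * h = 1) (h2' : h' * h' = 1)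
    (ha : h' * h⁻¹ ∈ K) (hρ : RepOn K ρ) {b : W →ₗ[ℂ] W →ₗ[ℂ] ℂ} (hb : TwInv K h ρ b)
    (hs : ∀ v w, b v w = -b w v) :
    ∃ b' : W →ₗ[ℂ] W →ₗ[ℂ] ℂ, TwInv K h' ρ b' ∧ (∀ v w, b' v w = -b' w v) ∧
      (b' = 0 → b = 0) := by
  set a := h' * h⁻¹ with hadef
  have hh' : h' = a * h := by rw [hadef]; group
  have hK' : Nrm h' K := by
    intro k hk
    have : h' * k * h'⁻¹ = a * (h * k * h⁻¹) * a⁻¹ := by rw [hh']; group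
    rw [this]
    exact K.mul_mem (K.mul_mem ha (hK k hk)) (K.inv_mem ha)
  have hinv : h * a * h⁻¹ = a⁻¹ := by
    have e1 : h⁻¹ = h := inv_eq_of_mul_eq_one_left h2
    have e2 : h'⁻¹ = h' := inv_eq_of_mul_eq_one_left h2'
    simp only [hadef, _root_.mul_inv_rev, e2, e1]
    calc h * (h' * h) * h = h * h' * (h * h) := by group
      _ = h * h' := by rw [h2, mul_one]
  let b' : W →ₗ[ℂ] W →ₗ[ℂ] ℂ := b.compl₂ (ρ a⁻¹)
  have hb' : ∀ v w, b' v w = b v (ρ a⁻¹ w) := fun v w => rfl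
  have ha' := K.inv_mem ha
  refine ⟨b', ?_, ?_, fun h0 => ?_⟩
  · intro k hk v w
    rw [hb', hb', ← hρ.mul_apply ha' (hK' k hk)]
    have : a⁻¹ * (h' * k * h'⁻¹) = h * k * h⁻¹ * a⁻¹ := by rw [hh']; group
    rw [this, hρ.mul_apply (hK k hk) ha', hb k hk]
  · intro v w
    rw [hb', hb', hs, neg_inj]
    have := hb a ha (ρ a⁻¹ w) v
    rw [hρ.apply_inv ha, hinv] at this
    exact this.symm
  · ext v w
    have := LinearMap.congr_fun₂ h0 v (ρ a w)
    rw [hb', hρ.inv_apply ha] at this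
    simpa using this

/-- The absence of skew forms depends only on the class of the twist modulo `K`. -/
lemma NoSkew.change {h h' : M} (hK : Nrm h K) (h2 : h * h = 1) (h2' : h' * h' = 1)
    (ha : h' * h⁻¹ ∈ K) (H : NoSkew K h') : NoSkew K h := by
  intro W _ _ _ ρ hρ b hb hs
  obtain ⟨b', hb', hs', h0⟩ := hb.exists_change hK h2 h2' ha hρ.toRepOn hs
  exact h0 (H W ρ hρ b' hb' hs')

lemma IrrOn.of_map {M₁ : Type} [Group M₁] (j : M₁ →* M) {K₁ : Subgroup M₁}
    (hρ : IrrOn (K₁.map j) ρ) : IrrOn K₁ (ρ ∘ j) where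
  one := by simp [hρ.one]
  mul a ha b hb := by
    simp only [Function.comp, map_mul]
    exact hρ.mul _ (Subgroup.mem_map_of_mem j ha) _ (Subgroup.mem_map_of_mem j hb)
  nontriv := hρ.nontriv
  eq_bot_or_top X hX := hρ.eq_bot_or_top X (by
    rintro _ ⟨k, hk, rfl⟩ x hx
    exact hX k hk x hx)

/-- Transfer along a homomorphism. -/
lemma NoSkew.map {M₁ : Type} [Group M₁] (j : M₁ →* M) {K₁ : Subgroup M₁} {h₁ : M₁} {h : M}
    (hj : ∀ k ∈ K₁, j (h₁ * k * h₁⁻¹) = h * j k * h⁻¹) (H : NoSkew K₁ h₁) :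
    NoSkew (K₁.map j) h := by
  intro W _ _ _ ρ hρ b hb hs
  refine H W _ (hρ.of_map j) b ?_ hs
  intro k hk v w
  simp only [Function.comp, hj k hk]
  exact hb _ (Subgroup.mem_map_of_mem j hk) v w

lemma HasSym.map {M₁ : Type} [Group M₁] (j : M₁ →* M) {K₁ : Subgroup M₁} {h₁ : M₁} {h : M}
    (hj : ∀ k ∈ K₁, j (h₁ * k * h₁⁻¹) = h * j k * h⁻¹) (H : HasSym K₁ h₁) :
    HasSym (K₁.map j) h := by
  intro W _ _ _ ρ hρ
  obtain ⟨b, hb, hs, h0⟩ := H W _ (hρ.of_map j)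
  refine ⟨b, ?_, hs, h0⟩
  rintro _ ⟨k, hk, rfl⟩ v w
  have := hb k hk v w
  simpa only [Function.comp, hj k hk] using this

/-- Abelian groups carry no irreducible skew forms. -/
lemma NoSkew.of_comm {h : M} (hK : ∀ a ∈ K, ∀ b ∈ K, a * b = b * a) : NoSkew K h := by
  intro W _ _ _ ρ hρ b hb hs
  have hsc : ∀ k ∈ K, ∃ c : ℂ, ∀ v, ρ k v = c • v := fun k hk => hρ.scalar (ρ k) (by
    intro l hl v
    rw [← hρ.mul_apply hk hl, hK k hk l hl, hρ.mul_apply hl hk])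
  have := hρ.nontriv
  obtain ⟨v, hv⟩ := exists_ne (0 : W)
  have htop : ℂ ∙ v = ⊤ := by
    refine (hρ.eq_bot_or_top (ℂ ∙ v) ?_).resolve_left (by simpa using hv)
    intro k hk x hx
    obtain ⟨c, hc⟩ := hsc k hk
    rw [hc]
    exact Submodule.smul_mem _ _ hx
  ext x y
  obtain ⟨s, rfl⟩ := Submodule.mem_span_singleton.1 (htop ▸ Submodule.mem_top : x ∈ ℂ ∙ v)
  obtain ⟨t, rfl⟩ := Submodule.mem_span_singleton.1 (htop ▸ Submodule.mem_top : y ∈ ℂ ∙ v)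
  have h0 : b v v = 0 := by
    have := hs v v
    linear_combination this / 2
  simp [h0]

/-- The character. -/
def chr (ρ : M → W →ₗ[ℂ] W) (g : M) : ℂ := LinearMap.trace ℂ W (ρ g)

lemma RepOn.chr_conj (hρ : RepOn K ρ) {a g : M} (ha : a ∈ K) (hg : g ∈ K) :
    chr ρ (a * g * a⁻¹) = chr ρ g := by
  unfold chr
  rw [hρ.mul _ (K.mul_mem ha hg) _ (K.inv_mem ha), LinearMap.trace_mul_comm,
    ← hρ.mul _ (K.inv_mem ha) _ (K.mul_mem ha hg)]
  congr 2
  group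

lemma IrrOn.isIrreducible (hρ : IrrOn K ρ) :
    Representation.IsIrreducible (hρ.toRepOn.toRep) := by
  have := hρ.nontriv
  refine { exists_pair_ne := ⟨⊥, ⊤, ?_⟩, eq_bot_or_eq_top := fun X => ?_ }
  · intro h
    have := congrArg Subrepresentation.toSubmodule h
    exact bot_ne_top this
  · refine (hρ.eq_bot_or_top X.toSubmodule
      fun k hk x hx => X.apply_mem_toSubmodule ⟨k, hk⟩ hx).imp ?_ ?_
    · intro h; exact Subrepresentation.toSubmodule_injective h
    · intro h; exact Subrepresentation.toSubmodule_injective h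

variable [FiniteDimensional ℂ W]

lemma RepOn.chr_twist (hρ : RepOn K ρ) {h : M} (hh : Nrm h K)
    {b : W →ₗ[ℂ] W →ₗ[ℂ] ℂ} (hb : TwInv K h ρ b) (hbi : Function.Injective b) {g : M}
    (hg : g ∈ K) : chr ρ (h * g⁻¹ * h⁻¹) = chr ρ g := by
  let e := LinearEquiv.ofBijective b (form_bijective hbi)
  unfold chr
  have key : Module.Dual.transpose (R := ℂ) (ρ (h * g⁻¹ * h⁻¹)) = e.conj (ρ g) := by
    ext φ w
    obtain ⟨v, rfl⟩ := e.surjective φ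
    simp only [LinearEquiv.conj_apply_apply, LinearEquiv.symm_apply_apply]
    change b v (ρ (h * g⁻¹ * h⁻¹) w) = b (ρ g v) w
    have := hb g hg v (ρ (h * g⁻¹ * h⁻¹) w)
    rw [← this]
    congr 1
    rw [← hρ.mul_apply (hh g hg) (hh _ (K.inv_mem hg))]
    have : h * g * h⁻¹ * (h * g⁻¹ * h⁻¹) = 1 := by group
    rw [this, hρ.one]; rfl
  rw [← LinearMap.trace_transpose' (ρ (h * g⁻¹ * h⁻¹)), key, LinearMap.trace_conj']

variable [Fintype M]

lemma IrrOn.sum_chr_mul (hρ : IrrOn K ρ) :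
    ∑ k : K, chr ρ k * chr ρ (k⁻¹ : M) = Nat.card K := by
  have := hρ.isIrreducible
  have hne : (Nat.card K : ℂ) ≠ 0 := Nat.cast_ne_zero.2 Nat.card_pos.ne'
  let _ : Invertible (Nat.card K : ℂ) := invertibleOfNonzero hne
  have key := Representation.char_orthonormal (hρ.toRepOn.toRep) (hρ.toRepOn.toRep)
  rw [if_pos ⟨Representation.Equiv.refl _⟩, inv_mul_eq_iff_eq_mul₀ hne, mul_one] at key
  exact key

/-- An averaging construction of twisted invariant forms. -/
lemma IrrOn.exists_form (hρ : IrrOn K ρ) {h : M} (hh : Nrm h K)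
    (hreal : ∀ g ∈ K, ∃ d, d * h⁻¹ ∈ K ∧ d * g * d⁻¹ = g⁻¹) :
    ∃ b : W →ₗ[ℂ] W →ₗ[ℂ] ℂ, TwInv K h ρ b ∧ b ≠ 0 := by
  by_contra! hcon
  have h1 : ∑ k : K, chr ρ k * chr ρ (h * k * h⁻¹) = Nat.card K := by
    rw [← hρ.sum_chr_mul]
    refine Finset.sum_congr rfl fun k _ => ?_
    congr 1
    obtain ⟨d, hd, hdk⟩ := hreal k k.2
    rw [← hdk, ← hρ.toRepOn.chr_conj hd (hh k k.2)]
    congr 1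
    group
  let B := Module.finBasis ℂ W
  have h2 : ∑ k : K, chr ρ k * chr ρ (h * k * h⁻¹) = 0 := by
    have htr : ∀ g, chr ρ g = ∑ i, B.repr (ρ g (B i)) i := by
      intro g
      rw [chr, LinearMap.trace_eq_matrix_trace ℂ B]
      simp [Matrix.trace, LinearMap.toMatrix_apply]
    simp_rw [htr, Finset.sum_mul_sum]
    rw [Finset.sum_comm]
    refine Finset.sum_eq_zero fun i _ => ?_
    rw [Finset.sum_comm]
    refine Finset.sum_eq_zero fun j _ => ?_
    let β : W →ₗ[ℂ] W →ₗ[ℂ] ℂ := ∑ k : K,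
      (LinearMap.mul ℂ ℂ).compl₁₂ (B.coord i ∘ₗ ρ k) (B.coord j ∘ₗ ρ (h * k * h⁻¹))
    have hβ : ∀ v w, β v w = ∑ k : K, B.repr (ρ k v) i * B.repr (ρ (h * k * h⁻¹) w) j := by
      intro v w
      simp [β, LinearMap.sum_apply]
    rw [← hβ, hcon β]
    · rfl
    · intro l hl v w
      rw [hβ, hβ]
      refine Fintype.sum_equiv (Equiv.mulRight ⟨l, hl⟩) _ _ fun k => ?_
      simp only [Equiv.coe_mulRight, Subgroup.coe_mul]
      rw [hρ.mul_apply k.2 hl]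
      have : h * (k * l) * h⁻¹ = (h * k * h⁻¹) * (h * l * h⁻¹) := by group
      rw [this, hρ.mul_apply (hh k k.2) (hh l hl)]
  rw [h1] at h2
  exact Nat.card_pos.ne' (Nat.cast_eq_zero.1 h2)

end TwistedForms

/-- Real twisted characters together with the absence of skew forms produce symmetric forms. -/
lemma NoSkew.hasSym {M : Type} [Group M] [Fintype M] {K : Subgroup M} {h : M}
    (H : NoSkew K h) (hh : Nrm h K) (h2 : h * h = 1)
    (hreal : ∀ g ∈ K, ∃ d, d * h⁻¹ ∈ K ∧ d * g * d⁻¹ = g⁻¹) : HasSym K h := by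
  intro W _ _ _ ρ hρ
  obtain ⟨b, hb, h0⟩ := hρ.exists_form hh hreal
  have hflip : TwInv K h ρ b.flip := by
    intro k hk v w
    have := hb _ (hh k hk) w v
    rw [Nrm.conj_conj h2] at this
    simpa using this
  have hskew : b - b.flip = 0 := by
    refine H W ρ hρ _ ?_ ?_
    · intro k hk v w
      simp only [LinearMap.sub_apply]
      rw [hb k hk, hflip k hk]
    · intro v w; simp
  refine ⟨b, hb, fun v w => ?_, h0⟩
  have := LinearMap.congr_fun₂ hskew v w
  simp only [LinearMap.sub_apply, LinearMap.flip_apply, LinearMap.zero_apply] at this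
  exact sub_eq_zero.1 this

section TwistInvariant

variable {M : Type} [Group M]

lemma TwInv.mono {W : Type} [AddCommGroup W] [Module ℂ W] {K K' : Subgroup M} {h : M}
    {ρ : M → W →ₗ[ℂ] W} {b : W →ₗ[ℂ] W →ₗ[ℂ] ℂ} (hb : TwInv K h ρ b) (hK : K' ≤ K) :
    TwInv K' h ρ b := fun k hk => hb k (hK hk)

/-- Restriction of a bilinear form to a subspace. -/
def resForm {W : Type} [AddCommGroup W] [Module ℂ W] (b : W →ₗ[ℂ] W →ₗ[ℂ] ℂ)
    (X : Submodule ℂ W) : X →ₗ[ℂ] X →ₗ[ℂ] ℂ := b.compl₁₂ X.subtype X.subtype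

lemma TwInv.res {W : Type} [AddCommGroup W] [Module ℂ W] {K : Subgroup M} {h : M}
    {ρ : M → W →ₗ[ℂ] W} {b : W →ₗ[ℂ] W →ₗ[ℂ] ℂ} (hb : TwInv K h ρ b) (hh : Nrm h K)
    {X : Submodule ℂ W} (hX : Stable K ρ X) : TwInv K h (subRep ρ X) (resForm b X) := by
  intro k hk v w
  simp only [resForm, LinearMap.compl₁₂_apply, Submodule.subtype_apply]
  rw [hX.coe_subRep hk, hX.coe_subRep (hh k hk), hb k hk]

/-- On an irreducible constituent of a `NoSkew` group a skew form vanishes. -/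
lemma NoSkew.isotropic {W : Type} [AddCommGroup W] [Module ℂ W] [FiniteDimensional ℂ W]
    {K : Subgroup M} {h : M} (H : NoSkew K h) (hh : Nrm h K)
    {ρ : M → W →ₗ[ℂ] W} {b : W →ₗ[ℂ] W →ₗ[ℂ] ℂ} (hb : TwInv K h ρ b)
    (hs : ∀ v w, b v w = -b w v) {X : Submodule ℂ W} (hX : Stable K ρ X)
    (hXi : IrrOn K (subRep ρ X)) : ∀ x ∈ X, ∀ y ∈ X, b x y = 0 := by
  intro x hx y hy
  have := H X (subRep ρ X) hXi (resForm b X) (hb.res hh hX) fun v w => hs v w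
  exact LinearMap.congr_fun₂ this ⟨x, hx⟩ ⟨y, hy⟩

/-- Products of commuting subgroups. -/
lemma NoSkew.prod {K K₁ K₂ : Subgroup M} {h : M} (h1 : K₁ ≤ K) (h2 : K₂ ≤ K)
    (hK : ∀ k ∈ K, ∃ a ∈ K₁, ∃ b ∈ K₂, k = a * b)
    (hcomm : ∀ a ∈ K₁, ∀ b ∈ K₂, a * b = b * a) (hn1 : Nrm h K₁) (hn2 : Nrm h K₂)
    (H1 : HasSym K₁ h) (H2 : NoSkew K₂ h) : NoSkew K h := by
  intro W _ _ _ ρ hρ b hb hs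
  have hρ1 := hρ.toRepOn.mono h1
  have hρ2 := hρ.toRepOn.mono h2
  have := hρ.nontriv
  obtain ⟨X, -, hX0, hXs, hXi⟩ := hρ1.exists_irr (Y := ⊤) (fun _ _ _ _ => Submodule.mem_top)
    top_ne_bot
  obtain ⟨b₁, hb₁, hs₁, hb₁0⟩ := H1 X _ hXi
  obtain ⟨x₀, y₀, hxy⟩ : ∃ x y, b₁ x y = 1 := by
    obtain ⟨x, hx⟩ : ∃ x, b₁ x ≠ 0 := by
      by_contra! hc; exact hb₁0 (LinearMap.ext hc)
    obtain ⟨y, hy⟩ : ∃ y, b₁ x y ≠ 0 := by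
      by_contra! hc; exact hx (LinearMap.ext hc)
    exact ⟨x, (b₁ x y)⁻¹ • y, by simp [hy]⟩
  -- the action of `K₂` on the space of maps from `X`
  let τ : M → (X →ₗ[ℂ] W) →ₗ[ℂ] (X →ₗ[ℂ] W) := fun g => LinearMap.llcomp ℂ X W W (ρ g)
  have hτ : ∀ g f x, τ g f x = ρ g (f x) := fun g f x => rfl
  have hτrep : RepOn K₂ τ := by
    refine ⟨?_, fun a ha b hb => ?_⟩
    · ext f x; rw [hτ, hρ.one]; rfl
    · ext f x; rw [hτ, hρ2.mul_apply ha hb]; rfl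
  let Y : Submodule ℂ (X →ₗ[ℂ] W) :=
    { carrier := {f | ∀ k ∈ K₁, ∀ x, f (subRep ρ X k x) = ρ k (f x)}
      add_mem' := by
        intro f g hf hg k hk x
        simp [hf k hk, hg k hk]
      zero_mem' := by intro k hk x; simp
      smul_mem' := by intro c f hf k hk x; simp [hf k hk] }
  have hYs : Stable K₂ τ Y := by
    intro k hk f hf l hl x
    rw [hτ, hτ, hf l hl, ← hρ.mul_apply (h2 hk) (h1 hl), ← hcomm l hl k hk,
      hρ.mul_apply (h1 hl) (h2 hk)]
  have hY0 : Y ≠ ⊥ := by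
    intro hbot
    have hmem : X.subtype ∈ Y := fun k hk x => hXs.coe_subRep hk x
    rw [hbot, Submodule.mem_bot] at hmem
    obtain ⟨x, hx, hx0⟩ := (Submodule.ne_bot_iff X).1 hX0
    exact hx0 (LinearMap.congr_fun hmem ⟨x, hx⟩)
  obtain ⟨Y', hY'Y, hY'0, hY's, hY'i⟩ := hτrep.exists_irr hYs hY0
  let lam : (X →ₗ[ℂ] W) →ₗ[ℂ] (X →ₗ[ℂ] W) →ₗ[ℂ] ℂ :=
    b.compl₁₂ (LinearMap.applyₗ x₀) (LinearMap.applyₗ y₀)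
  have hlam : ∀ f g, lam f g = b (f x₀) (g y₀) := fun f g => rfl
  have hfact : ∀ f ∈ Y, ∀ g ∈ Y, ∀ x y, b (f x) (g y) = lam f g * b₁ x y := by
    intro f hf g hg x y
    obtain ⟨c, hc⟩ := hXi.form_unique hn1 hb₁ hb₁0 (β := b.compl₁₂ f g) (by
      intro k hk v w
      simp only [LinearMap.compl₁₂_apply]
      rw [hf k hk, hg _ (hn1 k hk), hb k (h1 hk)])
    have hc' : ∀ x y, b (f x) (g y) = c * b₁ x y := hc
    rw [hc', hlam, hc', hxy, mul_one]
  have hlam0 : ∀ f ∈ Y', ∀ g ∈ Y', lam f g = 0 := by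
    intro f hf g hg
    have := H2 Y' _ hY'i (resForm lam Y') ?_ ?_
    · exact LinearMap.congr_fun₂ this ⟨f, hf⟩ ⟨g, hg⟩
    · refine TwInv.res ?_ hn2 hY's
      intro k hk f g
      rw [hlam, hlam, hτ, hτ, hb k (h2 hk)]
    · rintro ⟨f, hf⟩ ⟨g, hg⟩
      change lam f g = - lam g f
      rw [hlam f g, hs, hfact g (hY'Y hg) f (hY'Y hf), hs₁, hxy, mul_one]
  let Z : Submodule ℂ W := Submodule.span ℂ {w | ∃ f ∈ Y', ∃ x, w = f x}
  have hZs : Stable K ρ Z := by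
    intro k hk z hz
    obtain ⟨k₁, hk₁, k₂, hk₂, rfl⟩ := hK k hk
    induction hz using Submodule.span_induction with
    | mem w hw =>
      obtain ⟨f, hf, x, rfl⟩ := hw
      refine Submodule.subset_span ⟨τ k₂ f, hY's k₂ hk₂ f hf, subRep ρ X k₁ x, ?_⟩
      rw [hρ.mul_apply (h1 hk₁) (h2 hk₂), hYs k₂ hk₂ f (hY'Y hf) k₁ hk₁]; rfl
    | zero => simp
    | add v w _ _ hv hw => rw [map_add]; exact Z.add_mem hv hw
    | smul c v _ hv => rw [map_smul]; exact Z.smul_mem c hv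
  have hZtop : Z = ⊤ := by
    refine (hρ.eq_bot_or_top Z hZs).resolve_left fun hbot => hY'0 ?_
    rw [Submodule.eq_bot_iff]
    intro f hf
    ext x
    have : f x ∈ Z := Submodule.subset_span ⟨f, hf, x, rfl⟩
    rw [hbot, Submodule.mem_bot] at this
    exact this
  ext v w
  have hv : v ∈ Z := hZtop ▸ Submodule.mem_top
  have hw : w ∈ Z := hZtop ▸ Submodule.mem_top
  rw [LinearMap.zero_apply, LinearMap.zero_apply]
  induction hv using Submodule.span_induction with
  | mem v hv =>
    obtain ⟨f, hf, x, rfl⟩ := hv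
    induction hw using Submodule.span_induction with
    | mem w hw =>
      obtain ⟨g, hg, y, rfl⟩ := hw
      rw [hfact f (hY'Y hf) g (hY'Y hg), hlam0 f hf g hg, zero_mul]
    | zero => simp
    | add v w _ _ hv hw => rw [map_add, hv, hw, add_zero]
    | smul c v _ hv => rw [map_smul, hv, smul_zero]
  | zero => simp
  | add v w _ _ hv hw => rw [map_add, LinearMap.add_apply, hv, hw, add_zero]
  | smul c v _ hv => rw [map_smul, LinearMap.smul_apply, hv, smul_zero]

end TwistInvariant

section IndexTwo

variable {M : Type} [Group M] {W : Type} [AddCommGroup W] [Module ℂ W]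
  {K : Subgroup M} {ρ : M → W →ₗ[ℂ] W}

lemma RepOn.irr_sub (hρ : RepOn K ρ) {X : Submodule ℂ W} (hX : Stable K ρ X) (h0 : X ≠ ⊥)
    (hmin : ∀ Z ≤ X, Stable K ρ Z → Z = ⊥ ∨ Z = X) :
    IrrOn K (OrthSim.subRep ρ X) := by
  refine ⟨hρ.subRep hX, Submodule.nontrivial_iff_ne_bot.2 h0, fun Z hZ => ?_⟩
  rcases hmin _ (Submodule.map_subtype_le _ _) (stable_of_sub hX hZ) with h | h
  · left
    apply Submodule.map_injective_of_injective X.injective_subtype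
    rw [h, Submodule.map_bot]
  · right
    apply Submodule.map_injective_of_injective X.injective_subtype
    rw [h, Submodule.map_subtype_top]

lemma IrrOn.sub_min {X : Submodule ℂ W} (hXi : IrrOn K (subRep ρ X)) (hX : Stable K ρ X)
    {Z : Submodule ℂ W} (hZX : Z ≤ X) (hZ : Stable K ρ Z) : Z = ⊥ ∨ Z = X := by
  have hs : Stable K (subRep ρ X) (Z.comap X.subtype) := by
    intro k hk x hx
    change ((subRep ρ X k x : X) : W) ∈ Z
    rw [hX.coe_subRep hk]
    exact hZ k hk _ hx
  have hmap : (Z.comap X.subtype).map X.subtype = Z := by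
    rw [Submodule.map_comap_subtype, inf_eq_right.2 hZX]
  rcases hXi.eq_bot_or_top _ hs with h | h
  · left; rw [← hmap, h, Submodule.map_bot]
  · right; rw [← hmap, h, Submodule.map_subtype_top]

variable [FiniteDimensional ℂ W]

/-- Extension of the absence of skew forms through a subgroup of index at most two. -/
lemma skew_eq_zero_of_index_two {A A' : Subgroup M} (hA : A' ≤ A) {w : M} (hw : w ∈ A)
    (hind : ∀ a ∈ A, a ∈ A' ∨ w⁻¹ * a ∈ A') (hρ : IrrOn A ρ)
    (b : W →ₗ[ℂ] W →ₗ[ℂ] ℂ) (hs : ∀ v w, b v w = -b w v)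
    (hi : ∀ X, Stable A' ρ X → IrrOn A' (subRep ρ X) → ∀ x ∈ X, ∀ y ∈ X, b x y = 0)
    (hii : ∀ X Y, Stable A' ρ X → IrrOn A' (subRep ρ X) → Stable A' ρ Y →
      IrrOn A' (subRep ρ Y) → ∀ x ∈ X, ∀ y ∈ Y, b x y ≠ 0 →
      ∃ φ : X →ₗ[ℂ] W, (∀ k ∈ A', ∀ x, φ (subRep ρ X k x) = ρ k (φ x)) ∧
        Function.Injective φ ∧ LinearMap.range φ = Y) : b = 0 := by
  by_contra hb0
  have hρ' := hρ.toRepOn.mono hA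
  have hwi := A.inv_mem hw
  have hwA' : w ∉ A' := by
    intro hwA'
    have heq : A' = A := by
      refine le_antisymm hA fun a ha => (hind a ha).elim id fun h => ?_
      have := A'.mul_mem hwA' h
      rwa [mul_inv_cancel_left] at this
    subst heq
    have hst : Stable A' ρ ⊤ := fun _ _ _ _ => Submodule.mem_top
    have := hi ⊤ hst (hρ'.irr_sub hst (by have := hρ.nontriv; exact top_ne_bot)
      fun Z _ hZ => hρ.eq_bot_or_top Z hZ)
    exact hb0 (by ext x y; exact this x trivial y trivial)
  have hw2 : w * w ∈ A' := by
    rcases hind _ (A.mul_mem hw hw) with h | h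
    · exact h
    · rw [inv_mul_cancel_left] at h; exact absurd h hwA'
  have hc1 : ∀ k ∈ A', w * k * w⁻¹ ∈ A' := by
    intro k hk
    rcases hind _ (A.mul_mem (A.mul_mem hw (hA hk)) hwi) with h | h
    · exact h
    · exfalso
      have h3 : k * w⁻¹ ∈ A' := by
        have : w⁻¹ * (w * k * w⁻¹) = k * w⁻¹ := by group
        rwa [this] at h
      have := A'.inv_mem (A'.mul_mem (A'.inv_mem hk) h3)
      rw [inv_mul_cancel_left, inv_inv] at this
      exact hwA' this
  have hc2 : ∀ k ∈ A', w⁻¹ * k * w ∈ A' := by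
    intro k hk
    have h1 := hc1 k hk
    have : w⁻¹ * k * w = (w * w)⁻¹ * (w * k * w⁻¹) * (w * w) := by group
    rw [this]
    exact A'.mul_mem (A'.mul_mem (A'.inv_mem hw2) h1) hw2
  have := hρ.nontriv
  obtain ⟨X, -, hX0, hX, hXi⟩ := hρ'.exists_irr (Y := ⊤) (fun _ _ _ _ => Submodule.mem_top)
    top_ne_bot
  have hρwk : ∀ k ∈ A', ∀ v, ρ k (ρ w v) = ρ w (ρ (w⁻¹ * k * w) v) := by
    intro k hk v
    rw [← hρ.mul_apply (hA hk) hw, ← hρ.mul_apply hw (hA (hc2 k hk))]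
    congr 2
    group
  have hρwk' : ∀ k ∈ A', ∀ v, ρ w (ρ k v) = ρ (w * k * w⁻¹) (ρ w v) := by
    intro k hk v
    rw [← hρ.mul_apply (hA (hc1 k hk)) hw, ← hρ.mul_apply hw (hA hk)]
    congr 2
    group
  set wX : Submodule ℂ W := X.map (ρ w) with hwX
  have hwXs : Stable A' ρ wX := by
    rintro k hk _ ⟨x, hx, rfl⟩
    rw [hρwk k hk]
    exact ⟨_, hX _ (hc2 k hk) x hx, rfl⟩
  have hinjw : Function.Injective (ρ w) := fun x y hxy => by
    rw [← hρ.inv_apply hw x, hxy, hρ.inv_apply hw]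
  have hwX0 : wX ≠ ⊥ := by
    obtain ⟨x, hx, hx0⟩ := (Submodule.ne_bot_iff X).1 hX0
    refine (Submodule.ne_bot_iff _).2 ⟨ρ w x, ⟨x, hx, rfl⟩, fun h => hx0 (hinjw ?_)⟩
    rw [h, map_zero]
  have hwXi : IrrOn A' (subRep ρ wX) := by
    refine hρ'.irr_sub hwXs hwX0 fun Z hZ hZs => ?_
    have hcs : Stable A' ρ (Z.comap (ρ w)) := by
      intro k hk x hx
      rw [Submodule.mem_comap] at hx ⊢
      rw [hρwk' k hk]
      exact hZs _ (hc1 k hk) _ hx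
    have hle : Z.comap (ρ w) ≤ X := by
      intro x hx
      obtain ⟨x', hx', he⟩ := hZ hx
      exact hinjw he ▸ hx'
    have hmap : (Z.comap (ρ w)).map (ρ w) = Z := by
      apply Submodule.map_comap_eq_of_le
      rintro z hz
      obtain ⟨x', hx', he⟩ := hZ hz
      exact ⟨x', he⟩
    rcases hXi.sub_min hX hle hcs with h | h
    · left; rw [← hmap, h, Submodule.map_bot]
    · right; rw [← hmap, h]
  have hw2X : ∀ x ∈ X, ρ w (ρ w x) ∈ X := by
    intro x hx
    rw [← hρ.mul_apply hw hw]
    exact hX _ hw2 x hx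
  have hsum : X ⊔ wX = ⊤ := by
    refine (hρ.eq_bot_or_top _ ?_).resolve_left fun h => hX0 (by
      rw [← le_bot_iff, ← h]; exact le_sup_left)
    have hA's : Stable A' ρ (X ⊔ wX) := by
      intro k hk x hx
      obtain ⟨y, hy, z, hz, rfl⟩ := Submodule.mem_sup.1 hx
      rw [map_add]
      exact Submodule.add_mem_sup (hX k hk y hy) (hwXs k hk z hz)
    have hws : ∀ x ∈ X ⊔ wX, ρ w x ∈ X ⊔ wX := by
      intro x hx
      obtain ⟨y, hy, z, ⟨u, hu, rfl⟩, rfl⟩ := Submodule.mem_sup.1 hx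
      rw [map_add, add_comm]
      exact Submodule.add_mem_sup (hw2X u hu) ⟨y, hy, rfl⟩
    intro a ha x hx
    rcases hind a ha with h | h
    · exact hA's a h x hx
    · have : a = w * (w⁻¹ * a) := by group
      rw [this, hρ.mul_apply hw (hA h)]
      exact hws _ (hA's _ h x hx)
  have hX1 := hi X hX hXi
  have hX2 := hi wX hwXs hwXi
  obtain ⟨x₀, hx₀, y₀, hy₀, hxy⟩ : ∃ x ∈ X, ∃ y ∈ wX, b x y ≠ 0 := by
    by_contra! hcon
    apply hb0
    ext u v
    obtain ⟨x, hx, y, hy, rfl⟩ := Submodule.mem_sup.1 (hsum ▸ Submodule.mem_top : u ∈ X ⊔ wX)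
    obtain ⟨x', hx', y', hy', rfl⟩ := Submodule.mem_sup.1 (hsum ▸ Submodule.mem_top : v ∈ X ⊔ wX)
    simp [hX1 x hx x' hx', hX2 y hy y' hy', hcon x hx y' hy', hs y x', hcon x' hx' y hy]
  have hdisj : X ⊓ wX = ⊥ := by
    refine (hXi.sub_min hX inf_le_left fun k hk x hx =>
      ⟨hX k hk x hx.1, hwXs k hk x hx.2⟩).resolve_right fun h => ?_
    exact hxy (hX2 x₀ (inf_eq_left.1 h hx₀) y₀ hy₀)
  obtain ⟨φ, hφ, hφi, hφr⟩ := hii X wX hX hXi hwXs hwXi x₀ hx₀ y₀ hy₀ hxy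
  have hφX : ∀ x, ρ w⁻¹ (φ x) ∈ X := by
    intro x
    obtain ⟨u, hu, hux⟩ : φ x ∈ wX := hφr ▸ ⟨x, rfl⟩
    rw [← hux, hρ.inv_apply hw]
    exact hu
  let θ : X →ₗ[ℂ] X := LinearMap.codRestrict X (ρ w⁻¹ ∘ₗ φ) hφX
  have hθ : ∀ x, ρ w (θ x : W) = φ x := fun x => hρ.apply_inv hw (φ x)
  have hθk : ∀ k ∈ A', ∀ x, θ (subRep ρ X k x) = subRep ρ X (w⁻¹ * k * w) (θ x) := by
    intro k hk x
    apply Subtype.ext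
    apply hinjw
    rw [hθ, hφ k hk, hX.coe_subRep (hc2 k hk), ← hρwk k hk, hθ]
  have hθi : Function.Injective θ := fun x y hxy => hφi (by rw [← hθ, hxy, hθ])
  let ρX := subRep ρ X
  have hρX : RepOn A' ρX := hρ'.subRep hX
  let T : X →ₗ[ℂ] X := ρX (w * w) ∘ₗ θ ∘ₗ θ
  obtain ⟨c, hc⟩ := hXi.scalar T (by
    intro k hk x
    change ρX (w * w) (θ (θ (ρX k x))) = ρX k (ρX (w * w) (θ (θ x)))
    rw [hθk k hk, hθk _ (hc2 k hk), ← hρX.mul_apply hw2 (hc2 _ (hc2 k hk)),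
      ← hρX.mul_apply hk hw2]
    congr 2
    group)
  have hc' : ∀ x, ρX (w * w) (θ (θ x)) = c • x := hc
  have hc0 : c ≠ 0 := by
    rintro rfl
    obtain ⟨x, hx, hx0⟩ := (Submodule.ne_bot_iff X).1 hX0
    have h1 := hc' ⟨x, hx⟩
    rw [zero_smul] at h1
    have h2 : θ (θ ⟨x, hx⟩) = 0 := by
      rw [← hρX.inv_apply hw2 (θ (θ ⟨x, hx⟩)), h1, map_zero]
    have h3 := hθi (h2.trans (map_zero θ).symm)
    have h4 := hθi (h3.trans (map_zero θ).symm)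
    exact hx0 (congrArg Subtype.val h4)
  obtain ⟨s, hs2⟩ := IsAlgClosed.exists_eq_mul_self c⁻¹
  let η : X →ₗ[ℂ] X := s • θ
  have hη : ∀ x, η x = s • θ x := fun x => rfl
  have hη2 : ∀ x, ρX (w * w) (η (η x)) = x := by
    intro x
    rw [hη, hη, map_smul, map_smul, map_smul, hc', smul_smul, smul_smul, ← hs2,
      inv_mul_cancel₀ hc0, one_smul]
  have hηk : ∀ k ∈ A', ∀ x, η (ρX k x) = ρX (w⁻¹ * k * w) (η x) := by
    intro k hk x
    rw [hη, hη, hθk k hk, map_smul]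
  let f : X →ₗ[ℂ] W := X.subtype + ρ w ∘ₗ X.subtype ∘ₗ η
  have hf : ∀ x, f x = x + ρ w (η x) := fun x => rfl
  have hρXc : ∀ k ∈ A', ∀ x, (ρX k x : W) = ρ k x := fun k hk x => hX.coe_subRep hk x
  have hfk : ∀ k ∈ A', ∀ x, ρ k (f x) = f (ρX k x) := by
    intro k hk x
    rw [hf, hf, map_add, hρwk k hk, hηk k hk, hρXc k hk, hρXc _ (hc2 k hk)]
  have hfw : ∀ x, ρ w (f x) = f (ρX (w * w) (η x)) := by
    intro x
    have : w⁻¹ * (w * w) * w = w * w := by group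
    rw [hf, hf, map_add, hηk _ hw2, this, hη2, hρXc _ hw2, hρ.mul_apply hw hw, add_comm]
  have hstab : Stable A ρ (LinearMap.range f) := by
    rintro a ha _ ⟨x, rfl⟩
    rcases hind a ha with h | h
    · exact ⟨_, (hfk a h x).symm⟩
    · have : a = w * (w⁻¹ * a) := by group
      rw [this, hρ.mul_apply hw (hA h), hfk _ h, hfw]
      exact ⟨_, rfl⟩
  have hfX : ∀ x, f x ∈ X → x = 0 := by
    intro x hx
    have h1 : ρ w (η x) ∈ X ⊓ wX := by
      refine ⟨?_, ⟨_, (η x).2, rfl⟩⟩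
      have := X.sub_mem hx x.2
      rwa [hf, add_sub_cancel_left] at this
    rw [hdisj, Submodule.mem_bot] at h1
    have h2 : η x = 0 := Subtype.ext (hinjw (by rw [h1]; simp))
    rw [← hη2 x, h2, map_zero, map_zero]
  rcases hρ.eq_bot_or_top _ hstab with h | h
  · obtain ⟨x, hx, hx0⟩ := (Submodule.ne_bot_iff X).1 hX0
    have h1 : f ⟨x, hx⟩ = 0 := by
      have : f ⟨x, hx⟩ ∈ LinearMap.range f := ⟨_, rfl⟩
      rwa [h, Submodule.mem_bot] at this
    have := hfX ⟨x, hx⟩ (by rw [h1]; exact X.zero_mem)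
    exact hx0 (congrArg Subtype.val this)
  · obtain ⟨x, hx, hx0⟩ := (Submodule.ne_bot_iff X).1 hX0
    obtain ⟨y, hy⟩ : x ∈ LinearMap.range f := h ▸ Submodule.mem_top
    have h1 := hfX y (hy ▸ hx)
    rw [h1, map_zero] at hy
    exact hx0 hy.symm

/-- A nonzero pairing of irreducible constituents carrying symmetric forms gives an
isomorphism. -/
lemma HasSym.exists_iso {A' : Subgroup M} {h : M} (H : HasSym A' h) (hn : Nrm h A')
    {b : W →ₗ[ℂ] W →ₗ[ℂ] ℂ} (hb : TwInv A' h ρ b)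
    {X Y : Submodule ℂ W} (hX : Stable A' ρ X) (hXi : IrrOn A' (subRep ρ X))
    (hY : Stable A' ρ Y) (hYi : IrrOn A' (subRep ρ Y)) {x y : W} (hx : x ∈ X) (hy : y ∈ Y)
    (hxy : b x y ≠ 0) :
    ∃ φ : X →ₗ[ℂ] W, (∀ k ∈ A', ∀ x, φ (subRep ρ X k x) = ρ k (φ x)) ∧
        Function.Injective φ ∧ LinearMap.range φ = Y := by
  obtain ⟨b₁, hb₁, -, hb₁0⟩ := H Y _ hYi
  let e := LinearEquiv.ofBijective b₁ (form_bijective (hYi.form_injective hn hb₁ hb₁0))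
  have he : ∀ x, b₁ (e.symm x) = x := fun x => e.apply_symm_apply x
  let β : X →ₗ[ℂ] Y →ₗ[ℂ] ℂ := b.compl₁₂ X.subtype Y.subtype
  have hβ : ∀ x y, β x y = b x y := fun _ _ => rfl
  let T : X →ₗ[ℂ] Y := e.symm.toLinearMap ∘ₗ β
  have hT : ∀ x, b₁ (T x) = β x := fun x => he _
  have hTk : ∀ k ∈ A', ∀ x, T (subRep ρ X k x) = subRep ρ Y k (T x) := by
    intro k hk x
    apply e.injective
    change b₁ _ = b₁ _
    rw [hT]
    ext v
    rw [← hYi.toRepOn.apply_inv (hn k hk) v, hb₁ k hk, hβ, hX.coe_subRep hk,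
      hY.coe_subRep (hn k hk), hb k hk, hT, hβ]
  have hT0 : T ≠ 0 := by
    intro h0
    apply hxy
    have := hT ⟨x, hx⟩
    rw [h0, LinearMap.zero_apply, map_zero] at this
    exact (LinearMap.congr_fun this ⟨y, hy⟩).symm
  refine ⟨Y.subtype ∘ₗ T, ?_, ?_, ?_⟩
  · intro k hk x
    change (T _ : W) = _
    rw [hTk k hk, hY.coe_subRep hk]; rfl
  · exact Y.injective_subtype.comp (hXi.injective_of_intertwine T hTk hT0)
  · rw [LinearMap.range_comp, LinearMap.range_eq_top.2 (hYi.surjective_of_intertwine T hTk hT0),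
      Submodule.map_top, Submodule.range_subtype]

end IndexTwo

lemma NoSkew.index_two {M : Type} [Group M] [Fintype M] {A A' : Subgroup M} {h : M}
    (H : NoSkew A' h) (HS : HasSym A' h) (hA : A' ≤ A) (hn : Nrm h A')
    {w : M} (hw : w ∈ A) (hind : ∀ a ∈ A, a ∈ A' ∨ w⁻¹ * a ∈ A') : NoSkew A h := by
  intro W _ _ _ ρ hρ b hb hs
  refine skew_eq_zero_of_index_two hA hw hind hρ b hs ?_ ?_
  · intro X hX hXi
    exact H.isotropic hn (hb.mono hA) hs hX hXi
  · intro X Y hX hXi hY hYi x hx y hy hxy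
    exact HS.exists_iso hn (hb.mono hA) hX hXi hY hYi hx hy hxy

section Lagrangian

variable {M : Type} [Group M] {W : Type} [AddCommGroup W] [Module ℂ W]
  {K : Subgroup M} {ρ : M → W →ₗ[ℂ] W}

lemma TwInv.apply_right {h : M} {b : W →ₗ[ℂ] W →ₗ[ℂ] ℂ} (hb : TwInv K h ρ b)
    (hρ : RepOn K ρ) {k : M} (hk : k ∈ K) (v w : W) :
    b (ρ k v) w = b v (ρ (h * k⁻¹ * h⁻¹) w) := by
  have := hb k⁻¹ (K.inv_mem hk) (ρ k v) w
  rw [hρ.inv_apply hk] at this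
  exact this.symm

variable [Fintype M] [FiniteDimensional ℂ W]

/-- A stable maximal isotropic subspace is its own orthogonal. -/
lemma NoSkew.exists_lagrangian {h : M} (H : NoSkew K h) (hn : Nrm h K)
    (hρ : RepOn K ρ) {b : W →ₗ[ℂ] W →ₗ[ℂ] ℂ} (hb : TwInv K h ρ b)
    (hs : ∀ v w, b v w = -b w v) :
    ∃ X, Stable K ρ X ∧ (∀ x ∈ X, ∀ y ∈ X, b x y = 0) ∧
      ∀ v, (∀ x ∈ X, b v x = 0) → v ∈ X := by
  obtain ⟨X, ⟨hX, hXi⟩, hmax⟩ := (wellFounded_gt (α := Submodule ℂ W)).has_min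
    {X | Stable K ρ X ∧ ∀ x ∈ X, ∀ y ∈ X, b x y = 0} ⟨⊥, fun k _ x hx => by
      rw [Submodule.mem_bot] at hx ⊢; rw [hx, map_zero], by
      intro x hx; rw [Submodule.mem_bot] at hx; simp [hx]⟩
  refine ⟨X, hX, hXi, ?_⟩
  let P : Submodule ℂ W :=
    { carrier := {v | ∀ x ∈ X, b v x = 0}
      add_mem' := fun {v w} hv hw x hx => by simp [hv x hx, hw x hx]
      zero_mem' := by simp
      smul_mem' := fun c v hv x hx => by simp [hv x hx] }
  have hP : Stable K ρ P := by
    intro k hk v hv x hx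
    rw [hb.apply_right hρ hk]
    exact hv _ (hX _ (hn _ (K.inv_mem hk)) x hx)
  obtain ⟨X', hX', hcompl⟩ := hρ.exists_compl hX
  have hU : P ⊓ X' = ⊥ := by
    by_contra hne
    obtain ⟨Y, hYU, hY0, hY, hYi⟩ := hρ.exists_irr (Y := P ⊓ X')
      (fun k hk x hx => ⟨hP k hk x hx.1, hX' k hk x hx.2⟩) hne
    have hYb := H.isotropic hn hb hs hY hYi
    refine hmax (X ⊔ Y) ⟨?_, ?_⟩ ?_
    · intro k hk z hz
      obtain ⟨x, hx, y, hy, rfl⟩ := Submodule.mem_sup.1 hz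
      rw [map_add]
      exact Submodule.add_mem_sup (hX k hk x hx) (hY k hk y hy)
    · intro z hz z' hz'
      obtain ⟨x, hx, y, hy, rfl⟩ := Submodule.mem_sup.1 hz
      obtain ⟨x', hx', y', hy', rfl⟩ := Submodule.mem_sup.1 hz'
      have e1 : b y x' = 0 := (hYU hy).1 x' hx'
      have e2 : b x y' = 0 := by rw [hs, (hYU hy').1 x hx, neg_zero]
      simp [hXi x hx x' hx', hYb y hy y' hy', e1, e2]
    · refine lt_of_le_of_ne le_sup_left fun h => hY0 ?_
      have hYX : Y ≤ X := by rw [h]; exact le_sup_right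
      rw [← le_bot_iff, ← hcompl.inf_eq_bot]
      exact le_inf hYX fun y hy => (hYU hy).2
  intro v hv
  obtain ⟨x, hx, y, hy, rfl⟩ := Submodule.mem_sup.1
    (hcompl.sup_eq_top ▸ Submodule.mem_top : v ∈ X ⊔ X')
  have : y ∈ P ⊓ X' := by
    refine ⟨fun z hz => ?_, hy⟩
    have := hv z hz
    rwa [map_add, LinearMap.add_apply, hXi x hx z hz, zero_add] at this
  rw [hU, Submodule.mem_bot] at this
  rw [this, add_zero]
  exact hx

/-- The character of a representation with a stable Lagrangian. -/
lemma chr_eq_add_of_lagrangian {h : M} (hn : Nrm h K)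
    (hρ : RepOn K ρ) {b : W →ₗ[ℂ] W →ₗ[ℂ] ℂ} (hb : TwInv K h ρ b)
    (hbi : Function.Injective b) {X : Submodule ℂ W} (hX : Stable K ρ X)
    (hXi : ∀ x ∈ X, ∀ y ∈ X, b x y = 0) (hXm : ∀ v, (∀ x ∈ X, b v x = 0) → v ∈ X)
    {k : M} (hk : k ∈ K) :
    chr ρ k = chr (subRep ρ X) k + chr (subRep ρ X) (h * k⁻¹ * h⁻¹) := by
  obtain ⟨X', hX', hcompl⟩ := hρ.exists_compl hX
  have h1 : chr ρ k = chr (subRep ρ X) k + chr (subRep ρ X') k := by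
    let e := Submodule.prodEquivOfIsCompl X X' hcompl
    have he : e.conj (LinearMap.prodMap (subRep ρ X k) (subRep ρ X' k)) = ρ k := by
      ext v
      obtain ⟨⟨x, y⟩, rfl⟩ := e.surjective v
      rw [LinearEquiv.conj_apply_apply, LinearEquiv.symm_apply_apply]
      simp only [e, Submodule.coe_prodEquivOfIsCompl', LinearMap.prodMap_apply]
      rw [hX.coe_subRep hk, hX'.coe_subRep hk, map_add]
    unfold chr
    rw [← he, LinearMap.trace_conj', LinearMap.trace_prodMap']
  rw [h1]
  congr 1
  let ψ : X' →ₗ[ℂ] Module.Dual ℂ X := b.compl₁₂ X'.subtype X.subtype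
  have hψ : ∀ x' x, ψ x' x = b x' x := fun _ _ => rfl
  have hψb : Function.Bijective ψ := by
    constructor
    · rw [← LinearMap.ker_eq_bot, LinearMap.ker_eq_bot']
      intro y hy
      have hyX : (y : W) ∈ X := hXm y fun x hx => LinearMap.congr_fun hy ⟨x, hx⟩
      have : (y : W) ∈ X ⊓ X' := ⟨hyX, y.2⟩
      rw [hcompl.inf_eq_bot, Submodule.mem_bot] at this
      exact Subtype.ext this
    · intro φ
      obtain ⟨w, hw⟩ := (form_bijective hbi).2 (φ ∘ₗ prj X)
      obtain ⟨x, hx, y, hy, rfl⟩ := Submodule.mem_sup.1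
        (hcompl.sup_eq_top ▸ Submodule.mem_top : w ∈ X ⊔ X')
      refine ⟨⟨y, hy⟩, ?_⟩
      ext z
      have := LinearMap.congr_fun hw z
      rw [LinearMap.comp_apply, prj_coe, map_add, LinearMap.add_apply, hXi x hx z z.2,
        zero_add] at this
      exact this
  let e := LinearEquiv.ofBijective ψ hψb
  have key : Module.Dual.transpose (R := ℂ) (subRep ρ X (h * k⁻¹ * h⁻¹)) =
      e.conj (subRep ρ X' k) := by
    ext φ w
    obtain ⟨v, rfl⟩ := e.surjective φ
    simp only [LinearEquiv.conj_apply_apply, LinearEquiv.symm_apply_apply]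
    change ψ v (subRep ρ X (h * k⁻¹ * h⁻¹) w) = ψ (subRep ρ X' k v) w
    rw [hψ, hψ, hX'.coe_subRep hk, hX.coe_subRep (hn _ (K.inv_mem hk)), hb.apply_right hρ hk]
  unfold chr
  rw [← LinearMap.trace_transpose' (subRep ρ X (h * k⁻¹ * h⁻¹)), key, LinearMap.trace_conj']

end Lagrangian

section Integrality

/-- `z` is divisible by `m` in the ring of algebraic integers. -/
def Dv (m : ℕ) (z : ℂ) : Prop := ∃ w, IsIntegral ℤ w ∧ z = m * w

lemma Dv.add {m : ℕ} {z w : ℂ} (hz : Dv m z) (hw : Dv m w) : Dv m (z + w) := by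
  obtain ⟨a, ha, rfl⟩ := hz
  obtain ⟨b, hb, rfl⟩ := hw
  exact ⟨a + b, ha.add hb, by ring⟩

lemma Dv.mul_left {m : ℕ} {z w : ℂ} (hz : Dv m z) (hw : IsIntegral ℤ w) : Dv m (w * z) := by
  obtain ⟨a, ha, rfl⟩ := hz
  exact ⟨w * a, hw.mul ha, by ring⟩

lemma Dv.zero (m : ℕ) : Dv m 0 := ⟨0, isIntegral_zero, by simp⟩

lemma Dv.sum {ι : Type} {m : ℕ} (s : Finset ι) {f : ι → ℂ} (hf : ∀ i ∈ s, Dv m (f i)) :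
    Dv m (∑ i ∈ s, f i) := by
  induction s using Finset.induction_on with
  | empty => simpa using Dv.zero m
  | insert a s ha ih =>
    rw [Finset.sum_insert ha]
    exact (hf a (Finset.mem_insert_self a s)).add
      (ih fun i hi => hf i (Finset.mem_insert_of_mem hi))

lemma isIntegral_natCast (n : ℕ) : IsIntegral ℤ (n : ℂ) := by
  have := isIntegral_algebraMap (R := ℤ) (A := ℂ) (x := (n : ℤ))
  simpa using this

lemma isIntegral_intCast (n : ℤ) : IsIntegral ℤ (n : ℂ) := by
  simpa using isIntegral_algebraMap (R := ℤ) (A := ℂ) (x := n)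

variable {E : Type} [AddCommGroup E] [Module ℂ E] [FiniteDimensional ℂ E]

lemma isIntegral_trace {q : E →ₗ[ℂ] E} {m : ℕ} (hm : 0 < m) (hq : q ^ (m + 1) = q) :
    IsIntegral ℤ (LinearMap.trace ℂ E q) := by
  rw [Module.End.trace_eq_sum_roots_charpoly_of_splits (IsAlgClosed.splits _)]
  refine IsIntegral.multiset_sum fun z hz => ?_
  have hroot := (Polynomial.mem_roots'.1 hz).2
  have hev := (Module.End.hasEigenvalue_iff_isRoot_charpoly q z).2 hroot
  obtain ⟨v, hv⟩ := hev.exists_hasEigenvector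
  have h1 := hv.pow_apply (m + 1)
  rw [hq, hv.apply_eq_smul] at h1
  have h2 : z ^ (m + 1) = z := (smul_left_injective ℂ hv.2 h1).symm
  refine ⟨Polynomial.X ^ (m + 1) - Polynomial.X, ?_, ?_⟩
  · exact Polynomial.monic_X_pow_sub (by rw [Polynomial.degree_X]; exact_mod_cast (by omega : 1 < m + 1))
  · simp [h2]

/-- Averages of twisted characters are algebraic integers. -/
lemma isIntegral_average {D : Type} [Group D] [Fintype D] (R : Representation ℂ D E)
    (T : E →ₗ[ℂ] E) (hT : ∀ d, T * R d = R d * T) {m : ℕ} (hm : 0 < m) (hTm : T ^ m = 1) :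
    Dv (Nat.card D) (∑ d, LinearMap.trace ℂ E (T * R d)) := by
  have hne : (Nat.card D : ℂ) ≠ 0 := Nat.cast_ne_zero.2 Nat.card_pos.ne'
  let p : E →ₗ[ℂ] E := (Nat.card D : ℂ)⁻¹ • ∑ d, R d
  have hRp : ∀ d, R d * p = p := by
    intro d
    simp only [p, mul_smul_comm, Finset.mul_sum, ← map_mul]
    congr 1
    exact Fintype.sum_equiv (Equiv.mulLeft d) _ _ fun _ => rfl
  have hpp : p * p = p := by
    have : p * p = (Nat.card D : ℂ)⁻¹ • ∑ d, R d * p := by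
      simp only [p, smul_mul_assoc, Finset.sum_mul]
    rw [this]
    simp only [hRp, Finset.sum_const, Finset.card_univ]
    rw [← Nat.card_eq_fintype_card, ← Nat.cast_smul_eq_nsmul ℂ, smul_smul,
      inv_mul_cancel₀ hne, one_smul]
  have hcomm : Commute T p := by
    change T * p = p * T
    simp only [p, mul_smul_comm, smul_mul_assoc, Finset.mul_sum, Finset.sum_mul, hT]
  have hppow : ∀ n, p ^ (n + 1) = p := by
    intro n
    induction n with
    | zero => simp
    | succ n ih => rw [pow_succ, ih, hpp]
  refine ⟨LinearMap.trace ℂ E (T * p), isIntegral_trace hm (q := T * p) ?_, ?_⟩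
  · rw [hcomm.mul_pow, hppow, pow_succ, hTm, one_mul]
  · simp only [p, mul_smul_comm, map_smul, Finset.mul_sum, map_sum, smul_eq_mul]
    simp only [← Finset.mul_sum]
    rw [← mul_assoc, mul_inv_cancel₀ hne, one_mul]

/-- Powers of a character are characters. -/
lemma exists_rep_pow {D : Type} [Group D] (R : Representation ℂ D E) (n : ℕ) :
    ∃ (Q : Type) (_ : AddCommGroup Q) (_ : Module ℂ Q) (_ : FiniteDimensional ℂ Q)
      (S : Representation ℂ D Q), ∀ d, S.character d = R.character d ^ n := by
  induction n with
  | zero => exact ⟨ℂ, inferInstance, inferInstance, inferInstance, 1, fun d => by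
      simp [Representation.character]⟩
  | succ n ih =>
    obtain ⟨Q, _, _, _, S, hS⟩ := ih
    refine ⟨TensorProduct ℂ Q E, inferInstance, inferInstance, inferInstance, S.tprod R,
      fun d => ?_⟩
    rw [Representation.char_tensor, Pi.mul_apply, hS, pow_succ]

/-- Twisting an average by a power of a character. -/
lemma isIntegral_average_mul_pow {D : Type} [Group D] [Fintype D]
    {P : Type} [AddCommGroup P] [Module ℂ P] [FiniteDimensional ℂ P]
    (π : Representation ℂ D P) (R : Representation ℂ D E)
    (T : E →ₗ[ℂ] E) (hT : ∀ d, T * R d = R d * T) {m : ℕ} (hm : 0 < m) (hTm : T ^ m = 1)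
    (n : ℕ) :
    Dv (Nat.card D) (∑ d, LinearMap.trace ℂ E (T * R d) * π.character d ^ n) := by
  obtain ⟨Q, _, _, _, S, hS⟩ := exists_rep_pow π n
  have := isIntegral_average (S.tprod R) (TensorProduct.map 1 T) (fun d => by
    rw [Representation.tprod_apply, ← TensorProduct.map_mul, ← TensorProduct.map_mul, hT,
      one_mul, mul_one]) hm (by rw [TensorProduct.map_pow, hTm, one_pow, TensorProduct.map_one])
  convert this using 1
  refine Finset.sum_congr rfl fun d _ => ?_
  rw [Representation.tprod_apply, ← TensorProduct.map_mul, LinearMap.trace_tensorProduct',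
    one_mul, ← hS, mul_comm]
  rfl

end Integrality

section PermRep

variable {C : Type} [Group C] {X : Type} [Fintype X] [MulAction C X]

/-- The permutation representation on functions. -/
def permRep (C X : Type) [Group C] [MulAction C X] : Representation ℂ C (X → ℂ) where
  toFun g := LinearMap.funLeft ℂ ℂ (g⁻¹ • ·)
  map_one' := by ext; simp [LinearMap.funLeft]
  map_mul' a b := by
    refine LinearMap.ext fun f => funext fun x => ?_
    simp [LinearMap.funLeft, mul_smul]

/-- The number of fixed points. -/
def fixCard (X : Type) [MulAction C X] (g : C) : ℕ :=
  Nat.card {x : X // g • x = x}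

lemma permRep_character (g : C) : (permRep C X).character g = fixCard X g := by
  unfold Representation.character
  rw [LinearMap.trace_eq_matrix_trace ℂ (Pi.basisFun ℂ X), Matrix.trace]
  have : ∀ x : X, (LinearMap.toMatrix (Pi.basisFun ℂ X) (Pi.basisFun ℂ X) (permRep C X g)).diag x
      = if g • x = x then 1 else 0 := by
    intro x
    rw [Matrix.diag_apply, LinearMap.toMatrix_apply]
    simp only [Pi.basisFun_apply, Pi.basisFun_repr]
    change (Pi.single x (1 : ℂ) : X → ℂ) (g⁻¹ • x) = _
    rw [Pi.single_apply]
    congr 1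
    rw [inv_smul_eq_iff, @eq_comm _ x]
  rw [Finset.sum_congr rfl fun x _ => this x, Finset.sum_boole, fixCard,
    Nat.card_eq_fintype_card, Fintype.card_subtype]

lemma fixCard_odd {g : C} {k : ℕ} (hg : g ^ 2 ^ k = 1) (hX : Odd (Fintype.card X)) :
    Odd (fixCard X g) := by
  have : Fact (Nat.Prime 2) := ⟨Nat.prime_two⟩
  have h := Equiv.Perm.card_fixedPoints_modEq (α := X) (p := 2) (n := k)
    (f := MulAction.toEndHom (M := C) g) (by rw [← map_pow, hg, map_one])
  rw [Nat.odd_iff] at hX ⊢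
  have h' : Fintype.card X % 2 = fixCard X g % 2 := by
    refine Eq.trans h ?_
    rw [fixCard, ← Nat.card_eq_fintype_card]
    rfl
  omega

lemma card_mul_fixCard [Fintype C] (D : Subgroup C) (y : C) :
    Nat.card D * fixCard (C ⧸ D) y = Nat.card {c : C // c⁻¹ * y * c ∈ D} := by
  have e := QuotientGroup.preimageMkEquivSubgroupProdSet D {x : C ⧸ D | y • x = x}
  have h1 : fixCard (C ⧸ D) y = Nat.card {x : C ⧸ D | y • x = x} := rfl
  rw [h1, ← Nat.card_prod, ← Nat.card_congr e]
  refine Nat.card_congr (Equiv.subtypeEquivRight fun c => ?_)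
  change y • (QuotientGroup.mk c : C ⧸ D) = QuotientGroup.mk c ↔ _
  rw [eq_comm]
  change (QuotientGroup.mk c : C ⧸ D) = QuotientGroup.mk (y * c) ↔ _
  rw [QuotientGroup.eq, mul_assoc]

lemma fixCard_eq [Fintype C] (D : Subgroup C) {y y' : C} (e : C ≃ C)
    (he : ∀ c, c⁻¹ * y * c ∈ D ↔ (e c)⁻¹ * y' * e c ∈ D) :
    fixCard (C ⧸ D) y = fixCard (C ⧸ D) y' := by
  have hD : 0 < Nat.card D := Nat.card_pos
  refine Nat.eq_of_mul_eq_mul_left hD ?_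
  rw [card_mul_fixCard, card_mul_fixCard]
  exact Nat.card_congr (e.subtypeEquiv he)

end PermRep

section TwoElements

variable {C : Type} [Group C]

/-- Elements of 2-power order. -/
def Is2 (y : C) : Prop := ∃ k : ℕ, y ^ 2 ^ k = 1

lemma Is2.conj {y : C} (h : Is2 y) (c : C) : Is2 (c * y * c⁻¹) := by
  obtain ⟨k, hk⟩ := h
  exact ⟨k, by rw [conj_pow, hk]; group⟩

variable [Fintype C]

lemma sum_mul_fixCard (D : Subgroup C) (hD : IsPGroup 2 D) {f : C → ℂ}
    (hf : ∀ c y, f (c * y * c⁻¹) = f y) :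
    (Nat.card D : ℂ) * ∑ y ∈ Finset.univ.filter (fun y : C => Is2 y), f y * fixCard (C ⧸ D) y
      = Nat.card C * ∑ d : D, f d := by
  have h1 : ∀ y : C, (Nat.card D : ℂ) * (f y * fixCard (C ⧸ D) y) =
      ∑ c : C, if c⁻¹ * y * c ∈ D then f y else 0 := by
    intro y
    rw [← Finset.sum_filter, Finset.sum_const, nsmul_eq_mul]
    have := card_mul_fixCard D y
    rw [Nat.card_eq_fintype_card (α := {c : C // c⁻¹ * y * c ∈ D}), Fintype.card_subtype] at this
    rw [← this]
    push_cast
    ring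
  rw [Finset.mul_sum, Finset.sum_congr rfl fun y _ => h1 y, Finset.sum_comm]
  have h2 : ∀ c : C, (∑ y ∈ Finset.univ.filter (fun y : C => Is2 y),
      if c⁻¹ * y * c ∈ D then f y else 0) = ∑ d : D, f d := by
    intro c
    rw [← Finset.sum_filter]
    refine Finset.sum_bij' (fun y _ => if h : c⁻¹ * y * c ∈ D then ⟨c⁻¹ * y * c, h⟩ else 1)
      (fun d _ => c * d * c⁻¹) (fun _ _ => Finset.mem_univ _) ?_ ?_ ?_ ?_
    · intro d _
      simp only [Finset.mem_filter, Finset.mem_univ, true_and]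
      refine ⟨Is2.conj ?_ c, ?_⟩
      · obtain ⟨k, hk⟩ := hD d
        exact ⟨k, by simpa using congrArg Subtype.val hk⟩
      · convert d.2 using 1; group
    · intro y hy
      simp only [Finset.mem_filter, Finset.mem_univ, true_and] at hy
      simp only [hy.2, dite_true]
      group
    · intro d _
      have : c⁻¹ * (c * d * c⁻¹) * c = d := by group
      simp [this]
    · intro y hy
      simp only [Finset.mem_filter, Finset.mem_univ, true_and] at hy
      simp only [hy.2, dite_true]
      have := hf c (c⁻¹ * y * c)
      rw [← this]
      congr 1
      group
  rw [Finset.sum_congr rfl fun c _ => h2 c, Finset.sum_const, nsmul_eq_mul, Finset.card_univ,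
    Nat.card_eq_fintype_card]

/-- A class function whose twisted sums over a Sylow subgroup are highly divisible. -/
lemma dv_sum_is2 (D : Subgroup C) (hD : IsPGroup 2 D) (hodd : Odd D.index) {f : C → ℂ}
    (hf : ∀ c y, f (c * y * c⁻¹) = f y) (hfi : ∀ y, IsIntegral ℤ (f y))
    (hdv : ∀ n : ℕ, Dv (2 * Nat.card D) (∑ d : D, f d * (fixCard (C ⧸ D) (d : C) : ℂ) ^ n)) :
    Dv (2 * Nat.card D) (∑ y ∈ Finset.univ.filter (fun y : C => Is2 y), f y) := by
  have : Fact (Nat.Prime 2) := ⟨Nat.prime_two⟩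
  obtain ⟨a, ha⟩ := IsPGroup.iff_card.1 hD
  have hD0 : (Nat.card D : ℂ) ≠ 0 := Nat.cast_ne_zero.2 Nat.card_pos.ne'
  obtain ⟨n, hn⟩ : ∃ n, Nat.totient (2 * Nat.card D) = n + 1 :=
    Nat.exists_eq_add_one.2 (Nat.totient_pos.2 (Nat.mul_pos two_pos Nat.card_pos))
  have hind : Odd (Fintype.card (C ⧸ D)) := by
    rwa [← Nat.card_eq_fintype_card]
  have h1 : ∀ y : C, Is2 y →
      ∃ z : ℤ, (1 : ℂ) = (fixCard (C ⧸ D) y : ℂ) ^ (n + 1) + (2 * Nat.card D : ℕ) * (z : ℂ) := by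
    rintro y ⟨k, hk⟩
    have ho := fixCard_odd (X := C ⧸ D) hk hind
    have hcop : (fixCard (C ⧸ D) y).Coprime (2 * Nat.card D) := by
      rw [ha, ← pow_succ']
      exact Nat.Coprime.pow_right _ (Nat.coprime_two_right.2 ho)
    have hm := Nat.ModEq.pow_totient hcop
    rw [hn] at hm
    obtain ⟨z, hz⟩ := (Nat.modEq_iff_dvd.1 hm)
    refine ⟨z, ?_⟩
    have := congrArg (Int.cast : ℤ → ℂ) hz
    push_cast at this ⊢
    linear_combination this
  choose! z hz using h1
  have h2 : ∑ y ∈ Finset.univ.filter (fun y : C => Is2 y), f y =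
      (∑ y ∈ Finset.univ.filter (fun y : C => Is2 y),
        (f y * (fixCard (C ⧸ D) y : ℂ) ^ n) * fixCard (C ⧸ D) y) +
      ∑ y ∈ Finset.univ.filter (fun y : C => Is2 y), (2 * Nat.card D : ℕ) * (f y * (z y : ℂ)) := by
    rw [← Finset.sum_add_distrib]
    refine Finset.sum_congr rfl fun y hy => ?_
    have := hz y (Finset.mem_filter.1 hy).2
    rw [pow_succ] at this
    linear_combination f y * this
  rw [h2]
  refine Dv.add ?_ (Dv.sum _ fun y _ => ⟨_, (hfi y).mul (isIntegral_intCast _), rfl⟩)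
  have h3 := sum_mul_fixCard D hD (f := fun y => f y * (fixCard (C ⧸ D) y : ℂ) ^ n) (fun c y => by
    simp only [hf]
    congr 2
    have : fixCard (C ⧸ D) (c * y * c⁻¹) = fixCard (C ⧸ D) y :=
      fixCard_eq D (Equiv.mulLeft c⁻¹) fun x => by
        simp only [Equiv.coe_mulLeft, _root_.mul_inv_rev, inv_inv, mul_assoc]
    rw [this])
  have h4 : (∑ y ∈ Finset.univ.filter (fun y : C => Is2 y),
        (f y * (fixCard (C ⧸ D) y : ℂ) ^ n) * fixCard (C ⧸ D) y) =
      D.index * ∑ d : D, f d * (fixCard (C ⧸ D) (d : C) : ℂ) ^ n := by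
    refine mul_left_cancel₀ hD0 ?_
    rw [h3, ← D.card_mul_index]
    push_cast
    ring
  rw [h4]
  exact (hdv n).mul_left (isIntegral_natCast _)

/-- The divisibility used for the class function `y ↦ χ(xy) χ((xy)⁻¹)`. -/
lemma dv_sum_is2_of_rep (D : Subgroup C) (hD : IsPGroup 2 D) (hodd : Odd D.index) {f : C → ℂ}
    (hf : ∀ c y, f (c * y * c⁻¹) = f y) (hfi : ∀ y, IsIntegral ℤ (f y))
    (τ : C ≃* C) (hτ : ∀ d ∈ D, τ d ∈ D) (hτ2 : ∀ c, τ (τ c) = c)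
    {E : Type} [AddCommGroup E] [Module ℂ E] [FiniteDimensional ℂ E] (R : Representation ℂ D E)
    (T : E →ₗ[ℂ] E) (hT : ∀ d, T * R d = R d * T) {m : ℕ} (hm : 0 < m) (hTm : T ^ m = 1)
    (hfR : ∀ d : D, f d = LinearMap.trace ℂ E (T * R d) +
      LinearMap.trace ℂ E (T * R ⟨τ (d : C)⁻¹, hτ _ (D.inv_mem d.2)⟩)) :
    Dv (2 * Nat.card D) (∑ y ∈ Finset.univ.filter (fun y : C => Is2 y), f y) := by
  refine dv_sum_is2 D hD hodd hf hfi fun n => ?_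
  have hF : ∀ d : C, fixCard (C ⧸ D) (τ d⁻¹) = fixCard (C ⧸ D) d := fun d => by
    refine fixCard_eq D τ.toEquiv fun c => ?_
    have h1 : τ (c⁻¹ * τ d⁻¹ * c) = ((τ c)⁻¹ * d * τ c)⁻¹ := by
      simp [hτ2, mul_assoc]
    change c⁻¹ * τ d⁻¹ * c ∈ D ↔ (τ c)⁻¹ * d * τ c ∈ D
    constructor
    · intro h
      have := hτ _ h
      rw [h1] at this
      exact D.inv_mem_iff.1 this
    · intro h
      have := hτ _ (D.inv_mem h)
      rwa [← h1, hτ2] at this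
  have hav := isIntegral_average_mul_pow ((permRep C (C ⧸ D)).comp D.subtype) R T hT hm hTm n
  have hchar : ∀ d : D, Representation.character ((permRep C (C ⧸ D)).comp D.subtype) d =
      fixCard (C ⧸ D) (d : C) := fun d => permRep_character (d : C)
  simp only [hchar] at hav
  have hsum : ∑ d : D, f d * (fixCard (C ⧸ D) (d : C) : ℂ) ^ n =
      2 * ∑ d : D, LinearMap.trace ℂ E (T * R d) * (fixCard (C ⧸ D) (d : C) : ℂ) ^ n := by
    simp only [hfR, add_mul]
    rw [Finset.sum_add_distrib, two_mul]
    congr 1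
    let e : D ≃ D := Function.Involutive.toPerm
      (fun d => ⟨τ (d : C)⁻¹, hτ _ (D.inv_mem d.2)⟩) (fun d => by simp [hτ2])
    refine Fintype.sum_equiv e _ _ fun d => ?_
    change _ = _ * (fixCard (C ⧸ D) (τ (d : C)⁻¹) : ℂ) ^ n
    rw [hF]
    rfl
  obtain ⟨w, hw, h⟩ := hav
  refine ⟨w, hw, ?_⟩
  rw [hsum, h]
  push_cast
  ring

end TwoElements

section OddPart

lemma Dv.trans {m n : ℕ} (h : m ∣ n) {z : ℂ} (hz : Dv n z) : Dv m z := by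
  obtain ⟨w, hw, rfl⟩ := hz
  obtain ⟨k, rfl⟩ := h
  exact ⟨k * w, (isIntegral_natCast k).mul hw, by push_cast; ring⟩

lemma Dv.nat_mul {m : ℕ} {z : ℂ} (hz : Dv m z) (k : ℕ) : Dv (k * m) (k * z) := by
  obtain ⟨w, hw, rfl⟩ := hz
  exact ⟨w, hw, by push_cast; ring⟩

lemma Dv.dvd_of_natCast {m n : ℕ} (hm : m ≠ 0) (h : Dv m (n : ℂ)) : m ∣ n := by
  obtain ⟨w, hw, h⟩ := h
  have hm' : (m : ℂ) ≠ 0 := Nat.cast_ne_zero.2 hm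
  have hw' : w = algebraMap ℚ ℂ ((n : ℚ) / m) := by
    rw [map_div₀, map_natCast, map_natCast, h]
    field_simp
  rw [hw', isIntegral_algebraMap_iff (algebraMap ℚ ℂ).injective] at hw
  obtain ⟨z, hz⟩ := IsIntegrallyClosed.isIntegral_iff.1 hw
  have hmq : (m : ℚ) ≠ 0 := Nat.cast_ne_zero.2 hm
  have h2 : ((n : ℤ) : ℚ) = ((m * z : ℤ) : ℚ) := by
    rw [eq_div_iff hmq] at hz
    push_cast
    rw [← hz, mul_comm]
    simp
  exact Int.natCast_dvd_natCast.1 ⟨z, by exact_mod_cast h2⟩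

variable {A : Type} [Group A] [Fintype A]

lemma card_conj_mul_card_centralizer (x : A) :
    (Finset.univ.filter fun y : A => ConjClasses.mk y = ConjClasses.mk x).card *
      Nat.card (Subgroup.centralizer {x}) = Nat.card A := by
  have h1 : Nat.card (MulAction.orbit (ConjAct A) x) =
      (Finset.univ.filter fun y : A => ConjClasses.mk y = ConjClasses.mk x).card := by
    rw [ConjAct.orbit_eq_carrier_conjClasses, ← Fintype.card_subtype, ← Nat.card_eq_fintype_card]
    exact Nat.card_congr (Equiv.subtypeEquivRight fun y => ConjClasses.mem_carrier_iff_mk_eq)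
  have h3 := MulAction.card_orbit_mul_card_stabilizer_eq_card_group (ConjAct A) x
  rw [← Nat.card_eq_fintype_card, ← Nat.card_eq_fintype_card, ← Nat.card_eq_fintype_card] at h3
  rw [← h1, Subgroup.nat_card_centralizer_nat_card_stabilizer]
  exact h3

/-- The sum of a class function over the elements with given odd part. -/
def oddFiber (G : A → ℂ) (x : A) : ℂ :=
  ∑ y ∈ Finset.univ.filter (fun y : A => Is2 y ∧ y * x = x * y), G (x * y)

lemma sum_eq_sum_oddFiber (G : A → ℂ) :
    ∑ g, G g = ∑ x ∈ Finset.univ.filter (fun x : A => Odd (orderOf x)), oddFiber G x := by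
  obtain ⟨s, t, ht, hst⟩ := Nat.exists_eq_two_pow_mul_odd (n := Nat.card A) Nat.card_pos.ne'
  have hco : Nat.Coprime (2 ^ s) t := Nat.Coprime.pow_left _ (Nat.coprime_two_left.2 ht)
  obtain ⟨u, hu⟩ := Nat.chineseRemainder hco 0 1
  obtain ⟨v, hv⟩ := Nat.chineseRemainder hco 1 0
  have huv : u + v ≡ 1 [MOD Nat.card A] := by
    rw [hst, ← Nat.modEq_and_modEq_iff_modEq_mul hco]
    exact ⟨by simpa using hu.1.add hv.1, by simpa using hu.2.add hv.2⟩
  have hpow : ∀ {m a b : ℕ} {x : A}, x ^ m = 1 → a ≡ b [MOD m] → x ^ a = x ^ b := by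
    intro m a b x hx hab
    exact pow_eq_pow_iff_modEq.2 (hab.of_dvd (orderOf_dvd_of_pow_eq_one hx))
  have hodd : ∀ x : A, Odd (orderOf x) → x ^ t = 1 := by
    intro x hx
    refine orderOf_dvd_iff_pow_eq_one.1 ?_
    have := orderOf_dvd_natCard x
    rw [hst] at this
    exact (Nat.Coprime.pow_right _ (Nat.coprime_two_right.2 hx)).dvd_of_dvd_mul_left this
  have htwo : ∀ y : A, Is2 y → y ^ 2 ^ s = 1 := by
    rintro y ⟨k, hk⟩
    refine orderOf_dvd_iff_pow_eq_one.1 ?_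
    have h1 := orderOf_dvd_natCard y
    rw [hst] at h1
    have h2 := orderOf_dvd_of_pow_eq_one hk
    have h3 : Nat.Coprime (orderOf y) t :=
      Nat.Coprime.coprime_dvd_left h2 (Nat.Coprime.pow_left _ (Nat.coprime_two_left.2 ht))
    exact h3.dvd_of_dvd_mul_right h1
  have hcard : ∀ g : A, g ^ (2 ^ s * t) = 1 := fun g => by rw [← hst]; exact pow_card_eq_one'
  unfold oddFiber
  rw [Finset.sum_sigma']
  refine Finset.sum_bij' (fun g _ => ⟨g ^ u, g ^ v⟩) (fun p _ => p.1 * p.2) ?_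
    (fun _ _ => Finset.mem_univ _) ?_ ?_ ?_
  · intro g _
    simp only [Finset.mem_sigma, Finset.mem_filter, Finset.mem_univ, true_and]
    refine ⟨?_, ⟨s, ?_⟩, (Commute.refl g).pow_pow _ _⟩
    · refine Odd.of_dvd_nat ht (orderOf_dvd_of_pow_eq_one ?_)
      rw [← pow_mul]
      obtain ⟨w, rfl⟩ := (Nat.modEq_zero_iff_dvd.1 hu.1)
      rw [show 2 ^ s * w * t = 2 ^ s * t * w by ring, pow_mul, hcard, one_pow]
    · rw [← pow_mul]
      obtain ⟨w, rfl⟩ := (Nat.modEq_zero_iff_dvd.1 hv.2)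
      rw [show t * w * 2 ^ s = 2 ^ s * t * w by ring, pow_mul, hcard, one_pow]
  · intro g _
    rw [← pow_add, hpow (by rw [hst]; exact hcard g) huv, pow_one]
  · rintro ⟨x, y⟩ hxy
    simp only [Finset.mem_sigma, Finset.mem_filter, Finset.mem_univ, true_and] at hxy
    obtain ⟨hx, hy, hc⟩ := hxy
    have hc' : Commute x y := hc.symm
    have e1 : (x * y) ^ u = x := by
      rw [hc'.mul_pow, hpow (hodd x hx) hu.2, hpow (htwo y hy) hu.1, pow_one, pow_zero, mul_one]
    have e2 : (x * y) ^ v = y := by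
      rw [hc'.mul_pow, hpow (hodd x hx) hv.2, hpow (htwo y hy) hv.1, pow_one, pow_zero, one_mul]
    simp only [e1, e2]
  · intro g _
    rw [← pow_add, hpow (by rw [hst]; exact hcard g) huv, pow_one]

lemma oddFiber_conj {G : A → ℂ} (hG : ∀ a g, G (a * g * a⁻¹) = G g) (a x : A) :
    oddFiber G (a * x * a⁻¹) = oddFiber G x := by
  unfold oddFiber
  refine Finset.sum_bij' (fun y _ => a⁻¹ * y * a) (fun y _ => a * y * a⁻¹) ?_ ?_ ?_ ?_ ?_
  · intro y hy
    simp only [Finset.mem_filter, Finset.mem_univ, true_and] at hy ⊢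
    refine ⟨by simpa using hy.1.conj a⁻¹, ?_⟩
    have := congrArg (fun z => a⁻¹ * z * a) hy.2
    simpa [mul_assoc] using this
  · intro y hy
    simp only [Finset.mem_filter, Finset.mem_univ, true_and] at hy ⊢
    refine ⟨hy.1.conj a, ?_⟩
    have := congrArg (fun z => a * z * a⁻¹) hy.2
    simpa [mul_assoc] using this
  · intro y _; group
  · intro y _; group
  · intro y _
    rw [← hG a (x * _)]
    congr 1
    group

/-- If all odd fibres of a class function are highly divisible by two,
then its sum is not the order of the group. -/
lemma sum_ne_card {G : A → ℂ} (hG : ∀ a g, G (a * g * a⁻¹) = G g)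
    (H : ∀ x : A, Odd (orderOf x) → ∃ D : Subgroup (Subgroup.centralizer {x}),
      Odd D.index ∧ Dv (2 * Nat.card D) (oddFiber G x)) :
    ∑ g, G g ≠ Nat.card A := by
  obtain ⟨s, t, ht, hst⟩ := Nat.exists_eq_two_pow_mul_odd (n := Nat.card A) Nat.card_pos.ne'
  intro hsum
  have key : Dv (2 * 2 ^ s) (∑ g, G g) := by
    rw [sum_eq_sum_oddFiber, ← Finset.sum_fiberwise _ ConjClasses.mk]
    refine Dv.sum _ fun c _ => ?_
    obtain ⟨x, rfl⟩ := ConjClasses.exists_rep c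
    have hconj : ∀ y, ConjClasses.mk y = ConjClasses.mk x →
        oddFiber G y = oddFiber G x ∧ orderOf y = orderOf x := by
      intro y hy
      obtain ⟨a, ha⟩ := isConj_iff.1 (ConjClasses.mk_eq_mk_iff_isConj.1 hy)
      subst ha
      refine ⟨(oddFiber_conj hG a y).symm, ?_⟩
      have := orderOf_injective (MulAut.conj a).toMonoidHom (MulAut.conj a).injective y
      exact this.symm
    by_cases hx : Odd (orderOf x)
    · have e : (Finset.univ.filter (fun x : A => Odd (orderOf x))).filter
          (fun y => ConjClasses.mk y = ConjClasses.mk x) =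
          Finset.univ.filter (fun y => ConjClasses.mk y = ConjClasses.mk x) := by
        ext y
        simp only [Finset.mem_filter, Finset.mem_univ, true_and, and_iff_right_iff_imp]
        intro hy
        rw [(hconj y hy).2]
        exact hx
      rw [e, Finset.sum_congr rfl fun y hy => (hconj y (Finset.mem_filter.1 hy).2).1,
        Finset.sum_const, nsmul_eq_mul]
      obtain ⟨D, hD, hdv⟩ := H x hx
      refine (hdv.nat_mul _).trans ?_
      have h1 := card_conj_mul_card_centralizer x
      rw [← D.card_mul_index, hst, ← mul_assoc] at h1
      rw [show ∀ a b : ℕ, a * (2 * b) = 2 * (a * b) by intros; ring]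
      refine Nat.mul_dvd_mul_left 2 ?_
      exact (Nat.Coprime.pow_left s (Nat.coprime_two_left.2 hD)).dvd_of_dvd_mul_right
        (h1 ▸ Dvd.intro _ rfl)
    · rw [Finset.sum_eq_zero]
      · exact Dv.zero _
      · intro y hy
        simp only [Finset.mem_filter, Finset.mem_univ, true_and] at hy
        rw [(hconj y hy.2).2] at hy
        exact absurd hy.1 hx
  rw [hsum] at key
  have := key.dvd_of_natCast (by positivity)
  rw [hst, mul_comm 2] at this
  have h2 : 2 ∣ t := Nat.dvd_of_mul_dvd_mul_left (by positivity) this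
  exact (Nat.not_even_iff_odd.2 ht) (even_iff_two_dvd.2 h2)

end OddPart

section Local

variable {M : Type} [Group M] [Fintype M]

lemma oddFiber_eq {A : Type} [Group A] [Fintype A] (G : A → ℂ) (x : A) :
    oddFiber G x = ∑ c ∈ Finset.univ.filter
      (fun c : Subgroup.centralizer {x} => Is2 c), G (x * c) := by
  unfold oddFiber
  refine Finset.sum_bij' (fun y hy => (⟨y, Subgroup.mem_centralizer_singleton_iff.2
      (Finset.mem_filter.1 hy).2.2⟩ : Subgroup.centralizer {x})) (fun c _ => (c : A)) ?_ ?_ ?_ ?_ ?_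
  · intro y hy
    obtain ⟨k, hk⟩ := (Finset.mem_filter.1 hy).2.1
    exact Finset.mem_filter.2 ⟨Finset.mem_univ _, k, Subtype.ext hk⟩
  · intro c hc
    obtain ⟨k, hk⟩ := (Finset.mem_filter.1 hc).2
    exact Finset.mem_filter.2 ⟨Finset.mem_univ _, ⟨k, congrArg Subtype.val hk⟩,
      Subgroup.mem_centralizer_singleton_iff.1 c.2⟩
  · intro y _; rfl
  · intro y _; rfl
  · intro y _; rfl

lemma RepOn.isIntegral_chr {W : Type} [AddCommGroup W] [Module ℂ W] [FiniteDimensional ℂ W]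
    {K : Subgroup M} {ρ : M → W →ₗ[ℂ] W} (hρ : RepOn K ρ) {g : M} (hg : g ∈ K) :
    IsIntegral ℤ (chr ρ g) := by
  refine isIntegral_trace (m := Nat.card K) Nat.card_pos ?_
  have h1 : ρ g = hρ.toRep ⟨g, hg⟩ := rfl
  rw [h1, ← map_pow, pow_succ, pow_card_eq_one', one_mul]

lemma noSkew_of_local {A : Subgroup M} {h₀ : M} (h02 : h₀ * h₀ = 1) (hA : Nrm h₀ A)
    (H : ∀ x ∈ A, Odd (orderOf x) → ∃ (h : M) (D K : Subgroup M), h * h = 1 ∧ h * h₀⁻¹ ∈ A ∧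
      h * x * h⁻¹ = x⁻¹ ∧ IsPGroup 2 D ∧ Odd (D.relIndex (A ⊓ Subgroup.centralizer {x})) ∧
      Nrm h D ∧ K ≤ A ∧ x ∈ K ∧ D ≤ K ⊓ Subgroup.centralizer {x} ∧ Nrm h K ∧ NoSkew K h) :
    NoSkew A h₀ := by
  intro W _ _ _ ρ hρ b₀ hb₀ hs₀
  by_contra hb0
  refine sum_ne_card (A := A) (G := fun g => chr ρ g * chr ρ (g⁻¹ : M)) ?_ ?_ hρ.sum_chr_mul
  · rintro ⟨a, ha⟩ ⟨g, hg⟩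
    have h1 := hρ.toRepOn.chr_conj ha hg
    have h2 := hρ.toRepOn.chr_conj ha (A.inv_mem hg)
    simp only [Subgroup.coe_mul, InvMemClass.coe_inv]
    rw [h1, ← h2]
    congr 2
    group
  rintro ⟨x, hx⟩ hox
  rw [Subgroup.orderOf_mk] at hox
  obtain ⟨h, D, K, hh2, hhA, hhx, hD2, hDo, hhD, hKA, hxK, hDK, hhK, hNS⟩ := H x hx hox
  obtain ⟨b, hb, hs, hb0'⟩ := hb₀.exists_change hA h02 hh2 hhA hρ.toRepOn hs₀
  have hbne : b ≠ 0 := fun h => hb0 (hb0' h)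
  have hhA' : Nrm h A := by
    intro k hk
    have : h * k * h⁻¹ = (h * h₀⁻¹) * (h₀ * k * h₀⁻¹) * (h * h₀⁻¹)⁻¹ := by group
    rw [this]
    exact A.mul_mem (A.mul_mem hhA (hA k hk)) (A.inv_mem hhA)
  have hbi : Function.Injective b := hρ.form_injective hhA' hb hbne
  have hρK := hρ.toRepOn.mono hKA
  obtain ⟨X, hX, hXi, hXm⟩ := hNS.exists_lagrangian hhK hρK (fun k hk => hb k (hKA hk)) hs
  have hφ : ∀ k ∈ K, chr ρ k = chr (subRep ρ X) k + chr (subRep ρ X) (h * k⁻¹ * h⁻¹) := fun k hk =>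
    chr_eq_add_of_lagrangian hhK hρK (fun k hk => hb k (hKA hk)) hbi hX hXi hXm hk
  have hhi : h⁻¹ = h := inv_eq_of_mul_eq_one_left hh2
  have hhh : ∀ c, h * (h * c * h⁻¹) * h⁻¹ = c := Nrm.conj_conj hh2
  have hcent : ∀ y, y * x = x * y → (h * y * h⁻¹) * x = x * (h * y * h⁻¹) := by
    intro y hy
    have e : h * x⁻¹ * h⁻¹ = x := by
      rw [← hhx, hhh]
    have : x⁻¹ * y = y * x⁻¹ := by
      rw [inv_mul_eq_iff_eq_mul, ← mul_assoc, ← hy, mul_assoc, mul_inv_cancel, mul_one]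
    calc (h * y * h⁻¹) * x = h * y * h⁻¹ * (h * x⁻¹ * h⁻¹) := by rw [e]
      _ = h * (y * x⁻¹) * h⁻¹ := by group
      _ = h * (x⁻¹ * y) * h⁻¹ := by rw [this]
      _ = (h * x⁻¹ * h⁻¹) * (h * y * h⁻¹) := by group
      _ = _ := by rw [e]
  set x' : A := ⟨x, hx⟩ with hx'
  let C := Subgroup.centralizer {x'}
  let ι : C →* M := A.subtype.comp C.subtype
  have hιi : Function.Injective ι := A.subtype_injective.comp C.subtype_injective
  have hιA : ∀ c, ι c ∈ A := fun c => c.1.2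
  have hιc : ∀ c, ι c * x = x * ι c := fun c =>
    congrArg Subtype.val (Subgroup.mem_centralizer_singleton_iff.1 c.2)
  have hιr : ι.range = A ⊓ Subgroup.centralizer {x} := by
    ext y
    constructor
    · rintro ⟨c, rfl⟩
      exact ⟨hιA c, Subgroup.mem_centralizer_singleton_iff.2 (hιc c)⟩
    · rintro ⟨hy, hyc⟩
      exact ⟨⟨⟨y, hy⟩, Subgroup.mem_centralizer_singleton_iff.2
        (Subtype.ext (Subgroup.mem_centralizer_singleton_iff.1 hyc))⟩, rfl⟩
  let D' : Subgroup C := D.comap ι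
  have hτm : ∀ c : C, ∃ c' : C, ι c' = h * ι c * h⁻¹ := fun c => by
    have : h * ι c * h⁻¹ ∈ ι.range := by
      rw [hιr]
      exact ⟨hhA' _ (hιA c), Subgroup.mem_centralizer_singleton_iff.2 (hcent _ (hιc c))⟩
    exact this
  choose τ₀ hτ₀ using hτm
  have hτ2 : ∀ c, τ₀ (τ₀ c) = c := fun c => hιi (by rw [hτ₀, hτ₀, hhh])
  let τ : C ≃* C :=
    { toFun := τ₀
      invFun := τ₀
      left_inv := hτ2
      right_inv := hτ2
      map_mul' := fun a c => hιi (by rw [map_mul, hτ₀, hτ₀, hτ₀, map_mul]; group) }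
  have hτD : ∀ d ∈ D', τ d ∈ D' := fun d hd => by
    change ι (τ₀ d) ∈ D
    rw [hτ₀]
    exact hhD _ hd
  let j : D' →* K :=
    { toFun := fun d => ⟨ι d, (hDK d.2).1⟩
      map_one' := by ext; simp
      map_mul' := fun a c => by ext; simp }
  let RK := Representation.linHom hρK.toRep (hρK.subRep hX).toRep
  let xK : K := ⟨x, hxK⟩
  have hxd : ∀ d : D', xK * j d = j d * xK := fun d => Subtype.ext (hιc d).symm
  have hRK : ∀ d : D', LinearMap.trace ℂ _ (RK xK * (RK.comp j) d) =
      chr ρ ((x * ι d)⁻¹) * chr (subRep ρ X) (x * ι d) := fun d => by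
    have e : RK xK * (RK.comp j) d = RK (xK * j d) := (map_mul RK _ _).symm
    rw [e]
    exact Representation.char_linHom _ _ (xK * j d)
  refine ⟨D', ?_, ?_⟩
  · rw [Subgroup.index_comap, hιr]
    exact hDo
  have key := dv_sum_is2_of_rep D' (hD2.comap_of_injective ι hιi)
    (by rw [Subgroup.index_comap, hιr]; exact hDo)
    (f := fun c => chr ρ (x * ι c) * chr ρ ((x * ι c)⁻¹)) ?_ ?_ τ hτD hτ2 (RK.comp j) (RK xK)
    ?_ (m := Nat.card K) Nat.card_pos ?_ ?_
  · convert key using 1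
    exact oddFiber_eq _ x'
  · intro c y
    have e : x * ι (c * y * c⁻¹) = ι c * (x * ι y) * (ι c)⁻¹ := by
      rw [map_mul, map_mul, map_inv]
      simp only [← mul_assoc]
      rw [hιc c]
    have hm := A.mul_mem hx (hιA y)
    simp only [e]
    rw [hρ.toRepOn.chr_conj (hιA c) hm, ← hρ.toRepOn.chr_conj (hιA c) (A.inv_mem hm)]
    congr 2
    group
  · intro y
    have hm := A.mul_mem hx (hιA y)
    exact (hρ.toRepOn.isIntegral_chr hm).mul (hρ.toRepOn.isIntegral_chr (A.inv_mem hm))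
  · intro d
    change RK xK * RK (j d) = RK (j d) * RK xK
    rw [← map_mul, ← map_mul, hxd]
  · rw [← map_pow, pow_card_eq_one', map_one]
  · intro d
    rw [hRK, hRK]
    have hdK : ι d ∈ K := (hDK d.2).1
    have hm := K.mul_mem hxK hdK
    have e1 : ι (τ₀ (d : C)⁻¹) = h * (ι d)⁻¹ * h⁻¹ := by rw [hτ₀, map_inv]
    have e0 : h * x⁻¹ * h⁻¹ = x := by rw [← hhx, hhh]
    have e2 : x * ι (τ₀ (d : C)⁻¹) = h * (x * ι d)⁻¹ * h⁻¹ := by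
      rw [e1, _root_.mul_inv_rev]
      have hc : (ι d)⁻¹ * x⁻¹ = x⁻¹ * (ι d)⁻¹ := by
        rw [← _root_.mul_inv_rev, ← _root_.mul_inv_rev, hιc]
      rw [hc]
      calc x * (h * (ι d)⁻¹ * h⁻¹) = (h * x⁻¹ * h⁻¹) * (h * (ι d)⁻¹ * h⁻¹) := by rw [e0]
        _ = _ := by group
    have e3 : chr ρ ((h * (x * ι d)⁻¹ * h⁻¹)⁻¹) = chr ρ ((x * ι d)⁻¹) := by
      rw [← hρ.toRepOn.chr_twist hhA' hb hbi (A.inv_mem (hKA hm))]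
      congr 1
      group
    change _ = _ + chr ρ ((x * ι (τ₀ (d : C)⁻¹))⁻¹) * chr (subRep ρ X) (x * ι (τ₀ (d : C)⁻¹))
    rw [e2, e3, hφ _ hm]
    ring

end Local

section SylowAux

variable {M : Type} [Group M] [Fintype M]

/-- A normal subgroup of a 2-group meets the centre. -/
lemma exists_central {Q : Type} [Group Q] [Fintype Q] (hQ : IsPGroup 2 Q) (N : Subgroup Q)
    [N.Normal] (hN : N ≠ ⊥) : ∃ q ∈ N, q ≠ 1 ∧ q * q = 1 ∧ ∀ g, g * q * g⁻¹ = q := by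
  have : Fact (Nat.Prime 2) := ⟨Nat.prime_two⟩
  let _ : MulAction Q N := MulAction.compHom N (MulAut.conjNormal (H := N))
  have hact : ∀ (g : Q) (n : N), ((g • n : N) : Q) = g * n * g⁻¹ := fun g n =>
    MulAut.conjNormal_apply g n
  have hdvd : 2 ∣ Nat.card N := by
    obtain ⟨k, hk⟩ := IsPGroup.iff_card.1 (hQ.to_subgroup N)
    rw [hk]
    refine dvd_pow_self 2 fun h0 => hN ?_
    rw [h0, pow_zero] at hk
    exact Subgroup.card_eq_one.1 hk
  obtain ⟨b, hb, hb1⟩ := hQ.exists_fixed_point_of_prime_dvd_card_of_fixed_point N hdvd (a := 1)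
    (fun g => Subtype.ext (by rw [hact]; simp))
  have hbf : ∀ g : Q, g * (b : Q) * g⁻¹ = b := fun g => by rw [← hact, hb g]
  obtain ⟨k, hk⟩ := hQ b
  have hex : ∃ k, (b : Q) ^ 2 ^ k = 1 := ⟨k, hk⟩
  have hb1' : (b : Q) ≠ 1 := fun h => hb1 (Subtype.ext h.symm)
  obtain ⟨m, hm⟩ : ∃ m, Nat.find hex = m + 1 := by
    refine Nat.exists_eq_succ_of_ne_zero fun h0 => hb1' ?_
    have := Nat.find_spec hex
    rwa [h0, pow_zero, pow_one] at this
  refine ⟨(b : Q) ^ 2 ^ m, N.pow_mem b.2 _, Nat.find_min hex (by omega), ?_, fun g => ?_⟩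
  · rw [← pow_add, ← mul_two, ← pow_succ, ← hm]
    exact Nat.find_spec hex
  · rw [← conj_pow, hbf]

lemma Nrm.mem_normalizer {g : M} {Z : Subgroup M} (h : Nrm g Z) :
    g ∈ Subgroup.normalizer (Z : Set M) := Subgroup.mem_normalizer_fintype h

lemma isPGroup_zpowers {Q : Type} [Group Q] {c : Q} (hc : Is2 c) :
    IsPGroup 2 (Subgroup.zpowers c) := by
  have : Fact (Nat.Prime 2) := ⟨Nat.prime_two⟩
  obtain ⟨k, hk⟩ := hc
  obtain ⟨m, -, hm⟩ := (Nat.dvd_prime_pow Nat.prime_two).1 (orderOf_dvd_of_pow_eq_one hk)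
  exact IsPGroup.of_card (n := m) (by rw [Nat.card_zpowers, hm])

lemma exists_sylow_stable {C : Subgroup M} {h : M} (h2 : h * h = 1) (hC : Nrm h C) {c : M}
    (hc : c ∈ C) (hc2 : Is2 c) (hcC : ∀ a ∈ C, a * c = c * a) :
    ∃ D ≤ C, IsPGroup 2 D ∧ Odd (D.relIndex C) ∧ Nrm h D ∧ c ∈ D := by
  have : Fact (Nat.Prime 2) := ⟨Nat.prime_two⟩
  have hhh : ∀ c, h * (h * c * h⁻¹) * h⁻¹ = c := Nrm.conj_conj h2
  let τ : MulAut C :=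
    { toFun := fun c => ⟨h * c * h⁻¹, hC c c.2⟩
      invFun := fun c => ⟨h * c * h⁻¹, hC c c.2⟩
      left_inv := fun c => Subtype.ext (hhh c)
      right_inv := fun c => Subtype.ext (hhh c)
      map_mul' := fun a b => Subtype.ext (by simp) }
  have hτ : τ * τ = 1 := by ext c; exact hhh c
  have hS : ¬ 2 ∣ Fintype.card (Sylow 2 C) := by
    have := card_sylow_modEq_one 2 C
    rw [Nat.card_eq_fintype_card] at this
    intro h
    rw [Nat.ModEq] at this
    omega
  obtain ⟨P, hP⟩ := Equiv.Perm.exists_fixed_point_of_prime (p := 2) (n := 1) hS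
    (σ := MulAction.toPerm τ) (by
      rw [pow_one, pow_two]
      ext P : 1
      change τ • τ • P = P
      rw [smul_smul, hτ, one_smul])
  change τ • P = P at hP
  refine ⟨(P : Subgroup C).map C.subtype, Subgroup.map_subtype_le _, P.2.map _, ?_, ?_, ?_⟩
  · have hi : ((P : Subgroup C).map C.subtype).relIndex C = (P : Subgroup C).index := by
      change (((P : Subgroup C).map C.subtype).comap C.subtype).index = _
      rw [Subgroup.comap_map_eq_self_of_injective C.subtype_injective]
    rw [hi, ← Nat.not_even_iff_odd, even_iff_two_dvd]
    exact P.not_dvd_index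
  · rintro _ ⟨p, hp, rfl⟩
    refine ⟨τ p, ?_, rfl⟩
    rw [← hP]
    exact Subgroup.smul_mem_pointwise_smul p τ (P : Subgroup C) hp
  · refine ⟨⟨c, hc⟩, ?_, rfl⟩
    have hz : IsPGroup 2 (Subgroup.zpowers (⟨c, hc⟩ : C)) :=
      isPGroup_zpowers (hc2.imp fun k hk => Subtype.ext hk)
    have hle := hz.inf_normalizer_sylow P
    have hmem : (⟨c, hc⟩ : C) ∈ Subgroup.zpowers (⟨c, hc⟩ : C) ⊓
        Subgroup.normalizer (P : Set C) := by
      refine ⟨Subgroup.mem_zpowers _, Subgroup.mem_normalizer_fintype fun n hn => ?_⟩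
      have : (⟨c, hc⟩ : C) * n * (⟨c, hc⟩ : C)⁻¹ = n := by
        rw [mul_inv_eq_iff_eq_mul]
        exact Subtype.ext (hcC n n.2).symm
      rw [this]
      exact hn
    rw [hle] at hmem
    exact hmem.2

lemma exists_fixed_coset {D Z : Subgroup M} {h : M} (hD : IsPGroup 2 D) (h2 : h * h = 1)
    (hhD : Nrm h D) (hZD : Z ≤ D) (hDZ : ∀ d ∈ D, Nrm d Z) (hhZ : Nrm h Z) (hne : ¬ D ≤ Z) :
    ∃ y ∈ D, y ∉ Z ∧ y * y ∈ Z ∧ (∀ d ∈ D, d * y * d⁻¹ * y⁻¹ ∈ Z) ∧ h * y * h⁻¹ * y⁻¹ ∈ Z := by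
  let Γ := Subgroup.zpowers h ⊔ D
  have hhΓ : h ∈ Γ := (le_sup_left : _ ≤ Γ) (Subgroup.mem_zpowers h)
  have hDΓ : D ≤ Γ := le_sup_right
  have hz : IsPGroup 2 (Subgroup.zpowers h) :=
    isPGroup_zpowers ⟨1, by rw [pow_one, pow_two, h2]⟩
  have hΓ : IsPGroup 2 Γ := hz.to_sup_of_normal_right' hD
    ((Subgroup.zpowers_le).2 hhD.mem_normalizer)
  have hΓZ : Γ ≤ Subgroup.normalizer (Z : Set M) :=
    sup_le ((Subgroup.zpowers_le).2 hhZ.mem_normalizer) fun d hd => (hDZ d hd).mem_normalizer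
  have hΓD : Γ ≤ Subgroup.normalizer (D : Set M) :=
    sup_le ((Subgroup.zpowers_le).2 hhD.mem_normalizer) Subgroup.le_normalizer
  have : (Z.subgroupOf Γ).Normal :=
    (Subgroup.normal_subgroupOf_iff_le_normalizer (hZD.trans hDΓ)).2 hΓZ
  have : (D.subgroupOf Γ).Normal := (Subgroup.normal_subgroupOf_iff_le_normalizer hDΓ).2 hΓD
  let π := QuotientGroup.mk' (Z.subgroupOf Γ)
  have hπ : Function.Surjective π := QuotientGroup.mk'_surjective _
  let N := (D.subgroupOf Γ).map π
  have hNn : N.Normal := Subgroup.Normal.map inferInstance π hπ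
  have hker : ∀ g : Γ, π g = 1 ↔ (g : M) ∈ Z := fun g => by
    rw [← MonoidHom.mem_ker, QuotientGroup.ker_mk']; rfl
  obtain ⟨q, ⟨y, hy, rfl⟩, hq1, hq2, hq⟩ := exists_central (hΓ.to_quotient _) N (by
    obtain ⟨d, hd, hdZ⟩ := SetLike.not_le_iff_exists.1 hne
    intro h
    have : π ⟨d, hDΓ hd⟩ ∈ N := ⟨_, hd, rfl⟩
    rw [h, Subgroup.mem_bot, hker] at this
    exact hdZ this)
  have hfix : ∀ g : Γ, (g : M) * y * (g : M)⁻¹ * (y : M)⁻¹ ∈ Z := fun g => by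
    have h1 : π (g * y * g⁻¹ * y⁻¹) = 1 := by
      obtain hg := hq (π g)
      rw [map_mul, map_mul, map_mul, map_inv, map_inv, hg, mul_inv_cancel]
    exact (hker _).1 h1
  refine ⟨y, hy, fun h => hq1 ((hker y).2 h), (hker (y * y)).1 (by rw [map_mul, hq2]),
    fun d hd => hfix ⟨d, hDΓ hd⟩, hfix ⟨h, hhΓ⟩⟩

lemma eq_one_or_of_sq {c e v : M} {k : ℕ} (hce : c ^ 2 ^ k = e) (he1 : e ≠ 1) (he2 : e * e = 1)
    (hv : v ∈ Subgroup.zpowers c) (hv2 : v * v = 1) : v = 1 ∨ v = e := by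
  have : Fact (Nat.Prime 2) := ⟨Nat.prime_two⟩
  have ho : orderOf c = 2 ^ (k + 1) := orderOf_eq_prime_pow (by rwa [hce])
    (by rw [pow_succ, _root_.pow_mul, hce, pow_two, he2])
  obtain ⟨n, rfl⟩ := (mem_powers_iff_mem_zpowers (x := c)).2 hv
  simp only at hv2 ⊢
  rw [← pow_add, ← two_mul] at hv2
  have hd := orderOf_dvd_of_pow_eq_one hv2
  rw [ho, pow_succ', Nat.mul_dvd_mul_iff_left two_pos] at hd
  obtain ⟨m, rfl⟩ := hd
  rw [_root_.pow_mul, hce]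
  obtain ⟨l, rfl⟩ | ⟨l, rfl⟩ := Nat.even_or_odd m
  · left; rw [← two_mul, _root_.pow_mul, pow_two, he2, one_pow]
  · right; rw [pow_succ, _root_.pow_mul, pow_two, he2, one_pow, one_mul]

lemma sylow_refine {D : Subgroup M} {c e h : M} {k : ℕ} (hD : IsPGroup 2 D) (h2 : h * h = 1)
    (hhD : Nrm h D) (hcD : c ∈ D) (hce : c ^ 2 ^ k = e) (he1 : e ≠ 1) (he2 : e * e = 1)
    (hcen : ∀ d ∈ D, d * c = c * d) (hhc : h * c * h⁻¹ = c⁻¹) :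
    D ≤ Subgroup.zpowers c ∨
    (∃ z ∈ D, z * z = 1 ∧ z ≠ 1 ∧ z ≠ e ∧ (∀ d ∈ D, d * z * d⁻¹ = z ∨ d * z * d⁻¹ = e * z) ∧
      (h * z * h⁻¹ = z ∨ h * z * h⁻¹ = e * z)) ∨
    (∃ b ∈ D, b * b = c ∧ (∀ d ∈ D, d * b * d⁻¹ = b ∨ d * b * d⁻¹ = e * b) ∧
      (h * b * h⁻¹ = b⁻¹ ∨ h * b * h⁻¹ = e * b⁻¹)) := by
  by_cases hne : D ≤ Subgroup.zpowers c
  · exact Or.inl hne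
  right
  have hZD : Subgroup.zpowers c ≤ D := (Subgroup.zpowers_le).2 hcD
  have hzc : ∀ d ∈ D, ∀ v ∈ Subgroup.zpowers c, d * v = v * d := by
    rintro d hd _ ⟨n, rfl⟩
    exact (Commute.zpow_right (show Commute d c from hcen d hd) n).eq
  have hhz : ∀ n : ℤ, h * c ^ n * h⁻¹ = c ^ (-n) := fun n => by
    rw [← conj_zpow, hhc, _root_.inv_zpow, _root_.zpow_neg]
  obtain ⟨y, hy, hyZ, ⟨j, hj⟩, hyd, hyh⟩ := exists_fixed_coset hD h2 hhD hZD
    (fun d hd v hv => by rwa [hzc d hd v hv, mul_inv_cancel_right])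
    (by rintro _ ⟨n, rfl⟩; exact ⟨-n, (hhz n).symm⟩) hne
  have key := fun v hv => eq_one_or_of_sq hce he1 he2 (v := v) hv
  have heZ : e ∈ Subgroup.zpowers c := hce ▸ Subgroup.npow_mem_zpowers c _
  -- properties of all elements of the coset of `y`
  have hcos : ∀ i : ℤ, y * c ^ i ∈ D ∧ y * c ^ i ∉ Subgroup.zpowers c ∧
      (y * c ^ i) * (y * c ^ i) = c ^ (j + 2 * i) ∧
      (∀ d ∈ D, d * (y * c ^ i) * d⁻¹ * (y * c ^ i)⁻¹ ∈ Subgroup.zpowers c) ∧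
      h * (y * c ^ i) * h⁻¹ * (y * c ^ i)⁻¹ ∈ Subgroup.zpowers c := by
    intro i
    have hci : c ^ i ∈ Subgroup.zpowers c := ⟨i, rfl⟩
    have hyi := hzc y hy _ hci
    refine ⟨D.mul_mem hy (hZD hci), fun h => hyZ ?_, ?_, fun d hd => ?_, ?_⟩
    · exact (Subgroup.mul_mem_cancel_right _ hci).1 h
    · rw [mul_assoc, ← mul_assoc (c ^ i), ← hyi, mul_assoc y (c ^ i), ← mul_assoc, ← hj,
        ← _root_.zpow_add, ← _root_.zpow_add]
      ring_nf
    · have : d * (y * c ^ i) * d⁻¹ * (y * c ^ i)⁻¹ = d * y * d⁻¹ * y⁻¹ := by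
        have h1 := hzc _ (D.inv_mem hd) _ hci
        rw [← mul_assoc, mul_assoc (d * y), ← h1, _root_.mul_inv_rev]
        group
      rw [this]
      exact hyd d hd
    · have : h * (y * c ^ i) * h⁻¹ * (y * c ^ i)⁻¹ =
          (h * y * h⁻¹ * y⁻¹) * c ^ (-i + -i) := by
        have h1 := hzc _ (D.inv_mem hy) (c ^ (-i + -i)) ⟨_, rfl⟩
        calc h * (y * c ^ i) * h⁻¹ * (y * c ^ i)⁻¹
            = h * y * h⁻¹ * (h * c ^ i * h⁻¹ * c ^ (-i) * y⁻¹) := by group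
          _ = h * y * h⁻¹ * (c ^ (-i + -i) * y⁻¹) := by rw [hhz, _root_.zpow_add]
          _ = _ := by rw [← h1, ← mul_assoc]
      rw [this]
      exact Subgroup.mul_mem _ hyh ⟨_, rfl⟩
  have hconj : ∀ g b : M, (g * b * g⁻¹) * (g * b * g⁻¹) = g * (b * b) * g⁻¹ := fun g b => by
    group
  rcases Int.even_or_odd' j with ⟨i, rfl | rfl⟩
  · left
    obtain ⟨hzD, hzZ, hz2, hzd, hzh⟩ := hcos (-i)
    set z := y * c ^ (-i)
    have hz2 : z * z = 1 := by rw [hz2]; simp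
    have fin : ∀ g : M, g * z * g⁻¹ * z⁻¹ ∈ Subgroup.zpowers c →
        g * z * g⁻¹ = z ∨ g * z * g⁻¹ = e * z := by
      intro g hg
      have := key _ hg (by
        have h2 := hconj g z
        rw [hz2, mul_one, mul_inv_cancel] at h2
        calc _ = (g * z * g⁻¹) * (z⁻¹ * (g * z * g⁻¹ * z⁻¹)) := by group
          _ = (g * z * g⁻¹) * ((g * z * g⁻¹ * z⁻¹) * z⁻¹) := by
            rw [← hzc _ (D.inv_mem hzD) _ hg]
          _ = (g * z * g⁻¹) * (g * z * g⁻¹) * (z * z)⁻¹ := by group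
          _ = 1 := by rw [h2, hz2, _root_.inv_one, mul_one])
      exact this.imp mul_inv_eq_one.1 mul_inv_eq_iff_eq_mul.1
    exact ⟨z, hzD, hz2, fun h => hzZ (h ▸ Subgroup.one_mem _), fun h => hzZ (h ▸ heZ),
      fun d hd => fin d (hzd d hd), fin h hzh⟩
  · right
    obtain ⟨hbD, -, hb2, hbd, hbh⟩ := hcos (-i)
    set b := y * c ^ (-i)
    have hb2 : b * b = c := by rw [hb2]; ring_nf; exact zpow_one c
    refine ⟨b, hbD, hb2, fun d hd => ?_, ?_⟩
    · have h1 := hzc b hbD _ (hbd d hd)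
      have h2 := hconj d b
      rw [hb2, hcen d hd, mul_inv_cancel_right] at h2
      have := key _ (hbd d hd) (by
        calc _ = (d * b * d⁻¹) * (b⁻¹ * (d * b * d⁻¹ * b⁻¹)) := by group
          _ = (d * b * d⁻¹) * ((d * b * d⁻¹ * b⁻¹) * b⁻¹) := by
            rw [← hzc _ (D.inv_mem hbD) _ (hbd d hd)]
          _ = (d * b * d⁻¹) * (d * b * d⁻¹) * (b * b)⁻¹ := by group
          _ = 1 := by rw [h2, hb2, mul_inv_cancel])
      exact this.imp mul_inv_eq_one.1 mul_inv_eq_iff_eq_mul.1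
    · have h2 := hconj h b
      rw [hb2, hhc] at h2
      have hv : h * b * h⁻¹ * b ∈ Subgroup.zpowers c := by
        have : h * b * h⁻¹ * b = h * b * h⁻¹ * b⁻¹ * c := by rw [← hb2]; group
        rw [this]
        exact Subgroup.mul_mem _ hbh (Subgroup.mem_zpowers c)
      have := key _ hv (by
        calc _ = (h * b * h⁻¹) * (b * (h * b * h⁻¹ * b)) := by group
          _ = (h * b * h⁻¹) * ((h * b * h⁻¹ * b) * b) := by rw [← hzc _ hbD _ hv]
          _ = (h * b * h⁻¹) * (h * b * h⁻¹) * (b * b) := by group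
          _ = 1 := by rw [h2, hb2, inv_mul_cancel])
      exact this.imp mul_eq_one_iff_eq_inv.1 eq_mul_inv_iff_mul_eq.2

end SylowAux

section Forms

variable {F V : Type} [Field F] [AddCommGroup V] [Module F V]

/-- A nondegenerate symmetric bilinear form. -/
structure SymForm (B : LinearMap.BilinForm F V) : Prop where
  symm : ∀ x y, B x y = B y x
  nondeg : ∀ x, (∀ y, B x y = 0) → x = 0

/-- The subspace `U` is nondegenerate. -/
def NonDegOn (B : LinearMap.BilinForm F V) (U : Submodule F V) : Prop :=
  ∀ x ∈ U, (∀ y ∈ U, B x y = 0) → x = 0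

variable {B : LinearMap.BilinForm F V} {U : Submodule F V}

lemma SymForm.isRefl (hB : SymForm B) : B.IsRefl := fun x y h => by rw [hB.symm, h]

lemma SymForm.restrict (hB : SymForm B) (hU : NonDegOn B U) : SymForm (B.restrict U) where
  symm x y := hB.symm x y
  nondeg x h := Subtype.ext (hU x x.2 fun y hy => h ⟨y, hy⟩)

lemma SymForm.isCompl [FiniteDimensional F V] (hB : SymForm B) (hU : NonDegOn B U) :
    IsCompl U (B.orthogonal U) := by
  refine (LinearMap.BilinForm.isCompl_orthogonal_iff_disjoint hB.isRefl).2 ?_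
  rw [Submodule.disjoint_def]
  intro x hx hx'
  refine hU x hx fun y hy => ?_
  rw [hB.symm]
  exact LinearMap.BilinForm.mem_orthogonal_iff.1 hx' y hy

lemma exists_add_of_isCompl {U U' : Submodule F V} (h : IsCompl U U') (x : V) :
    ∃ u ∈ U, ∃ u' ∈ U', x = u + u' := by
  have : x ∈ U ⊔ U' := by rw [h.sup_eq_top]; trivial
  obtain ⟨u, hu, u', hu', rfl⟩ := Submodule.mem_sup.1 this
  exact ⟨u, hu, u', hu', rfl⟩

/-- An orthogonal decomposition has nondegenerate parts. -/
lemma SymForm.nonDegOn_of_isCompl (hB : SymForm B) {U' : Submodule F V} (h : IsCompl U U')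
    (ho : ∀ x ∈ U, ∀ y ∈ U', B x y = 0) : NonDegOn B U := by
  intro x hx hx'
  refine hB.nondeg x fun y => ?_
  obtain ⟨u, hu, u', hu', rfl⟩ := exists_add_of_isCompl h y
  rw [map_add, hx' u hu, ho x hx u' hu', add_zero]

lemma SymForm.nonDegOn_orthogonal [FiniteDimensional F V] (hB : SymForm B) (hU : NonDegOn B U) :
    NonDegOn B (B.orthogonal U) :=
  hB.nonDegOn_of_isCompl (hB.isCompl hU).symm fun x hx y hy => by
    rw [hB.symm]; exact LinearMap.BilinForm.mem_orthogonal_iff.1 hx y hy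

/-- Glue endomorphisms of complementary subspaces. -/
def glue {U U' : Submodule F V} (h : IsCompl U U') (a : Module.End F U) (b : Module.End F U') :
    Module.End F V :=
  LinearMap.ofIsCompl h (U.subtype ∘ₗ a) (U'.subtype ∘ₗ b)

variable {U' : Submodule F V} (h : IsCompl U U')

@[simp] lemma glue_left (a : Module.End F U) (b : Module.End F U') (u : U) :
    glue h a b u = a u := LinearMap.ofIsCompl_apply_left h u

@[simp] lemma glue_right (a : Module.End F U) (b : Module.End F U') (u : U') :
    glue h a b u = b u := LinearMap.ofIsCompl_apply_right h u

lemma end_ext (h : IsCompl U U') {a b : Module.End F V} (h1 : ∀ u ∈ U, a u = b u)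
    (h2 : ∀ u ∈ U', a u = b u) :
    a = b := by
  ext x
  obtain ⟨u, hu, u', hu', rfl⟩ := exists_add_of_isCompl h x
  rw [map_add, map_add, h1 u hu, h2 u' hu']

lemma isometry_of_isCompl (h : IsCompl U U') (hB : SymForm B) (ho : ∀ x ∈ U, ∀ y ∈ U', B x y = 0)
    {a : Module.End F V} (hU : ∀ x ∈ U, a x ∈ U) (hU' : ∀ x ∈ U', a x ∈ U')
    (h1 : ∀ x ∈ U, ∀ y ∈ U, B (a x) (a y) = B x y)
    (h2 : ∀ x ∈ U', ∀ y ∈ U', B (a x) (a y) = B x y) (x y : V) : B (a x) (a y) = B x y := by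
  obtain ⟨u, hu, u', hu', rfl⟩ := exists_add_of_isCompl h x
  obtain ⟨w, hw, w', hw', rfl⟩ := exists_add_of_isCompl h y
  simp only [map_add, LinearMap.add_apply]
  rw [h1 u hu w hw, h2 u' hu' w' hw', ho u hu w' hw', hB.symm u' w, ho w hw u' hu',
    ho _ (hU u hu) _ (hU' _ hw'), hB.symm (a u') (a w), ho _ (hU w hw) _ (hU' _ hu')]

/-- A family of isometries is simultaneously inverted by an isometric involution. -/
def Reversible (B : LinearMap.BilinForm F V) {ι : Type} (g g' : ι → Module.End F V) : Prop :=
  ∃ a : Module.End F V, a * a = 1 ∧ (∀ x y, B (a x) (a y) = B x y) ∧ ∀ i, a * g i = g' i * a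

/-- `U` is stable under the family. -/
def StableFam {ι : Type} (g : ι → Module.End F V) (U : Submodule F V) : Prop :=
  ∀ i, ∀ x ∈ U, g i x ∈ U

lemma reversible_glue (h : IsCompl U U') (hB : SymForm B) (ho : ∀ x ∈ U, ∀ y ∈ U', B x y = 0)
    {ι : Type} {g g' : ι → Module.End F V} (hg : StableFam g U) (hg' : StableFam g' U)
    (hgo : StableFam g U') (hgo' : StableFam g' U')
    (h1 : Reversible (B.restrict U) (fun i => (g i).restrict (hg i))
      (fun i => (g' i).restrict (hg' i)))
    (h2 : Reversible (B.restrict U') (fun i => (g i).restrict (hgo i))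
      (fun i => (g' i).restrict (hgo' i))) : Reversible B g g' := by
  obtain ⟨a, ha, hai, hag⟩ := h1
  obtain ⟨b, hb, hbi, hbg⟩ := h2
  have hl : ∀ x (hx : x ∈ U), glue h a b x = a ⟨x, hx⟩ := fun x hx => glue_left h a b ⟨x, hx⟩
  have hr : ∀ x (hx : x ∈ U'), glue h a b x = b ⟨x, hx⟩ := fun x hx => glue_right h a b ⟨x, hx⟩
  refine ⟨glue h a b, end_ext h (fun u hu => ?_) (fun u hu => ?_),
    isometry_of_isCompl h hB ho (fun u hu => ?_) (fun u hu => ?_) (fun x hx y hy => ?_)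
      (fun x hx y hy => ?_), fun i => end_ext h (fun u hu => ?_) (fun u hu => ?_)⟩
  · rw [Module.End.mul_apply, hl u hu, glue_left, ← Module.End.mul_apply, ha]; rfl
  · rw [Module.End.mul_apply, hr u hu, glue_right, ← Module.End.mul_apply, hb]; rfl
  · rw [hl u hu]; exact (a _).2
  · rw [hr u hu]; exact (b _).2
  · rw [hl x hx, hl y hy]; exact hai ⟨x, hx⟩ ⟨y, hy⟩
  · rw [hr x hx, hr y hy]; exact hbi ⟨x, hx⟩ ⟨y, hy⟩
  · rw [Module.End.mul_apply, Module.End.mul_apply, hl u hu, hl _ (hg i u hu)]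
    exact congrArg Subtype.val (LinearMap.congr_fun (hag i) ⟨u, hu⟩)
  · rw [Module.End.mul_apply, Module.End.mul_apply, hr u hu, hr _ (hgo i u hu)]
    exact congrArg Subtype.val (LinearMap.congr_fun (hbg i) ⟨u, hu⟩)

lemma StableFam.orthogonal {ι : Type} {g g' : ι → Module.End F V}
    (hadj : ∀ i x y, B (g i x) y = B x (g' i y)) (hg : StableFam g U) :
    StableFam g' (B.orthogonal U) := fun i x hx => by
  rw [LinearMap.BilinForm.mem_orthogonal_iff] at hx ⊢
  intro n hn
  rw [← hadj]
  exact hx _ (hg i n hn)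

/-- Splitting off a nondegenerate stable subspace. -/
lemma reversible_of_split [FiniteDimensional F V] (hB : SymForm B) {ι : Type}
    {g g' : ι → Module.End F V} (hadj : ∀ i x y, B (g i x) y = B x (g' i y))
    (hU : NonDegOn B U) (hg : StableFam g U) (hg' : StableFam g' U)
    (h1 : Reversible (B.restrict U) (fun i => (g i).restrict (hg i))
      (fun i => (g' i).restrict (hg' i)))
    (h2 : ∀ (hgo : StableFam g (B.orthogonal U)) (hgo' : StableFam g' (B.orthogonal U)),
      Reversible (B.restrict (B.orthogonal U)) (fun i => (g i).restrict (hgo i))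
      (fun i => (g' i).restrict (hgo' i))) : Reversible B g g' :=
  have hgo' := hg.orthogonal hadj
  have hgo := hg'.orthogonal (B := B) (g' := g) fun i x y => by
    rw [hB.symm, ← hadj, hB.symm]
  reversible_glue (hB.isCompl hU) hB
    (fun x hx y hy => LinearMap.BilinForm.mem_orthogonal_iff.1 hy x hx) hg hg' hgo hgo' h1
    (h2 hgo hgo')

/-- Reversal by the reflection in a subspace. -/
lemma reversible_of_reflection (h2 : (2 : F) ≠ 0) (hB : SymForm B)
    {ι : Type} {g g' : ι → Module.End F V} (hc : U ⊔ U' = ⊤)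
    (ho : ∀ x ∈ U, ∀ y ∈ U', B x y = 0)
    (hs : ∀ i, ∀ x ∈ U, g i x + g' i x ∈ U) (hs' : ∀ i, ∀ x ∈ U', g i x + g' i x ∈ U')
    (ht : ∀ i, ∀ x ∈ U, g i x - g' i x ∈ U') (ht' : ∀ i, ∀ x ∈ U', g i x - g' i x ∈ U) :
    Reversible B g g' := by
  have hd : IsCompl U U' := by
    refine ⟨Submodule.disjoint_def.2 fun x hx hx' => hB.nondeg x fun y => ?_,
      codisjoint_iff.2 hc⟩
    have : y ∈ U ⊔ U' := by rw [hc]; trivial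
    obtain ⟨u, hu, u', hu', rfl⟩ := Submodule.mem_sup.1 this
    rw [map_add, ho x hx u' hu', hB.symm, ho u hu x hx', add_zero]
  have hl : ∀ x ∈ U, glue hd 1 (-1) x = x := fun x hx => glue_left hd _ _ ⟨x, hx⟩
  have hr : ∀ x ∈ U', glue hd 1 (-1) x = -x := fun x hx => glue_right hd _ _ ⟨x, hx⟩
  set a := glue hd (1 : Module.End F U) (-1 : Module.End F U')
  refine ⟨a, end_ext hd (fun u hu => ?_) (fun u hu => ?_),
    isometry_of_isCompl hd hB ho (fun u hu => ?_) (fun u hu => ?_) (fun x hx y hy => ?_)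
      (fun x hx y hy => ?_), fun i => end_ext hd (fun u hu => ?_) (fun u hu => ?_)⟩
  · rw [Module.End.mul_apply, hl u hu, hl u hu]; rfl
  · rw [Module.End.mul_apply, hr u hu, map_neg, hr u hu, neg_neg]; rfl
  · rw [hl u hu]; exact hu
  · rw [hr u hu]; exact U'.neg_mem hu
  · rw [hl x hx, hl y hy]
  · rw [hr x hx, hr y hy]; simp
  · have e1 := hl _ (hs i u hu)
    have e2 := hr _ (ht i u hu)
    rw [map_add] at e1
    rw [map_sub] at e2
    rw [Module.End.mul_apply, Module.End.mul_apply, hl u hu]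
    refine smul_right_injective V h2 ?_
    simp only [two_smul]
    calc _ = (a (g i u) + a (g' i u)) + (a (g i u) - a (g' i u)) := by abel
      _ = _ := by rw [e1, e2]; abel
  · have e1 := hr _ (hs' i u hu)
    have e2 := hl _ (ht' i u hu)
    rw [map_add] at e1
    rw [map_sub] at e2
    rw [Module.End.mul_apply, Module.End.mul_apply, hr u hu, map_neg]
    refine smul_right_injective V h2 ?_
    simp only [two_smul]
    calc _ = (a (g i u) + a (g' i u)) + (a (g i u) - a (g' i u)) := by abel
      _ = _ := by rw [e1, e2]; abel

end Forms

section Socle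

open Polynomial

variable {F V : Type} [Field F] [AddCommGroup V] [Module F V] {s : Module.End F V} {r : F[X]}
  {m : ℕ}

lemma exists_aeval_inv (hr : Irreducible r) (hm : aeval s (r ^ (m + 1)) = 0) {u : F[X]}
    (hu : ¬ r ∣ u) : ∃ u', aeval s (u * u') = 1 := by
  obtain ⟨a, b, hab⟩ := ((hr.coprime_iff_not_dvd.2 hu).pow_left : IsCoprime (r ^ (m + 1)) u)
  refine ⟨b, ?_⟩
  have := congrArg (aeval s) hab
  rw [map_add, map_mul, hm, mul_zero, zero_add, map_one] at this
  rwa [mul_comm]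

lemma exists_aeval_factor (hr : Irreducible r) (hm : aeval s (r ^ (m + 1)) = 0) {a : F[X]}
    (ha : aeval s a ≠ 0) : ∃ i ≤ m, ∃ u u', a = r ^ i * u ∧ aeval s (u * u') = 1 := by
  have ha0 : a ≠ 0 := by rintro rfl; exact ha (map_zero _)
  obtain ⟨i, u, hu, rfl⟩ := WfDvdMonoid.max_power_factor ha0 hr
  obtain ⟨u', hu'⟩ := exists_aeval_inv hr hm hu
  refine ⟨i, ?_, u, u', rfl, hu'⟩
  by_contra hi
  obtain ⟨j, rfl⟩ := Nat.exists_eq_add_of_lt (not_le.1 hi)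
  apply ha
  rw [show m + j + 1 = m + 1 + j by ring, pow_add, mul_assoc, map_mul, hm, zero_mul]

lemma exists_socle_pair (hr : Irreducible r) (hm : aeval s (r ^ (m + 1)) = 0) {a b : F[X]}
    (h : ¬ (aeval s a = 0 ∧ aeval s b = 0)) :
    ∃ e, (aeval s (e * a) = aeval s (r ^ m) ∧ ∃ c, aeval s (e * b) = aeval s (r ^ m * c)) ∨
      (aeval s (e * a) = 0 ∧ aeval s (e * b) = aeval s (r ^ m)) := by
  by_cases ha : aeval s a = 0
  · have hb : aeval s b ≠ 0 := fun hb => h ⟨ha, hb⟩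
    obtain ⟨i, hi, u, u', rfl, hu⟩ := exists_aeval_factor hr hm hb
    refine ⟨r ^ (m - i) * u', Or.inr ⟨by rw [map_mul, ha, mul_zero], ?_⟩⟩
    rw [show r ^ (m - i) * u' * (r ^ i * u) = r ^ (m - i) * r ^ i * (u * u') by ring, ← pow_add,
      Nat.sub_add_cancel hi, map_mul, hu, mul_one]
  obtain ⟨i, hi, u, u', rfl, hu⟩ := exists_aeval_factor hr hm ha
  by_cases hb : aeval s b = 0
  · refine ⟨r ^ (m - i) * u', Or.inl ⟨?_, 0, by rw [map_mul, hb, mul_zero, mul_zero, map_zero]⟩⟩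
    rw [show r ^ (m - i) * u' * (r ^ i * u) = r ^ (m - i) * r ^ i * (u * u') by ring, ← pow_add,
      Nat.sub_add_cancel hi, map_mul, hu, mul_one]
  obtain ⟨j, hj, w, w', rfl, hw⟩ := exists_aeval_factor hr hm hb
  by_cases hij : i ≤ j
  · refine ⟨r ^ (m - i) * u', Or.inl ⟨?_, r ^ (j - i) * w * u', ?_⟩⟩
    · rw [show r ^ (m - i) * u' * (r ^ i * u) = r ^ (m - i) * r ^ i * (u * u') by ring, ← pow_add,
        Nat.sub_add_cancel hi, map_mul, hu, mul_one]
    · congr 1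
      obtain ⟨k, rfl⟩ := Nat.exists_eq_add_of_le hij
      obtain ⟨l, rfl⟩ := Nat.exists_eq_add_of_le hi
      rw [Nat.add_sub_cancel_left, Nat.add_sub_cancel_left]
      ring
  · obtain ⟨k, rfl⟩ := Nat.exists_eq_add_of_lt (not_le.1 hij)
    obtain ⟨l, rfl⟩ := Nat.exists_eq_add_of_le hj
    refine ⟨r ^ l * w', Or.inr ⟨?_, ?_⟩⟩
    · rw [show r ^ l * w' * (r ^ (j + k + 1) * u) = r ^ (j + l + 1) * (r ^ k * w' * u) by ring,
        map_mul, hm, zero_mul]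
    · rw [show r ^ l * w' * (r ^ j * w) = r ^ (j + l) * (w * w') by ring,
        map_mul, hw, mul_one]

lemma exists_socle (hr : Irreducible r) (hm : aeval s (r ^ (m + 1)) = 0) {a : F[X]}
    (ha : aeval s a ≠ 0) : ∃ e, aeval s (e * a) = aeval s (r ^ m) := by
  obtain ⟨i, hi, u, u', rfl, hu⟩ := exists_aeval_factor hr hm ha
  refine ⟨r ^ (m - i) * u', ?_⟩
  rw [show r ^ (m - i) * u' * (r ^ i * u) = r ^ (m - i) * r ^ i * (u * u') by ring, ← pow_add,
    Nat.sub_add_cancel hi, map_mul, hu, mul_one]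

/-- An element killed by `r` lies in the socle. -/
lemma mem_socle (hr : Irreducible r) (hm : aeval s (r ^ (m + 1)) = 0) (hm' : aeval s (r ^ m) ≠ 0)
    {a : F[X]} (ha : aeval s (r * a) = 0) : ∃ c, aeval s a = aeval s (r ^ m * c) := by
  by_cases ha0 : aeval s a = 0
  · exact ⟨0, by rw [ha0, mul_zero, map_zero]⟩
  obtain ⟨i, hi, u, u', rfl, hu⟩ := exists_aeval_factor hr hm ha0
  obtain rfl | hlt := hi.eq_or_lt
  · exact ⟨u, rfl⟩
  · exfalso
    apply hm'
    obtain ⟨l, rfl⟩ := Nat.exists_eq_add_of_lt hlt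
    rw [← mul_one (aeval s _), ← hu, ← map_mul,
      show r ^ (i + l + 1) * (u * u') = (r * (r ^ i * u)) * (r ^ l * u') by ring, map_mul, ha,
      zero_mul]

lemma exists_socle_exponent [Nontrivial V] (hn : IsNilpotent (aeval s r)) :
    ∃ m, aeval s (r ^ (m + 1)) = 0 ∧ aeval s (r ^ m) ≠ 0 := by
  have hex : ∃ k, aeval s (r ^ k) = 0 := by simpa [IsNilpotent] using hn
  obtain ⟨m, hm⟩ : ∃ m, Nat.find hex = m + 1 := by
    refine Nat.exists_eq_succ_of_ne_zero fun h0 => ?_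
    have := Nat.find_spec hex
    rw [h0, pow_zero, map_one] at this
    exact one_ne_zero this
  exact ⟨m, hm ▸ Nat.find_spec hex, Nat.find_min hex (by omega)⟩

/-- Some irreducible polynomial acts non-injectively. -/
lemma exists_irreducible_not_injective [FiniteDimensional F V] [Nontrivial V]
    (s : Module.End F V) :
    ∃ r : F[X], Irreducible r ∧ ¬ Function.Injective (aeval s r) := by
  by_contra! hcon
  have key : ∀ f : F[X], f ≠ 0 → Function.Injective (aeval s f) := by
    intro f
    induction f using WfDvdMonoid.induction_on_irreducible with
    | zero => intro h; exact absurd rfl h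
    | unit u hu =>
      intro _
      have : IsUnit (aeval s u) := hu.map _
      exact ((Module.End.isUnit_iff _).1 this).1
    | mul a i ha hi ih =>
      intro _
      rw [map_mul]
      exact (hcon i hi).comp (ih ha)
  have h0 := key _ (minpoly.ne_zero (Algebra.IsIntegral.isIntegral (R := F) s))
  rw [minpoly.aeval] at h0
  obtain ⟨x, hx⟩ := exists_ne (0 : V)
  exact hx (h0 rfl)

end Socle

section Core

open Polynomial

variable {F V : Type} [Field F] [AddCommGroup V] [Module F V] {B : LinearMap.BilinForm F V}

lemma aeval_adj {s : Module.End F V} (hs : ∀ x y, B (s x) y = B x (s y)) (f : F[X]) (x y : V) :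
    B (aeval s f x) y = B x (aeval s f y) := by
  induction f using Polynomial.induction_on' generalizing x y with
  | add p q hp hq => simp [hp, hq]
  | monomial n a =>
    have : ∀ n x y, B ((s ^ n) x) y = B x ((s ^ n) y) := by
      intro n
      induction n with
      | zero => simp
      | succ n ih =>
        intro x y
        rw [pow_succ, Module.End.mul_apply, ih, hs, ← Module.End.mul_apply, ← pow_succ', pow_succ]
    rw [aeval_monomial]
    simp [this]

lemma aeval_stable {s : Module.End F V} {U : Submodule F V} (hU : ∀ x ∈ U, s x ∈ U) (f : F[X])
    {x : V} (hx : x ∈ U) : aeval s f x ∈ U := by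
  induction f using Polynomial.induction_on' with
  | add p q hp hq => simpa using U.add_mem hp hq
  | monomial n a =>
    have : ∀ n, (s ^ n) x ∈ U := by
      intro n
      induction n with
      | zero => simpa
      | succ n ih => rw [pow_succ', Module.End.mul_apply]; exact hU _ ih
    rw [aeval_monomial]
    simpa using U.smul_mem a (this n)

lemma aeval_commute {s t : Module.End F V} (h : t * s = s * t) (f : F[X]) (x : V) :
    t (aeval s f x) = aeval s f (t x) := by
  induction f using Polynomial.induction_on' generalizing x with
  | add p q hp hq => simp [hp, hq]
  | monomial n a =>
    have h1 : t * s ^ n = s ^ n * t := (show Commute t s from h).pow_right n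
    rw [aeval_monomial]
    simpa using congrArg (a • ·) (LinearMap.congr_fun h1 x)

/-- The cyclic subspace generated by `v`. -/
def cyc (s : Module.End F V) (v : V) : Submodule F V :=
  LinearMap.range ((LinearMap.applyₗ v) ∘ₗ (aeval s : F[X] →ₐ[F] Module.End F V).toLinearMap)

lemma mem_cyc {s : Module.End F V} {v x : V} : x ∈ cyc s v ↔ ∃ f : F[X], aeval s f v = x :=
  Iff.rfl

lemma self_mem_cyc (s : Module.End F V) (v : V) : v ∈ cyc s v := ⟨1, by simp⟩

lemma aeval_mem_cyc (s : Module.End F V) (v : V) (f : F[X]) : aeval s f v ∈ cyc s v := ⟨f, rfl⟩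

lemma cyc_stable {s : Module.End F V} {v x : V} (hx : x ∈ cyc s v) : s x ∈ cyc s v := by
  obtain ⟨f, rfl⟩ := mem_cyc.1 hx
  exact ⟨X * f, by simp⟩

/-- The sum of a cyclic subspace and a twisted one. -/
def bicyc (s t : Module.End F V) (v w : V) : Submodule F V := cyc s v ⊔ (cyc s w).map t

lemma mem_bicyc {s t : Module.End F V} {v w x : V} :
    x ∈ bicyc s t v w ↔ ∃ a b : F[X], aeval s a v + t (aeval s b w) = x := by
  rw [bicyc, Submodule.mem_sup]
  constructor
  · rintro ⟨_, ⟨a, rfl⟩, _, ⟨_, ⟨b, rfl⟩, rfl⟩, rfl⟩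
    exact ⟨a, b, rfl⟩
  · rintro ⟨a, b, rfl⟩
    exact ⟨_, ⟨a, rfl⟩, _, ⟨_, ⟨b, rfl⟩, rfl⟩, rfl⟩

lemma nonDegOn_sup (hB : SymForm B) {U U' : Submodule F V} (h : NonDegOn B U) (h' : NonDegOn B U')
    (ho : ∀ x ∈ U, ∀ y ∈ U', B x y = 0) : NonDegOn B (U ⊔ U') := by
  intro x hx hxy
  obtain ⟨u, hu, u', hu', rfl⟩ := Submodule.mem_sup.1 hx
  have h1 : u = 0 := h u hu fun y hy => by
    have := hxy y ((le_sup_left : U ≤ _) hy)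
    rwa [map_add, LinearMap.add_apply, hB.symm u', ho y hy u' hu', add_zero] at this
  have h2 : u' = 0 := h' u' hu' fun y hy => by
    have := hxy y ((le_sup_right : U' ≤ _) hy)
    rwa [map_add, LinearMap.add_apply, ho u hu y hy, zero_add] at this
  rw [h1, h2, add_zero]

/-- Data of a self-adjoint `s` and a commuting skew-adjoint `t`. -/
structure SkewPair (B : LinearMap.BilinForm F V) (s t : Module.End F V) (Q : F[X]) : Prop where
  form : SymForm B
  two : (2 : F) ≠ 0
  self : ∀ x y, B (s x) y = B x (s y)
  skew : ∀ x y, B (t x) y = - B x (t y)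
  comm : t * s = s * t
  sq : ∀ x, t (t x) = aeval s Q x

variable {s t : Module.End F V} {Q : F[X]}

lemma SkewPair.move (h : SkewPair B s t Q) (a b : F[X]) (x y : V) :
    B (aeval s a x) (aeval s b y) = B (aeval s (b * a) x) y := by
  rw [← aeval_adj h.self, map_mul, Module.End.mul_apply]

lemma SkewPair.ortho (h : SkewPair B s t Q) (a b : F[X]) (v : V) :
    B (t (aeval s a v)) (aeval s b v) = 0 := by
  rw [aeval_commute h.comm, h.move, ← aeval_commute h.comm]
  set f := b * a
  have h1 : B (t (aeval s f v)) v = - B (t (aeval s f v)) v := by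
    conv_lhs => rw [h.skew, aeval_adj h.self, h.form.symm, ← aeval_commute h.comm]
  have h2 : (2 : F) * B (t (aeval s f v)) v = 0 := by linear_combination h1
  exact (mul_eq_zero.1 h2).resolve_left h.two

lemma SkewPair.skew_skew (h : SkewPair B s t Q) (a b : F[X]) (v w : V) :
    B (t (aeval s a v)) (t (aeval s b w)) = - B (aeval s (Q * b * a) v) w := by
  rw [h.skew, h.sq, ← Module.End.mul_apply, ← map_mul, h.move]

lemma SkewPair.tmove (h : SkewPair B s t Q) (a b : F[X]) (x y : V) :
    B (t (aeval s a x)) (aeval s b y) = B (t (aeval s (b * a) x)) y := by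
  rw [aeval_commute h.comm, h.move, ← aeval_commute h.comm]

lemma SkewPair.tmove' (h : SkewPair B s t Q) (a b : F[X]) (x y : V) :
    B (aeval s a x) (t (aeval s b y)) = - B (t (aeval s (b * a) x)) y := by
  rw [← h.tmove, h.skew, neg_neg]

lemma SkewPair.nonDegOn_cyc (h : SkewPair B s t Q) {r : F[X]} {m : ℕ} (hr : Irreducible r)
    (hm : aeval s (r ^ (m + 1)) = 0) {v : V} (hv : B (aeval s (r ^ m) v) v ≠ 0) :
    NonDegOn B (cyc s v) := by
  rintro _ ⟨a, rfl⟩ hx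
  change aeval s a v = 0
  by_contra hne
  obtain ⟨e, he⟩ := exists_socle hr hm (a := a) fun h0 => hne (by rw [h0]; rfl)
  have h1 : B (aeval s a v) (aeval s e v) = 0 := hx _ (aeval_mem_cyc s v e)
  rw [h.move, he] at h1
  exact hv h1

lemma SkewPair.nonDegOn_tcyc (h : SkewPair B s t Q) {r : F[X]} {m : ℕ} (hr : Irreducible r)
    (hm : aeval s (r ^ (m + 1)) = 0) {v : V} (hv : B (aeval s (r ^ m) v) v ≠ 0)
    (hQ : ∀ a : F[X], aeval s (Q * a) = 0 → t (aeval s a v) = 0) :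
    NonDegOn B ((cyc s v).map t) := by
  rintro _ ⟨_, ⟨a, rfl⟩, rfl⟩ hx
  change t (aeval s a v) = 0
  by_contra hne
  obtain ⟨e, he⟩ := exists_socle hr hm (a := Q * a) fun h0 => hne (hQ a h0)
  have h1 : B (t (aeval s a v)) (t (aeval s e v)) = 0 := hx _ ⟨_, aeval_mem_cyc s v e, rfl⟩
  rw [h.skew_skew, show Q * e * a = e * (Q * a) by ring, he, neg_eq_zero] at h1
  exact hv h1

lemma SkewPair.nonDegOn_bicyc (h : SkewPair B s t Q) {r : F[X]} {m : ℕ} (hr : Irreducible r)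
    (hm : aeval s (r ^ (m + 1)) = 0) (hQ : aeval s (Q * r ^ m) = 0) {v w : V}
    (hvw : B (t (aeval s (r ^ m) v)) w ≠ 0) : NonDegOn B (bicyc s t v w) := by
  intro x hx hxy
  obtain ⟨a, b, rfl⟩ := mem_bicyc.1 hx
  by_cases hab : aeval s a = 0 ∧ aeval s b = 0
  · rw [hab.1, hab.2]; simp
  exfalso
  have t1 : ∀ e : F[X], B (aeval s (e * a) v) v + B (t (aeval s (e * b) w)) v = 0 := fun e => by
    have := hxy (aeval s e v) (mem_bicyc.2 ⟨e, 0, by simp⟩)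
    rwa [map_add, LinearMap.add_apply, h.move, h.tmove] at this
  have t2 : ∀ e : F[X], B (t (aeval s (e * a) v)) w + B (aeval s (Q * e * b) w) w = 0 :=
    fun e => by
    have := hxy (t (aeval s e w)) (mem_bicyc.2 ⟨0, e, by simp⟩)
    rw [map_add, LinearMap.add_apply, h.tmove', h.skew_skew] at this
    linear_combination -this
  obtain ⟨e, ⟨h1, c, h2⟩ | ⟨h1, h2⟩⟩ := exists_socle_pair hr hm hab
  · have := t2 e
    rw [h1, mul_assoc, map_mul, h2, ← map_mul, ← mul_assoc, map_mul, hQ] at this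
    simp only [zero_mul, LinearMap.zero_apply, map_zero, add_zero] at this
    exact hvw this
  · have := t1 e
    rw [h1, h2, h.skew, aeval_adj h.self, ← aeval_commute h.comm, h.form.symm w] at this
    simp only [LinearMap.zero_apply, map_zero, zero_add, neg_eq_zero] at this
    exact hvw this

lemma aeval_injective_or_nilpotent [FiniteDimensional F V] (hB : SymForm B)
    (hs : ∀ x y, B (s x) y = B x (s y))
    (hmin : ∀ U : Submodule F V, NonDegOn B U → (∀ x ∈ U, t x ∈ U) → (∀ x ∈ U, s x ∈ U) →
      U = ⊥ ∨ U = ⊤) (hts : t * s = s * t) (f : F[X]) :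
    Function.Injective (aeval s f) ∨ IsNilpotent (aeval s f) := by
  obtain ⟨n, hn⟩ := Filter.eventually_atTop.1
    (LinearMap.eventually_isCompl_ker_pow_range_pow (aeval s f))
  have hc := hn (n + 1) (by omega)
  rw [← map_pow] at hc
  have hnd : NonDegOn B (LinearMap.ker (aeval s (f ^ (n + 1)))) := by
    refine hB.nonDegOn_of_isCompl hc ?_
    rintro x hx _ ⟨y, rfl⟩
    rw [← aeval_adj hs, LinearMap.mem_ker.1 hx, map_zero, LinearMap.zero_apply]
  rcases hmin _ hnd (fun x hx => by
      rw [LinearMap.mem_ker] at hx ⊢; rw [← aeval_commute hts, hx, map_zero]) (fun x hx => by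
      rw [LinearMap.mem_ker] at hx ⊢; rw [← aeval_commute rfl, hx, map_zero]) with h | h
  · left
    rw [LinearMap.ker_eq_bot, map_pow] at h
    exact fun x y hxy => h (by rw [pow_succ, Module.End.mul_apply, Module.End.mul_apply, hxy])
  · right
    exact ⟨n + 1, by rw [← map_pow]; exact LinearMap.ker_eq_top.1 h⟩

end Core

section Rev

open Polynomial

variable {F V : Type} [Field F] [AddCommGroup V] [Module F V] {B : LinearMap.BilinForm F V}

lemma SymForm.exists_ne (hB : SymForm B) (h2 : (2 : F) ≠ 0) {σ : Module.End F V}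
    (hσ : ∀ x y, B (σ x) y = B x (σ y)) (h0 : σ ≠ 0) : ∃ v, B (σ v) v ≠ 0 := by
  by_contra! hc
  apply h0
  ext x
  refine hB.nondeg _ fun y => ?_
  have h1 := hc (x + y)
  simp only [map_add, LinearMap.add_apply, hc x, hc y] at h1
  rw [hσ y, hB.symm y] at h1
  have : (2 : F) * B (σ x) y = 0 := by linear_combination h1
  exact (mul_eq_zero.1 this).resolve_left h2

lemma aeval_eq_zero_of_injective {s : Module.End F V} {Q : F[X]}
    (hinj : Function.Injective (aeval s Q)) {a : F[X]} (ha : aeval s (Q * a) = 0) :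
    aeval s a = 0 := by
  ext x
  apply hinj
  rw [map_mul] at ha
  rw [← Module.End.mul_apply, ha, LinearMap.zero_apply, map_zero]

variable [FiniteDimensional F V]

lemma SkewPair.exists_split {s t : Module.End F V} {Q : F[X]} (hpair : SkewPair B s t Q)
    {r : F[X]} {m : ℕ} (hr : Irreducible r) (hm : aeval s (r ^ (m + 1)) = 0)
    (hm' : aeval s (r ^ m) ≠ 0)
    (hQ : (∀ a, aeval s (Q * a) = 0 → aeval s a = 0) ∨ ∃ l, Q = r * l ∧ ¬ r ∣ l) :
    ∃ U U' : Submodule F V, NonDegOn B U ∧ NonDegOn B U' ∧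
      (∀ x ∈ U, ∀ y ∈ U', B x y = 0) ∧ (∀ x ∈ U, s x ∈ U) ∧ (∀ x ∈ U', s x ∈ U') ∧
      (∀ x ∈ U, t x ∈ U') ∧ (∀ x ∈ U', t x ∈ U) ∧ U ≠ ⊥ := by
  obtain ⟨v, hv⟩ := hpair.form.exists_ne hpair.two (aeval_adj hpair.self (r ^ m)) hm'
  have hvne : v ≠ 0 := by rintro rfl; exact hv (by simp)
  have hZ0 := hpair.nonDegOn_cyc hr hm hv
  by_cases hcase : ∀ a : F[X], aeval s (Q * a) = 0 → t (aeval s a v) = 0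
  · refine ⟨cyc s v, (cyc s v).map t, hZ0, hpair.nonDegOn_tcyc hr hm hv hcase, ?_,
      fun x hx => cyc_stable hx, ?_, fun x hx => ⟨x, hx, rfl⟩, ?_, fun h => hvne ?_⟩
    · rintro _ ⟨a, rfl⟩ _ ⟨_, ⟨b, rfl⟩, rfl⟩
      rw [hpair.form.symm]
      exact hpair.ortho b a v
    · rintro _ ⟨x, hx, rfl⟩
      exact ⟨s x, cyc_stable hx, LinearMap.congr_fun hpair.comm x⟩
    · rintro _ ⟨x, hx, rfl⟩
      rw [hpair.sq]
      exact aeval_stable (fun x hx => cyc_stable hx) _ hx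
    · simpa [h] using self_mem_cyc s v
  push Not at hcase
  obtain ⟨a, ha, hav⟩ := hcase
  obtain hQ | ⟨l, hl, hrl⟩ := hQ
  · exact absurd (by rw [hQ a ha]; simp) hav
  obtain ⟨l', hl'⟩ := exists_aeval_inv hr hm hrl
  have hra : aeval s (r * a) = 0 := by
    rw [← mul_one (aeval s _), ← hl', ← map_mul,
      show r * a * (l * l') = r * l * a * l' by ring, ← hl, map_mul, ha, zero_mul]
  obtain ⟨c, hc⟩ := mem_socle hr hm hm' hra
  have htv : t (aeval s (r ^ m) v) ≠ 0 := by
    intro h0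
    rw [hc, mul_comm, map_mul, Module.End.mul_apply, aeval_commute hpair.comm, h0, map_zero] at hav
    exact hav rfl
  have hQm : aeval s (Q * r ^ m) = 0 := by
    rw [hl, show r * l * r ^ m = r ^ (m + 1) * l by ring, map_mul, hm, zero_mul]
  obtain ⟨w, hw, hvw⟩ : ∃ w ∈ B.orthogonal (cyc s v), B (t (aeval s (r ^ m) v)) w ≠ 0 := by
    by_contra! hcon
    refine htv (hpair.form.nondeg _ fun y => ?_)
    obtain ⟨u, hu, u', hu', rfl⟩ := exists_add_of_isCompl (hpair.form.isCompl hZ0) y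
    obtain ⟨f, rfl⟩ := mem_cyc.1 hu
    rw [map_add, hcon u' hu', hpair.ortho, add_zero]
  have hvw0 : ∀ a b : F[X], B (aeval s a v) (aeval s b w) = 0 := fun a b => by
    rw [hpair.move]
    exact LinearMap.BilinForm.mem_orthogonal_iff.1 hw _ (aeval_mem_cyc s v _)
  have hwv : B (t (aeval s (r ^ m) w)) v ≠ 0 := by
    rw [hpair.skew, aeval_adj hpair.self, ← aeval_commute hpair.comm, hpair.form.symm, neg_ne_zero]
    exact hvw
  have hbs : ∀ v w, ∀ x ∈ bicyc s t v w, s x ∈ bicyc s t v w := by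
    intro v w x hx
    obtain ⟨a, b, rfl⟩ := mem_bicyc.1 hx
    refine mem_bicyc.2 ⟨X * a, X * b, ?_⟩
    have := LinearMap.congr_fun hpair.comm (aeval s b w)
    simp only [Module.End.mul_apply] at this
    simp [this]
  have hbt : ∀ v w, ∀ x ∈ bicyc s t v w, t x ∈ bicyc s t w v := by
    intro v w x hx
    obtain ⟨a, b, rfl⟩ := mem_bicyc.1 hx
    refine mem_bicyc.2 ⟨Q * b, a, ?_⟩
    rw [map_add, hpair.sq, map_mul, Module.End.mul_apply, add_comm]
  refine ⟨bicyc s t v w, bicyc s t w v, hpair.nonDegOn_bicyc hr hm hQm hvw,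
    hpair.nonDegOn_bicyc hr hm hQm hwv, ?_, hbs v w, hbs w v, hbt v w, hbt w v,
    fun h => hvne ?_⟩
  · intro x hx y hy
    obtain ⟨a, b, rfl⟩ := mem_bicyc.1 hx
    obtain ⟨c, d, rfl⟩ := mem_bicyc.1 hy
    simp only [map_add, LinearMap.add_apply]
    have h1 : B (aeval s a v) (t (aeval s d v)) = 0 := by rw [hpair.form.symm, hpair.ortho]
    have h2 : B (t (aeval s b w)) (t (aeval s d v)) = 0 := by
      rw [hpair.form.symm, hpair.skew_skew]
      have := hvw0 (Q * b * d) 1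
      rw [map_one, Module.End.one_apply] at this
      rw [this, neg_zero]
    rw [hvw0, hpair.ortho, h1, h2]
    simp
  · have : v ∈ bicyc s t v w := mem_bicyc.2 ⟨1, 0, by simp⟩
    simpa [h] using this

lemma exists_local_prime [Nontrivial V] (h2 : (2 : F) ≠ 0) {s : Module.End F V}
    (hdich : ∀ f : F[X], Function.Injective (aeval s f) ∨ IsNilpotent (aeval s f)) :
    ∃ r : F[X], Irreducible r ∧ IsNilpotent (aeval s r) ∧
      ((∀ a : F[X], aeval s ((X ^ 2 - C 4) * a) = 0 → aeval s a = 0) ∨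
        ∃ l : F[X], X ^ 2 - C 4 = r * l ∧ ¬ r ∣ l) := by
  have h4 : (2 : F) + 2 ≠ 0 := by rw [← two_mul]; exact mul_ne_zero h2 h2
  have hfac : (X ^ 2 - C 4 : F[X]) = (X - C 2) * (X - C (-2)) := by
    have : (C 4 : F[X]) = C 2 * C 2 := by rw [← C_mul]; norm_num
    rw [this, C_neg]; ring
  generalize (X ^ 2 - C 4 : F[X]) = Q at hfac ⊢
  by_cases hinj : Function.Injective (aeval s Q)
  · obtain ⟨r, hr, hr'⟩ := exists_irreducible_not_injective s
    exact ⟨r, hr, (hdich r).resolve_left hr', Or.inl fun a ha =>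
      aeval_eq_zero_of_injective hinj ha⟩
  by_cases hi : Function.Injective (aeval s (X - C 2 : F[X]))
  · refine ⟨X - C (-2), irreducible_X_sub_C _, (hdich _).resolve_left fun h => hinj ?_,
      Or.inr ⟨X - C 2, by rw [hfac, mul_comm], ?_⟩⟩
    · rw [hfac, map_mul, Module.End.coe_mul]; exact hi.comp h
    · rw [dvd_iff_isRoot, IsRoot, eval_sub, eval_X, eval_C]
      intro h; apply h4; linear_combination -h
  · refine ⟨X - C 2, irreducible_X_sub_C _, (hdich _).resolve_left hi,
      Or.inr ⟨X - C (-2), hfac, ?_⟩⟩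
    rw [dvd_iff_isRoot, IsRoot, eval_sub, eval_X, eval_C]
    intro h; apply h4; linear_combination h

lemma reversible_of_minimal (h2 : (2 : F) ≠ 0) (hB : SymForm B) {g g' : Module.End F V}
    (hgg' : g * g' = 1) (hg'g : g' * g = 1) (hadj : ∀ x y, B (g x) y = B x (g' y))
    (hmin : ∀ U : Submodule F V, NonDegOn B U → (∀ x ∈ U, g x ∈ U) → (∀ x ∈ U, g' x ∈ U) →
      U = ⊥ ∨ U = ⊤) : Reversible B (fun _ : Unit => g) (fun _ => g') := by
  rcases subsingleton_or_nontrivial V with hV | hV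
  · exact ⟨1, by simp, by simp, fun _ => by ext x; exact Subsingleton.elim _ _⟩
  have hadj' : ∀ x y, B (g' x) y = B x (g y) := fun x y => by rw [hB.symm, ← hadj, hB.symm]
  set s := g + g' with hs
  set t := g - g' with ht
  have hpair : SkewPair B s t (X ^ 2 - C 4) :=
    { form := hB
      two := h2
      self := fun x y => by simp [hs, hadj, hadj']; ring
      skew := fun x y => by simp [ht, hadj, hadj']
      comm := by rw [hs, ht]; simp only [add_mul, sub_mul, mul_add, mul_sub, hgg', hg'g]; abel
      sq := fun x => by
        have : t * t = s ^ 2 - 4 := by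
          rw [pow_two, hs, ht]
          simp only [add_mul, sub_mul, mul_add, mul_sub, hgg', hg'g]
          rw [show (4 : Module.End F V) = 1 + 1 + 1 + 1 by norm_num]
          abel
        rw [← Module.End.mul_apply, this, map_sub, map_pow, aeval_X, aeval_C, map_ofNat] }
  have hgst : ∀ x, (2 : F) • g x = s x + t x := fun x => by
    simp [hs, ht, two_smul]
  have hg'st : ∀ x, (2 : F) • g' x = s x - t x := fun x => by
    simp [hs, ht, two_smul]
  have hmin' : ∀ U : Submodule F V, NonDegOn B U → (∀ x ∈ U, t x ∈ U) → (∀ x ∈ U, s x ∈ U) →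
      U = ⊥ ∨ U = ⊤ := fun U hU h1 h3 => hmin U hU
    (fun x hx => (U.smul_mem_iff h2).1 (by rw [hgst]; exact U.add_mem (h3 x hx) (h1 x hx)))
    (fun x hx => (U.smul_mem_iff h2).1 (by rw [hg'st]; exact U.sub_mem (h3 x hx) (h1 x hx)))
  have hdich := aeval_injective_or_nilpotent hB hpair.self hmin' hpair.comm
  obtain ⟨r, hr, hrn, hQ⟩ := exists_local_prime h2 hdich
  obtain ⟨m, hm, hm'⟩ := exists_socle_exponent hrn
  obtain ⟨U, U', hU, hU', ho, h1, h1', h3, h3', hne⟩ := hpair.exists_split hr hm hm' hQ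
  have hst : ∀ (f : Module.End F V), (∀ x ∈ U, f x ∈ U ⊔ U') → (∀ x ∈ U', f x ∈ U ⊔ U') →
      ∀ x ∈ U ⊔ U', f x ∈ U ⊔ U' := by
    intro f hf hf' x hx
    obtain ⟨u, hu, u', hu', rfl⟩ := Submodule.mem_sup.1 hx
    rw [map_add]
    exact Submodule.add_mem _ (hf u hu) (hf' u' hu')
  have hl : U ≤ U ⊔ U' := le_sup_left
  have hr : U' ≤ U ⊔ U' := le_sup_right
  have htop := (hmin' _ (nonDegOn_sup hB hU hU' ho)
    (hst t (fun x hx => hr (h3 x hx)) (fun x hx => hl (h3' x hx)))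
    (hst s (fun x hx => hl (h1 x hx)) (fun x hx => hr (h1' x hx)))).resolve_left
    fun h => hne (eq_bot_iff.2 (h ▸ hl))
  exact reversible_of_reflection h2 hB htop ho (fun _ => h1) (fun _ => h1') (fun _ => h3)
    (fun _ => h3')

end Rev

section RevOne

variable {F : Type} [Field F]

/-- Every isometry is inverted by an isometric involution. -/
theorem reversible_isometry (h2 : (2 : F) ≠ 0) (n : ℕ) : ∀ (V : Type) [AddCommGroup V]
    [Module F V] [FiniteDimensional F V] (B : LinearMap.BilinForm F V) (g g' : Module.End F V),
    Module.finrank F V = n → SymForm B → g * g' = 1 → g' * g = 1 →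
    (∀ x y, B (g x) y = B x (g' y)) → Reversible B (fun _ : Unit => g) (fun _ => g') := by
  induction n using Nat.strong_induction_on with
  | _ n ih =>
  intro V _ _ _ B g g' hn hB h1 h1' hadj
  by_cases hmin : ∀ U : Submodule F V, NonDegOn B U → (∀ x ∈ U, g x ∈ U) →
      (∀ x ∈ U, g' x ∈ U) → U = ⊥ ∨ U = ⊤
  · exact reversible_of_minimal h2 hB h1 h1' hadj hmin
  push Not at hmin
  obtain ⟨U, hU, hg, hg', hbot, htop⟩ := hmin
  have hc := hB.isCompl hU
  have key : ∀ (W : Submodule F V), NonDegOn B W → W ≠ ⊤ →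
      ∀ (hg : StableFam (fun _ : Unit => g) W) (hg' : StableFam (fun _ : Unit => g') W),
      Reversible (B.restrict W) (fun _ : Unit => g.restrict (hg ()))
        (fun _ => g'.restrict (hg' ())) := by
    intro W hW hWt hg hg'
    refine ih (Module.finrank F W) (hn ▸ Submodule.finrank_lt hWt) W _ _ _ rfl (hB.restrict hW)
      ?_ ?_ (fun x y => hadj x y)
    · ext x; exact LinearMap.congr_fun h1 x
    · ext x; exact LinearMap.congr_fun h1' x
  refine reversible_of_split hB (fun _ => hadj) hU (fun _ => hg) (fun _ => hg')
    (key U hU htop (fun _ => hg) (fun _ => hg')) fun hgo hgo' => key _ (hB.nonDegOn_orthogonal hU) ?_ hgo hgo'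
  intro h
  apply hbot
  have := hc.inf_eq_bot
  rwa [h, inf_top_eq] at this

end RevOne

section OrthGroup

variable {F V : Type} [Field F] [AddCommGroup V] [Module F V]

/-- The orthogonal group of a form. -/
def orth (B : LinearMap.BilinForm F V) : Subgroup (Module.End F V)ˣ where
  carrier := {g | ∀ x y, B ((g : Module.End F V) x) ((g : Module.End F V) y) = B x y}
  one_mem' := by simp
  mul_mem' := by
    intro a b ha hb x y
    simp only [Units.val_mul, Module.End.mul_apply]
    rw [ha, hb]
  inv_mem' := by
    intro a ha x y
    have h : ∀ z, (a : Module.End F V) (((a⁻¹ : (Module.End F V)ˣ) : Module.End F V) z) = z :=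
      fun z => by rw [← Module.End.mul_apply, Units.mul_inv]; rfl
    rw [← ha, h, h]

variable {B : LinearMap.BilinForm F V}

lemma mem_orth {g : (Module.End F V)ˣ} : g ∈ orth B ↔
    ∀ x y, B ((g : Module.End F V) x) ((g : Module.End F V) y) = B x y := Iff.rfl

lemma unit_apply_inv (a : (Module.End F V)ˣ) (z : V) :
    (a : Module.End F V) (((a⁻¹ : (Module.End F V)ˣ) : Module.End F V) z) = z := by
  rw [← Module.End.mul_apply, Units.mul_inv]; rfl

lemma unit_inv_apply (a : (Module.End F V)ˣ) (z : V) :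
    ((a⁻¹ : (Module.End F V)ˣ) : Module.End F V) ((a : Module.End F V) z) = z := by
  rw [← Module.End.mul_apply, Units.inv_mul]; rfl

lemma orth_adj {g : (Module.End F V)ˣ} (hg : g ∈ orth B) (x y : V) :
    B ((g : Module.End F V) x) y = B x (((g⁻¹ : (Module.End F V)ˣ) : Module.End F V) y) := by
  rw [← mem_orth.1 hg x, unit_apply_inv]

lemma exists_reversing [FiniteDimensional F V] (h2 : (2 : F) ≠ 0) (hB : SymForm B)
    {g : (Module.End F V)ˣ} (hg : g ∈ orth B) :
    ∃ h ∈ orth B, h * h = 1 ∧ h * g * h⁻¹ = g⁻¹ := by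
  obtain ⟨a, ha, hai, hag⟩ := reversible_isometry h2 _ V B _ _ rfl hB g.mul_inv g.inv_mul
    (orth_adj hg)
  refine ⟨⟨a, a, ha, ha⟩, hai, Units.ext ha, ?_⟩
  rw [mul_inv_eq_iff_eq_mul]
  exact Units.ext (hag ())

lemma reverse_zpow {M : Type} [Group M] {h g : M} (hg : h * g * h⁻¹ = g⁻¹) {x : M}
    (hx : x ∈ Subgroup.zpowers g) : h * x * h⁻¹ = x⁻¹ := by
  obtain ⟨n, rfl⟩ := hx
  simp only
  rw [← conj_zpow, hg, _root_.inv_zpow]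

end OrthGroup

section CyclicAux

variable {M : Type} [Group M]

lemma mem_zpowers_of_unique_involution {c e y : M} {k : ℕ} (hce : c ^ 2 ^ k = e)
    (he1 : e ≠ 1) (he2 : e * e = 1) (hyc : Commute y c)
    (hu : ∀ i j : ℤ, (y ^ i * c ^ j) * (y ^ i * c ^ j) = 1 → y ^ i * c ^ j = 1 ∨ y ^ i * c ^ j = e)
    (hy : y ^ 2 ^ (k + 1) = 1) : y ∈ Subgroup.zpowers c := by
  have heZ : e ∈ Subgroup.zpowers c := hce ▸ Subgroup.npow_mem_zpowers c _
  have key : ∀ a ≤ k + 1, ∀ b : ℕ, (y ^ b) ^ 2 ^ a = 1 → y ^ b ∈ Subgroup.zpowers c := by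
    intro a
    induction a with
    | zero => intro _ b hb; rw [pow_zero, pow_one] at hb; rw [hb]; exact Subgroup.one_mem _
    | succ a ih =>
      intro ha b hb
      have h1 : y ^ (b * 2) ∈ Subgroup.zpowers c := by
        refine ih (by omega) _ ?_
        rw [_root_.pow_mul, ← _root_.pow_mul, ← pow_succ', hb]
      obtain ⟨j, hj⟩ := h1
      simp only at hj
      have hje : Even j := by
        by_contra hodd
        rw [Int.not_even_iff_odd] at hodd
        apply he1
        have h3 : c ^ (j * 2 ^ k) = 1 := by
          obtain ⟨l, hl⟩ := Nat.exists_eq_add_of_le (show a ≤ k by omega)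
          have : (c ^ j) ^ 2 ^ k = 1 := by
            rw [hj, hl, pow_add, _root_.pow_mul _ b, _root_.pow_mul _ (2 ^ a),
              ← _root_.pow_mul (y ^ b) 2, ← pow_succ', hb, one_pow]
          rw [_root_.zpow_mul]
          exact_mod_cast this
        rw [mul_comm, _root_.zpow_mul] at h3
        have h4 : c ^ ((2 : ℤ) ^ k) = e := by rw [← hce]; exact_mod_cast rfl
        rw [h4] at h3
        obtain ⟨i, rfl⟩ := hodd
        rwa [_root_.zpow_add, _root_.zpow_mul, zpow_two, he2, _root_.one_zpow, one_mul,
          zpow_one] at h3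
      obtain ⟨i, rfl⟩ := hje
      have hcomm : Commute (y ^ (b : ℤ)) (c ^ (-i)) := (hyc.zpow_left _).zpow_right _
      have := hu b (-i) (by
        rw [hcomm.symm.mul_mul_mul_comm, ← _root_.zpow_add, ← _root_.zpow_add,
          show (b : ℤ) + b = ((b * 2 : ℕ) : ℤ) by push_cast; ring, zpow_natCast, ← hj,
          ← _root_.zpow_add]
        simp)
      have h5 : y ^ (b : ℤ) * c ^ (-i) ∈ Subgroup.zpowers c := by
        rcases this with h | h <;> rw [h]
        · exact Subgroup.one_mem _
        · exact heZ
      rw [zpow_natCast] at h5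
      have hci : c ^ (-i) ∈ Subgroup.zpowers c := ⟨-i, rfl⟩
      exact (Subgroup.mul_mem_cancel_right _ hci).1 h5
  simpa using key (k + 1) le_rfl 1 (by rwa [pow_one])

lemma mem_zpowers_mul_of_coprime {a b : M} (hab : Commute a b)
    (h : Nat.Coprime (orderOf a) (orderOf b)) : a ∈ Subgroup.zpowers (a * b) := by
  have hg := Nat.gcd_eq_gcd_ab (orderOf a) (orderOf b)
  rw [h.gcd_eq_one, Nat.cast_one] at hg
  refine ⟨(orderOf b : ℤ) * Nat.gcdB (orderOf a) (orderOf b), ?_⟩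
  have ha : ∀ (z : M) (n : ℤ), z ^ ((orderOf z : ℤ) * n) = 1 := fun z n => by
    rw [_root_.zpow_mul, zpow_natCast, pow_orderOf_eq_one, _root_.one_zpow]
  simp only
  rw [hab.mul_zpow, ha b, mul_one]
  have h1 := ha a (Nat.gcdA (orderOf a) (orderOf b))
  calc a ^ ((orderOf b : ℤ) * Nat.gcdB (orderOf a) (orderOf b))
      = a ^ ((orderOf a : ℤ) * Nat.gcdA (orderOf a) (orderOf b)) *
        a ^ ((orderOf b : ℤ) * Nat.gcdB (orderOf a) (orderOf b)) := by rw [h1, one_mul]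
    _ = a := by rw [← _root_.zpow_add, ← hg, zpow_one]

lemma cyclic_or_involution [Finite M] {c e x : M} {k : ℕ} (K : Subgroup M) (hcK : c ∈ K)
    (hxK : x ∈ K) (hce : c ^ 2 ^ k = e) (he1 : e ≠ 1) (he2 : e * e = 1) (hcx : c * x = x * c) :
    (∃ z ∈ K, z * z = 1 ∧ z ≠ 1 ∧ z ≠ e) ∨
      ∃ g ∈ K, c ∈ Subgroup.zpowers g ∧ x ∈ Subgroup.zpowers g := by
  by_cases hu : ∀ z ∈ K, z * z = 1 → z = 1 ∨ z = e
  swap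
  · push Not at hu
    exact Or.inl hu
  right
  have hxc : Commute x c := hcx.symm
  obtain ⟨l, m, hm, ho⟩ := Nat.exists_eq_two_pow_mul_odd (orderOf_pos x).ne'
  have hlm : Nat.Coprime m (2 ^ l) := (Nat.Coprime.pow_left l hm.coprime_two_left).symm
  have hx : x ∈ Subgroup.zpowers (x ^ m) ⊔ Subgroup.zpowers (x ^ 2 ^ l) := by
    have hg := Nat.gcd_eq_gcd_ab m (2 ^ l)
    rw [hlm.gcd_eq_one, Nat.cast_one] at hg
    have he : (x ^ m) ^ (Nat.gcdA m (2 ^ l)) * (x ^ 2 ^ l) ^ (Nat.gcdB m (2 ^ l)) = x := by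
      rw [← zpow_natCast, ← zpow_natCast, ← _root_.zpow_mul, ← _root_.zpow_mul,
        ← _root_.zpow_add, ← hg, zpow_one]
    have hmem := Subgroup.mul_mem_sup
      (Subgroup.zpow_mem _ (Subgroup.mem_zpowers (x ^ m)) (Nat.gcdA m (2 ^ l)))
      (Subgroup.zpow_mem _ (Subgroup.mem_zpowers (x ^ 2 ^ l)) (Nat.gcdB m (2 ^ l)))
    rwa [he] at hmem
  have hy2 : (x ^ m) ^ 2 ^ l = 1 := by
    rw [← _root_.pow_mul, mul_comm, ← ho, pow_orderOf_eq_one]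
  have hmemK : ∀ i j : ℤ, (x ^ m) ^ i * c ^ j ∈ K := fun i j =>
    K.mul_mem (K.zpow_mem (K.pow_mem hxK _) _) (K.zpow_mem hcK _)
  have hyc : Commute (x ^ m) c := hxc.pow_left m
  by_cases hlk : l ≤ k + 1
  · have hy := mem_zpowers_of_unique_involution hce he1 he2 hyc
      (fun i j => hu _ (hmemK i j)) (by
        obtain ⟨j, hj⟩ := Nat.exists_eq_add_of_le hlk
        rw [hj, pow_add, _root_.pow_mul, hy2, one_pow])
    have hcop : Nat.Coprime (orderOf c) (orderOf (x ^ 2 ^ l)) := by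
      have h1 : orderOf c ∣ 2 ^ (k + 1) := orderOf_dvd_of_pow_eq_one (by
        rw [pow_succ, _root_.pow_mul, hce, pow_two, he2])
      have h3 : orderOf (x ^ 2 ^ l) ∣ m := orderOf_dvd_of_pow_eq_one (by
        rw [← _root_.pow_mul, ← ho, pow_orderOf_eq_one])
      exact Nat.Coprime.of_dvd h1 h3 (Nat.Coprime.pow_left _ hm.coprime_two_left)
    have hcc : Commute c (x ^ 2 ^ l) := (hxc.pow_left _).symm
    have hc' := mem_zpowers_mul_of_coprime hcc hcop
    have hx' := mem_zpowers_mul_of_coprime hcc.symm hcop.symm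
    rw [← hcc.eq] at hx'
    refine ⟨c * x ^ 2 ^ l, K.mul_mem hcK (K.pow_mem hxK _), hc', ?_⟩
    refine (sup_le ?_ ?_ : Subgroup.zpowers (x ^ m) ⊔ Subgroup.zpowers (x ^ 2 ^ l) ≤ _) hx
    · exact (Subgroup.zpowers_le).2 ((Subgroup.zpowers_le).2 hc' hy)
    · exact (Subgroup.zpowers_le).2 hx'
  · obtain ⟨j, hj⟩ : ∃ j, l = j + 1 := ⟨l - 1, by omega⟩
    have hord : (x ^ m) ^ 2 ^ j ≠ 1 := by
      intro h
      rw [← _root_.pow_mul] at h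
      have h1 := Nat.le_of_dvd (Nat.mul_pos hm.pos (by positivity)) (orderOf_dvd_of_pow_eq_one h)
      rw [ho, hj, pow_succ] at h1
      have := hm.pos
      have h3 : 0 < 2 ^ j := by positivity
      nlinarith [Nat.mul_pos hm.pos h3]
    have hsq : (x ^ m) ^ 2 ^ j * (x ^ m) ^ 2 ^ j = 1 := by
      rw [← pow_two, ← _root_.pow_mul, ← pow_succ, ← hj, hy2]
    have hye : (x ^ m) ^ 2 ^ j = e := (hu _ (K.pow_mem (K.pow_mem hxK _) _) hsq).resolve_left hord
    have := mem_zpowers_of_unique_involution (y := c) (c := x ^ m) hye he1 he2 hyc.symm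
      (fun i j => by
        rw [((hyc.symm.zpow_left i).zpow_right j).eq]
        exact hu _ (hmemK j i)) (by
        obtain ⟨i, hi⟩ := Nat.exists_eq_add_of_le (show k + 1 ≤ j + 1 by omega)
        rw [hi, pow_add, _root_.pow_mul, pow_succ, _root_.pow_mul, hce, pow_two, he2, one_pow])
    exact ⟨x, hxK, (Subgroup.zpowers_le).2 (Subgroup.npow_mem_zpowers x m) this,
      Subgroup.mem_zpowers x⟩

end CyclicAux

section UnitGlue

variable {F V : Type} [Field F] [AddCommGroup V] [Module F V]

instance finite_units_end [Finite V] : Finite (Module.End F V)ˣ :=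
  have : Finite (Module.End F V) := Finite.of_injective (fun f : Module.End F V => (f : V → V))
    DFunLike.coe_injective
  inferInstance

/-- Glue automorphisms of complementary subspaces. -/
def glueU {U U' : Submodule F V} (hc : IsCompl U U') :
    (Module.End F U)ˣ × (Module.End F U')ˣ →* (Module.End F V)ˣ where
  toFun p := ⟨glue hc p.1 p.2, glue hc (p.1⁻¹ : (Module.End F U)ˣ) (p.2⁻¹ : (Module.End F U')ˣ),
    end_ext hc (fun u hu => by
      lift u to U using hu
      rw [Module.End.mul_apply, glue_left, glue_left, unit_apply_inv]; rfl)
    (fun u hu => by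
      lift u to U' using hu
      rw [Module.End.mul_apply, glue_right, glue_right, unit_apply_inv]; rfl),
    end_ext hc (fun u hu => by
      lift u to U using hu
      rw [Module.End.mul_apply, glue_left, glue_left, unit_inv_apply]; rfl)
    (fun u hu => by
      lift u to U' using hu
      rw [Module.End.mul_apply, glue_right, glue_right, unit_inv_apply]; rfl)⟩
  map_one' := Units.ext <| end_ext hc
    (fun u hu => by lift u to U using hu; exact glue_left hc _ _ u)
    (fun u hu => by lift u to U' using hu; exact glue_right hc _ _ u)
  map_mul' p r := Units.ext <| end_ext hc
    (fun u hu => by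
      lift u to U using hu
      simp only [Units.val_mul, Module.End.mul_apply, glue_left, Prod.fst_mul])
    (fun u hu => by
      lift u to U' using hu
      simp only [Units.val_mul, Module.End.mul_apply, glue_right, Prod.snd_mul])

variable {U U' : Submodule F V} (hc : IsCompl U U')

@[simp] lemma glueU_left (p : (Module.End F U)ˣ × (Module.End F U')ˣ) (u : U) :
    (glueU hc p : Module.End F V) u = (p.1 : Module.End F U) u := glue_left hc _ _ u

@[simp] lemma glueU_right (p : (Module.End F U)ˣ × (Module.End F U')ˣ) (u : U') :
    (glueU hc p : Module.End F V) u = (p.2 : Module.End F U') u := glue_right hc _ _ u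

lemma glueU_injective : Function.Injective (glueU hc) := by
  intro p r h
  refine Prod.ext (Units.ext ?_) (Units.ext ?_)
  · ext u
    rw [← glueU_left hc p, ← glueU_left hc r, h]
  · ext u
    rw [← glueU_right hc p, ← glueU_right hc r, h]

lemma glueU_neg (p : (Module.End F U)ˣ × (Module.End F U')ˣ) :
    glueU hc (-p.1, -p.2) = -glueU hc p :=
  Units.ext <| end_ext hc
    (fun u hu => by lift u to U using hu; rw [glueU_left]; simp)
    (fun u hu => by lift u to U' using hu; rw [glueU_right]; simp)

variable {B : LinearMap.BilinForm F V}

lemma glueU_mem_orth (hB : SymForm B) (ho : ∀ x ∈ U, ∀ y ∈ U', B x y = 0)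
    (p : (Module.End F U)ˣ × (Module.End F U')ˣ) :
    glueU hc p ∈ orth B ↔ p.1 ∈ orth (B.restrict U) ∧ p.2 ∈ orth (B.restrict U') := by
  constructor
  · intro h
    refine ⟨fun x y => ?_, fun x y => ?_⟩
    · have := mem_orth.1 h x y
      rwa [glueU_left, glueU_left] at this
    · have := mem_orth.1 h x y
      rwa [glueU_right, glueU_right] at this
  · rintro ⟨h1, h2⟩
    refine isometry_of_isCompl hc hB ho (fun x hx => ?_) (fun x hx => ?_)
      (fun x hx y hy => ?_) (fun x hx y hy => ?_)
    · lift x to U using hx; rw [glueU_left]; exact ((p.1 : Module.End F U) x).2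
    · lift x to U' using hx; rw [glueU_right]; exact ((p.2 : Module.End F U') x).2
    · lift x to U using hx
      lift y to U using hy
      rw [glueU_left, glueU_left]; exact h1 x y
    · lift x to U' using hx
      lift y to U' using hy
      rw [glueU_right, glueU_right]; exact h2 x y

/-- The fixed space. -/
def fixSp (z : (Module.End F V)ˣ) : Submodule F V := LinearMap.eqLocus (z : Module.End F V) 1

lemma mem_fixSp {z : (Module.End F V)ˣ} {x : V} :
    x ∈ fixSp z ↔ (z : Module.End F V) x = x := Iff.rfl

lemma mem_fixSp_neg {z : (Module.End F V)ˣ} {x : V} :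
    x ∈ fixSp (-z) ↔ (z : Module.End F V) x = -x := by
  rw [mem_fixSp, Units.val_neg, LinearMap.neg_apply, neg_eq_iff_eq_neg]

lemma isCompl_fixSp (h2 : (2 : F) ≠ 0) {z : (Module.End F V)ˣ} (hz : z * z = 1) :
    IsCompl (fixSp z) (fixSp (-z)) := by
  have hzz : ∀ x, (z : Module.End F V) ((z : Module.End F V) x) = x := fun x => by
    rw [← Module.End.mul_apply, ← Units.val_mul, hz]; rfl
  refine IsCompl.of_eq ?_ ?_
  · rw [eq_bot_iff]
    rintro x ⟨h1, h3⟩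
    have h3' := mem_fixSp_neg.1 h3
    rw [mem_fixSp.1 h1] at h3'
    have : (2 : F) • x = 0 := by rw [two_smul]; nth_rewrite 1 [h3']; simp
    exact (smul_eq_zero.1 this).resolve_left h2
  · rw [eq_top_iff]
    intro x _
    have : x = (2 : F)⁻¹ • (x + (z : Module.End F V) x) +
        (2 : F)⁻¹ • (x - (z : Module.End F V) x) := by
      rw [← smul_add, add_add_sub_cancel, ← two_smul F, smul_smul, inv_mul_cancel₀ h2, one_smul]
    rw [this]
    refine Submodule.add_mem_sup (Submodule.smul_mem _ _ ?_) (Submodule.smul_mem _ _ ?_)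
    · rw [mem_fixSp, map_add, hzz, add_comm]
    · rw [mem_fixSp_neg, map_sub, hzz, neg_sub]

lemma fixSp_orth (h2 : (2 : F) ≠ 0) {z : (Module.End F V)ˣ} (hz : z ∈ orth B) :
    ∀ x ∈ fixSp z, ∀ y ∈ fixSp (-z), B x y = 0 := by
  intro x hx y hy
  have := mem_orth.1 hz x y
  rw [mem_fixSp.1 hx, mem_fixSp_neg.1 hy, map_neg] at this
  have h : (2 : F) * B x y = 0 := by linear_combination -this
  exact (mul_eq_zero.1 h).resolve_left h2

lemma fixSp_ne_top {z : (Module.End F V)ˣ} (hz : z ≠ 1) : fixSp z ≠ ⊤ := fun h => hz <| Units.ext <|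
  LinearMap.ext fun x => mem_fixSp.1 (h ▸ Submodule.mem_top : x ∈ fixSp z)

lemma fixSp_stable {z g : (Module.End F V)ˣ} (hg : g * z = z * g) {x : V} (hx : x ∈ fixSp z) :
    (g : Module.End F V) x ∈ fixSp z := by
  rw [mem_fixSp] at hx ⊢
  rw [← Module.End.mul_apply, ← Units.val_mul, ← hg, Units.val_mul, Module.End.mul_apply, hx]

/-- Restriction of an automorphism. -/
def resU {U : Submodule F V} (g : (Module.End F V)ˣ)
    (h1 : ∀ x ∈ U, (g : Module.End F V) x ∈ U)
    (h2 : ∀ x ∈ U, ((g⁻¹ : (Module.End F V)ˣ) : Module.End F V) x ∈ U) : (Module.End F U)ˣ :=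
  ⟨(g : Module.End F V).restrict h1, ((g⁻¹ : (Module.End F V)ˣ) : Module.End F V).restrict h2,
    by ext x; exact unit_apply_inv g x, by ext x; exact unit_inv_apply g x⟩

lemma exists_glueU {z g : (Module.End F V)ˣ} (hc : IsCompl (fixSp z) (fixSp (-z)))
    (hg : g * z = z * g) : ∃ p, glueU hc p = g := by
  have hg' : g⁻¹ * z = z * g⁻¹ := (Commute.inv_left (show Commute g z from hg))
  have hn : ∀ {a : (Module.End F V)ˣ}, a * z = z * a → a * -z = -z * a := fun h => by
    rw [mul_neg, neg_mul, h]
  refine ⟨(resU g (fun _ => fixSp_stable hg) (fun _ => fixSp_stable hg'),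
    resU g (fun _ => fixSp_stable (hn hg)) (fun _ => fixSp_stable (hn hg'))), ?_⟩
  refine Units.ext <| end_ext hc (fun u hu => ?_) (fun u hu => ?_)
  · lift u to fixSp z using hu
    rw [glueU_left]; rfl
  · lift u to fixSp (-z) using hu
    rw [glueU_right]; rfl

lemma glueU_eq_self {z : (Module.End F V)ˣ} (hc : IsCompl (fixSp z) (fixSp (-z))) :
    glueU hc (1, -1) = z := by
  refine Units.ext <| end_ext hc (fun u hu => ?_) (fun u hu => ?_)
  · rw [mem_fixSp.1 hu]
    lift u to fixSp z using hu
    rw [glueU_left]; rfl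
  · rw [mem_fixSp_neg.1 hu]
    lift u to fixSp (-z) using hu
    rw [glueU_right]; simp

lemma glueU_commute {z : (Module.End F V)ˣ} (hc : IsCompl (fixSp z) (fixSp (-z)))
    (p : (Module.End F (fixSp z))ˣ × (Module.End F (fixSp (-z)))ˣ) :
    glueU hc p * z = z * glueU hc p := by
  have h : glueU hc (p * (1, -1)) = glueU hc ((1, -1) * p) := by
    congr 1
    exact Prod.ext (by simp) (Commute.neg_one_right p.2)
  rwa [map_mul, map_mul, glueU_eq_self] at h

lemma glueU_pow_eq_neg_one {p : (Module.End F U)ˣ × (Module.End F U')ˣ} {m : ℕ}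
    (h : (glueU hc p) ^ m = -1) : p.1 ^ m = -1 ∧ p.2 ^ m = -1 := by
  rw [← map_pow] at h
  have h1 : glueU hc (p ^ m) = glueU hc (-1, -1) := by
    rw [h, ← map_one (glueU hc), ← glueU_neg]; rfl
  have h2 := glueU_injective hc h1
  exact ⟨congrArg Prod.fst h2, congrArg Prod.snd h2⟩

lemma glueU_inverts {h p : (Module.End F U)ˣ × (Module.End F U')ˣ}
    (h1 : h.1 * p.1 * h.1⁻¹ = p.1⁻¹) (h2 : h.2 * p.2 * h.2⁻¹ = p.2⁻¹) :
    glueU hc h * glueU hc p * (glueU hc h)⁻¹ = (glueU hc p)⁻¹ := by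
  rw [← map_inv, ← map_mul, ← map_mul, ← map_inv]
  congr 1
  exact Prod.ext h1 h2

lemma units_trivial (h2 : (2 : F) ≠ 0) (hne : (-1 : (Module.End F V)ˣ) = 1)
    (a b : (Module.End F V)ˣ) : a = b := by
  have hV : ∀ v : V, v = 0 := fun v => by
    have h := congrArg (fun g : (Module.End F V)ˣ => (g : Module.End F V) v) hne
    simp only [Units.val_neg, Units.val_one, LinearMap.neg_apply, Module.End.one_apply] at h
    have : (2 : F) • v = 0 := by rw [two_smul]; nth_rewrite 1 [← h]; simp
    exact (smul_eq_zero.1 this).resolve_left h2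
  exact Units.ext <| LinearMap.ext fun v => by rw [hV v, map_zero, map_zero]

/-- Two commuting isometries, one of them a root of `-1` of two-power order, are simultaneously
inverted by an isometric involution. -/
lemma exists_reversing_pair (h2 : (2 : F) ≠ 0) (n : ℕ) : ∀ (V : Type) [AddCommGroup V]
    [Module F V] [Finite V] (B : LinearMap.BilinForm F V) (c x : (Module.End F V)ˣ) (k : ℕ),
    Module.finrank F V = n → SymForm B → c ∈ orth B → x ∈ orth B → c ^ 2 ^ k = -1 →
    c * x = x * c → ∃ h ∈ orth B, h * h = 1 ∧ h * c * h⁻¹ = c⁻¹ ∧ h * x * h⁻¹ = x⁻¹ := by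
  induction n using Nat.strong_induction_on with
  | _ n ih =>
  intro V _ _ _ B c x k hn hB hcB hxB hck hcx
  by_cases hne : (-1 : (Module.End F V)ˣ) = 1
  · have htr := units_trivial h2 hne
    exact ⟨1, Subgroup.one_mem _, htr _ _, htr _ _, htr _ _⟩
  have h1 : (-1 : (Module.End F V)ˣ) * -1 = 1 := by simp
  rcases cyclic_or_involution (orth B ⊓ Subgroup.centralizer {c} ⊓ Subgroup.centralizer {x})
    (c := c) (x := x) (k := k)
    ⟨⟨hcB, Subgroup.mem_centralizer_singleton_iff.2 rfl⟩,
      Subgroup.mem_centralizer_singleton_iff.2 hcx⟩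
    ⟨⟨hxB, Subgroup.mem_centralizer_singleton_iff.2 hcx.symm⟩,
      Subgroup.mem_centralizer_singleton_iff.2 rfl⟩ hck hne h1 hcx with
    ⟨z, ⟨⟨hzB, hzc⟩, hzx⟩, hzz, hz1, hz2⟩ | ⟨g, ⟨⟨hg, -⟩, -⟩, hgc, hgx⟩
  · replace hzc := Subgroup.mem_centralizer_singleton_iff.1 hzc
    replace hzx := Subgroup.mem_centralizer_singleton_iff.1 hzx
    have hc := isCompl_fixSp h2 hzz
    have ho := fixSp_orth h2 hzB
    obtain ⟨p, rfl⟩ := exists_glueU hc hzc.symm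
    obtain ⟨r, rfl⟩ := exists_glueU hc hzx.symm
    have hp := (glueU_mem_orth hc hB ho p).1 hcB
    have hr := (glueU_mem_orth hc hB ho r).1 hxB
    have hk := glueU_pow_eq_neg_one hc hck
    rw [← map_mul, ← map_mul] at hcx
    have hpr := glueU_injective hc hcx
    have hB1 := hB.restrict (hB.nonDegOn_of_isCompl hc ho)
    have hB2 := hB.restrict (hB.nonDegOn_of_isCompl hc.symm fun x hx y hy => by
      rw [hB.symm]; exact ho y hy x hx)
    obtain ⟨a, haB, haa, hac, hax⟩ := ih _ (hn ▸ Submodule.finrank_lt (fixSp_ne_top hz1)) _ _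
      p.1 r.1 k rfl hB1 hp.1 hr.1 hk.1 (congrArg Prod.fst hpr)
    obtain ⟨b, hbB, hbb, hbc, hbx⟩ := ih _ (hn ▸ Submodule.finrank_lt
      (fixSp_ne_top (z := -z) fun h => hz2 (neg_eq_iff_eq_neg.1 h))) _ _
      p.2 r.2 k rfl hB2 hp.2 hr.2 hk.2 (congrArg Prod.snd hpr)
    refine ⟨glueU hc (a, b), (glueU_mem_orth hc hB ho _).2 ⟨haB, hbB⟩, ?_,
      glueU_inverts hc hac hbc, glueU_inverts hc hax hbx⟩
    rw [← map_mul, Prod.mk_mul_mk, haa, hbb]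
    exact map_one _
  · obtain ⟨h, hh, hhh, hhg⟩ := exists_reversing h2 hB hg
    exact ⟨h, hh, hhh, reverse_zpow hhg hgc, reverse_zpow hhg hgx⟩

end UnitGlue

section Tw

variable {R : Type} [Ring R]

/-- Elements commuting with `y` up to sign. -/
def twCen (A : Subgroup Rˣ) (y : Rˣ) : Subgroup Rˣ where
  carrier := {a | a ∈ A ∧ (a * y * a⁻¹ = y ∨ a * y * a⁻¹ = -y)}
  one_mem' := ⟨A.one_mem, by simp⟩
  mul_mem' := by
    rintro a b ⟨ha, ha'⟩ ⟨hb, hb'⟩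
    refine ⟨A.mul_mem ha hb, ?_⟩
    have : a * b * y * (a * b)⁻¹ = a * (b * y * b⁻¹) * a⁻¹ := by group
    rw [this]
    rcases hb' with h | h <;> rw [h] <;> rcases ha' with h' | h' <;> simp [h']
  inv_mem' := by
    rintro a ⟨ha, ha'⟩
    refine ⟨A.inv_mem ha, ?_⟩
    have : ∀ w : Rˣ, a⁻¹ * (a * w * a⁻¹) * a⁻¹⁻¹ = w := fun w => by group
    have h1 := this y
    rcases ha' with h | h <;> rw [h] at h1
    · exact Or.inl h1
    · rw [mul_neg, neg_mul] at h1
      exact Or.inr (neg_eq_iff_eq_neg.1 h1)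

lemma mem_inf_centralizer {M : Type} [Group M] {A : Subgroup M} {y a : M} :
    a ∈ A ⊓ Subgroup.centralizer {y} ↔ a ∈ A ∧ a * y * a⁻¹ = y := by
  rw [Subgroup.mem_inf, Subgroup.mem_centralizer_singleton_iff, mul_inv_eq_iff_eq_mul]

lemma nrm_twCen {A : Subgroup Rˣ} {y h : Rˣ} (hA : Nrm h A) (h2 : h * h = 1)
    (hy : h * y * h⁻¹ = y⁻¹ ∨ h * y * h⁻¹ = -y⁻¹) : Nrm h (twCen A y) := by
  rintro a ⟨ha, ha'⟩
  refine ⟨hA a ha, ?_⟩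
  have hi : h⁻¹ = h := inv_eq_of_mul_eq_one_right h2
  have e : h * a * h⁻¹ * y * (h * a * h⁻¹)⁻¹ = h * (a * (h * y * h⁻¹) * a⁻¹) * h⁻¹ := by
    rw [hi, _root_.mul_inv_rev, _root_.mul_inv_rev, hi]; group
  have hyi : h * y⁻¹ * h⁻¹ = y ∨ h * y⁻¹ * h⁻¹ = -y := by
    have h4 : (h * y * h⁻¹)⁻¹ = h * y⁻¹ * h⁻¹ := by group
    rcases hy with h3 | h3 <;> rw [h3] at h4
    · exact Or.inl (by rw [← h4, inv_inv])
    · exact Or.inr (by rw [← h4, inv_neg, inv_inv])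
  have hai : a * y⁻¹ * a⁻¹ = y⁻¹ ∨ a * y⁻¹ * a⁻¹ = -y⁻¹ := by
    have h4 : (a * y * a⁻¹)⁻¹ = a * y⁻¹ * a⁻¹ := by group
    rcases ha' with h3 | h3 <;> rw [h3] at h4
    · exact Or.inl h4.symm
    · exact Or.inr (by rw [← h4, inv_neg])
  rw [e]
  rcases hy with h3 | h3 <;> rw [h3] <;> rcases hai with h4 | h4 <;>
    rcases hyi with h5 | h5 <;> simp [h4, h5]

/-- Passage from the centralizer to the centralizer up to sign. -/
lemma NoSkew.twCen [Fintype Rˣ] {A : Subgroup Rˣ} {y h h' : Rˣ} (hA : Nrm h A) (hA' : Nrm h' A)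
    (h2 : h * h = 1) (h2' : h' * h' = 1) (ha : h' * h⁻¹ ∈ A)
    (hy : h * y * h⁻¹ = y⁻¹ ∨ h * y * h⁻¹ = -y⁻¹) (hy' : h' * y * h'⁻¹ = y⁻¹)
    (H : NoSkew (A ⊓ Subgroup.centralizer {y}) h')
    (HS : HasSym (A ⊓ Subgroup.centralizer {y}) h') : NoSkew (twCen A y) h := by
  have hle : A ⊓ Subgroup.centralizer {y} ≤ OrthSim.twCen A y := fun a ha => by
    rw [mem_inf_centralizer] at ha
    exact ⟨ha.1, Or.inl ha.2⟩
  have hn : Nrm h' (A ⊓ Subgroup.centralizer {y}) := by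
    intro a ha
    rw [mem_inf_centralizer] at ha ⊢
    refine ⟨hA' a ha.1, ?_⟩
    have h6 : h'⁻¹ = h' := inv_eq_of_mul_eq_one_right h2'
    have h3 : h'⁻¹ * y * h' = y⁻¹ := by rw [h6]; rw [h6] at hy'; exact hy'
    have h4 : a * y⁻¹ * a⁻¹ = y⁻¹ := by
      have : (a * y * a⁻¹)⁻¹ = a * y⁻¹ * a⁻¹ := by group
      rw [← this, ha.2]
    calc h' * a * h'⁻¹ * y * (h' * a * h'⁻¹)⁻¹ = h' * (a * (h'⁻¹ * y * h') * a⁻¹) * h'⁻¹ := by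
          group
      _ = (h' * y * h'⁻¹)⁻¹ := by rw [h3, h4]; group
      _ = y := by rw [hy', inv_inv]
  have key : NoSkew (OrthSim.twCen A y) h' := by
    by_cases hex : ∃ w ∈ OrthSim.twCen A y, w * y * w⁻¹ ≠ y
    · obtain ⟨w, hw, hwy⟩ := hex
      have hwy' := hw.2.resolve_left hwy
      refine NoSkew.index_two H HS hle hn hw fun a ha => ?_
      rcases ha.2 with h | h
      · exact Or.inl (mem_inf_centralizer.2 ⟨ha.1, h⟩)
      · refine Or.inr (mem_inf_centralizer.2 ⟨A.mul_mem (A.inv_mem hw.1) ha.1, ?_⟩)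
        have e : w⁻¹ * a * y * (w⁻¹ * a)⁻¹ = w⁻¹ * (a * y * a⁻¹) * w := by group
        rw [e, h, ← hwy']
        group
    · push Not at hex
      exact NoSkew.index_two H HS hle hn (Subgroup.one_mem _) fun a ha =>
        Or.inl (mem_inf_centralizer.2 ⟨ha.1, hex a ha⟩)
  refine NoSkew.change (nrm_twCen hA h2 hy) h2 h2' ⟨ha, ?_⟩ key
  have hi : h⁻¹ = h := inv_eq_of_mul_eq_one_right h2
  have e : h' * h⁻¹ * y * (h' * h⁻¹)⁻¹ = h' * (h * y * h⁻¹) * h'⁻¹ := by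
    rw [_root_.mul_inv_rev, inv_inv, hi]; group
  have e2 : h' * y⁻¹ * h'⁻¹ = y := by
    have : (h' * y * h'⁻¹)⁻¹ = h' * y⁻¹ * h'⁻¹ := by group
    rw [← this, hy', inv_inv]
  rw [e]
  rcases hy with h3 | h3 <;> rw [h3]
  · exact Or.inl e2
  · right; simp [e2]

lemma noSkew_closure_pair {M : Type} [Group M] {x y : M} (hxy : x * y = y * x) (h : M) :
    NoSkew (Subgroup.closure {x, y}) h := by
  refine NoSkew.of_comm fun a ha b hb => ?_
  have hle : Subgroup.closure {x, y} ≤ Subgroup.centralizer ({x, y} : Set M) := by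
    rw [Subgroup.closure_le]
    rintro _ (rfl | rfl) _ (rfl | rfl) <;> first | rfl | exact hxy | exact hxy.symm
  exact ((Subgroup.closure_le_centralizer_centralizer {x, y} ha) b (hle hb)).symm

lemma nrm_closure_pair {M : Type} [Group M] {x y h : M} (hx : h * x * h⁻¹ = x⁻¹)
    (hy : h * y * h⁻¹ = y⁻¹) : Nrm h (Subgroup.closure {x, y}) := by
  have hle : Subgroup.closure {x, y} ≤
      (Subgroup.closure {x, y}).comap (MulAut.conj h).toMonoidHom := by
    rw [Subgroup.closure_le]
    intro k hk
    change h * k * h⁻¹ ∈ Subgroup.closure {x, y}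
    rcases hk with hk | hk
    · rw [hk, hx]
      exact Subgroup.inv_mem _ (Subgroup.subset_closure (by simp))
    · rw [Set.mem_singleton_iff.1 hk, hy]
      exact Subgroup.inv_mem _ (Subgroup.subset_closure (by simp))
  exact fun k hk => hle hk

end Tw

section Main

variable {F V : Type} [Field F] [AddCommGroup V] [Module F V]

/-- The centralizer of `c` in the orthogonal group. -/
def cen (B : LinearMap.BilinForm F V) (c : (Module.End F V)ˣ) : Subgroup (Module.End F V)ˣ :=
  orth B ⊓ Subgroup.centralizer {c}

variable {B : LinearMap.BilinForm F V} {c : (Module.End F V)ˣ}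

lemma mem_cen {g : (Module.End F V)ˣ} : g ∈ cen B c ↔ g ∈ orth B ∧ g * c * g⁻¹ = c :=
  mem_inf_centralizer

lemma mul_inv_mem_cen {d h : (Module.End F V)ˣ} (hd : d ∈ orth B) (hh : h ∈ orth B)
    (h1 : d * c * d⁻¹ = c⁻¹) (h2 : h * c * h⁻¹ = c⁻¹) : d * h⁻¹ ∈ cen B c := by
  refine mem_cen.2 ⟨Subgroup.mul_mem _ hd (Subgroup.inv_mem _ hh), ?_⟩
  have e : c = h⁻¹ * c⁻¹ * h := by rw [← h2]; group
  have e2 : h⁻¹ * c * h = c⁻¹ := by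
    have := congrArg (·⁻¹) e
    rw [this]; group
  have e3 : d * h⁻¹ * c * (d * h⁻¹)⁻¹ = d * (h⁻¹ * c * h) * d⁻¹ := by group
  have e4 : d * c⁻¹ * d⁻¹ = (d * c * d⁻¹)⁻¹ := by group
  rw [e3, e2, e4, h1, inv_inv]

lemma nrm_cen {h : (Module.End F V)ˣ} (hh : h ∈ orth B) (h1 : h * c * h⁻¹ = c⁻¹) :
    Nrm h (cen B c) := by
  intro k hk
  rw [mem_cen] at hk
  have h3 : (h * k) * c * (h * k)⁻¹ = c⁻¹ := by
    have : (h * k) * c * (h * k)⁻¹ = h * (k * c * k⁻¹) * h⁻¹ := by group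
    rw [this, hk.2, h1]
  exact mul_inv_mem_cen (Subgroup.mul_mem _ hh hk.1) hh h3 h1

lemma cen_hasSym [Finite V] (h2 : (2 : F) ≠ 0) (hB : SymForm B) {h : (Module.End F V)ˣ} {k : ℕ}
    (hcB : c ∈ orth B) (hck : c ^ 2 ^ k = -1) (hh : h ∈ orth B) (hhh : h * h = 1)
    (hhc : h * c * h⁻¹ = c⁻¹) (H : NoSkew (cen B c) h) : HasSym (cen B c) h := by
  let := Fintype.ofFinite (Module.End F V)ˣ
  refine H.hasSym (nrm_cen hh hhc) hhh fun g hg => ?_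
  obtain ⟨d, hd, -, hdc, hdg⟩ := exists_reversing_pair h2 _ V B c g k rfl hB hcB hg.1 hck
    (Subgroup.mem_centralizer_singleton_iff.1 hg.2).symm
  exact ⟨d, mul_inv_mem_cen hd hh hdc hhc, hdg⟩

lemma noSkew_of_subsingleton {M : Type} [Group M] (hM : ∀ a b : M, a = b) (K : Subgroup M) (h : M) :
    NoSkew K h := NoSkew.of_comm fun _ _ _ _ => hM _ _

section Split

variable {z : (Module.End F V)ˣ} (hc : IsCompl (fixSp z) (fixSp (-z)))

lemma cen_inf_centralizer (hB : SymForm B)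
    (ho : ∀ x ∈ fixSp z, ∀ y ∈ fixSp (-z), B x y = 0)
    {p : (Module.End F (fixSp z))ˣ × (Module.End F (fixSp (-z)))ˣ}
    {a : (Module.End F V)ˣ} :
    a ∈ cen B (glueU hc p) ⊓ Subgroup.centralizer {z} ↔
      ∃ r, glueU hc r = a ∧ r.1 ∈ cen (B.restrict (fixSp z)) p.1 ∧
        r.2 ∈ cen (B.restrict (fixSp (-z))) p.2 := by
  constructor
  · rintro ⟨⟨h1, h2⟩, h3⟩
    obtain ⟨r, rfl⟩ := exists_glueU hc (Subgroup.mem_centralizer_singleton_iff.1 h3)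
    have hr := (glueU_mem_orth hc hB ho r).1 h1
    have h2' := Subgroup.mem_centralizer_singleton_iff.1 h2
    rw [← map_mul, ← map_mul] at h2'
    have h4 := glueU_injective hc h2'
    exact ⟨r, rfl, ⟨hr.1, Subgroup.mem_centralizer_singleton_iff.2 (congrArg Prod.fst h4)⟩,
      ⟨hr.2, Subgroup.mem_centralizer_singleton_iff.2 (congrArg Prod.snd h4)⟩⟩
  · rintro ⟨r, rfl, h1, h2⟩
    refine ⟨⟨(glueU_mem_orth hc hB ho r).2 ⟨h1.1, h2.1⟩,
      Subgroup.mem_centralizer_singleton_iff.2 ?_⟩,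
      Subgroup.mem_centralizer_singleton_iff.2 (glueU_commute hc r)⟩
    rw [← map_mul, ← map_mul]
    congr 1
    exact Prod.ext (Subgroup.mem_centralizer_singleton_iff.1 h1.2)
      (Subgroup.mem_centralizer_singleton_iff.1 h2.2)

/-- The product of two centralizers, acting on complementary spaces. -/
lemma noSkew_split [Finite V] (hB : SymForm B)
    (ho : ∀ x ∈ fixSp z, ∀ y ∈ fixSp (-z), B x y = 0)
    {p h : (Module.End F (fixSp z))ˣ × (Module.End F (fixSp (-z)))ˣ}
    (hh1 : h.1 ∈ orth (B.restrict (fixSp z))) (hh2 : h.2 ∈ orth (B.restrict (fixSp (-z))))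
    (hp1 : h.1 * p.1 * h.1⁻¹ = p.1⁻¹) (hp2 : h.2 * p.2 * h.2⁻¹ = p.2⁻¹)
    (H1 : HasSym (cen (B.restrict (fixSp z)) p.1) h.1)
    (H2 : NoSkew (cen (B.restrict (fixSp (-z))) p.2) h.2) :
    NoSkew (cen B (glueU hc p) ⊓ Subgroup.centralizer {z}) (glueU hc h) := by
  let := Fintype.ofFinite (Module.End F V)ˣ
  let j1 := (glueU hc).comp (MonoidHom.inl _ _)
  let j2 := (glueU hc).comp (MonoidHom.inr _ _)
  have e1 : ∀ k, j1 (h.1 * k * h.1⁻¹) = glueU hc h * j1 k * (glueU hc h)⁻¹ := fun k => by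
    change glueU hc _ = glueU hc h * glueU hc _ * (glueU hc h)⁻¹
    rw [← map_inv, ← map_mul, ← map_mul]
    congr 1
    exact Prod.ext rfl (by simp)
  have e2 : ∀ k, j2 (h.2 * k * h.2⁻¹) = glueU hc h * j2 k * (glueU hc h)⁻¹ := fun k => by
    change glueU hc _ = glueU hc h * glueU hc _ * (glueU hc h)⁻¹
    rw [← map_inv, ← map_mul, ← map_mul]
    congr 1
    exact Prod.ext (by simp) rfl
  refine NoSkew.prod (K₁ := (cen (B.restrict (fixSp z)) p.1).map j1)
    (K₂ := (cen (B.restrict (fixSp (-z))) p.2).map j2) ?_ ?_ ?_ ?_ ?_ ?_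
    (H1.map j1 fun k _ => e1 k) (H2.map j2 fun k _ => e2 k)
  · rintro _ ⟨a, ha, rfl⟩
    exact (cen_inf_centralizer hc hB ho).2 ⟨(a, 1), rfl, ha, Subgroup.one_mem _⟩
  · rintro _ ⟨a, ha, rfl⟩
    exact (cen_inf_centralizer hc hB ho).2 ⟨(1, a), rfl, Subgroup.one_mem _, ha⟩
  · intro k hk
    obtain ⟨r, rfl, h1, h2⟩ := (cen_inf_centralizer hc hB ho).1 hk
    refine ⟨j1 r.1, Subgroup.mem_map_of_mem _ h1, j2 r.2, Subgroup.mem_map_of_mem _ h2, ?_⟩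
    change _ = glueU hc _ * glueU hc _
    rw [← map_mul]
    congr 1
  · rintro _ ⟨a, ha, rfl⟩ _ ⟨b, hb, rfl⟩
    change glueU hc _ * glueU hc _ = glueU hc _ * glueU hc _
    rw [← map_mul, ← map_mul]
    congr 1
  · rintro _ ⟨a, ha, rfl⟩
    rw [← e1]
    exact Subgroup.mem_map_of_mem _ (nrm_cen hh1 hp1 a ha)
  · rintro _ ⟨a, ha, rfl⟩
    rw [← e2]
    exact Subgroup.mem_map_of_mem _ (nrm_cen hh2 hp2 a ha)

end Split

end Main

section Main

/-- The centralizer of a root of `-1` of two-power order in an orthogonal group carries no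
irreducible skew twisted forms. -/
theorem noSkew_cen {F : Type} [Field F] (h2 : (2 : F) ≠ 0) (n : ℕ) : ∀ (V : Type) [AddCommGroup V]
    [Module F V] [Finite V] (B : LinearMap.BilinForm F V), Module.finrank F V = n → SymForm B →
    ∀ (m k : ℕ) (c h : (Module.End F V)ˣ), Nat.card (Module.End F V)ˣ - k = m →
    c ∈ orth B → c ^ 2 ^ k = -1 → h ∈ orth B → h * h = 1 → h * c * h⁻¹ = c⁻¹ →
    NoSkew (cen B c) h := by
  induction n using Nat.strong_induction_on with
  | _ n ihn =>
  intro V _ _ _ B hn hB m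
  induction m using Nat.strong_induction_on with
  | _ m ihm =>
  intro k c h₀ hm hcB hck hh₀ hh₀2 hh₀c
  by_cases hne : (-1 : (Module.End F V)ˣ) = 1
  · exact noSkew_of_subsingleton (units_trivial h2 hne) _ _
  let := Fintype.ofFinite (Module.End F V)ˣ
  have hneg : (-1 : (Module.End F V)ˣ) * -1 = 1 := by simp
  have hc2 : c ^ 2 ^ (k + 1) = 1 := by rw [pow_succ, _root_.pow_mul, hck, pow_two, hneg]
  refine noSkew_of_local hh₀2 (nrm_cen hh₀ hh₀c) fun x hx _ => ?_
  have hxc := Subgroup.mem_centralizer_singleton_iff.1 hx.2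
  obtain ⟨h, hh, hhh, hhc, hhx⟩ := exists_reversing_pair h2 _ V B c x k rfl hB hcB hx.1 hck hxc.symm
  have hnA : Nrm h (cen B c) := nrm_cen hh hhc
  have hcA : c ∈ cen B c := ⟨hcB, Subgroup.mem_centralizer_singleton_iff.2 rfl⟩
  have hnC : Nrm h (cen B c ⊓ Subgroup.centralizer {x}) := by
    rintro a ⟨ha, hax⟩
    refine ⟨hnA a ha, Subgroup.mem_centralizer_singleton_iff.2 ?_⟩
    have h1 := Subgroup.mem_centralizer_singleton_iff.1 hax
    have h3 : x = h * x⁻¹ * h⁻¹ := by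
      have : (h * x * h⁻¹)⁻¹ = h * x⁻¹ * h⁻¹ := by group
      rw [← this, hhx, inv_inv]
    have h4 : a * x⁻¹ = x⁻¹ * a := (Commute.inv_right (show Commute a x from h1))
    calc h * a * h⁻¹ * x = h * a * h⁻¹ * (h * x⁻¹ * h⁻¹) := by rw [← h3]
      _ = h * (a * x⁻¹) * h⁻¹ := by group
      _ = (h * x⁻¹ * h⁻¹) * (h * a * h⁻¹) := by rw [h4]; group
      _ = x * (h * a * h⁻¹) := by rw [← h3]
  obtain ⟨D, hDC, hD2, hDo, hhD, hcD⟩ := exists_sylow_stable hhh hnC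
    ⟨hcA, Subgroup.mem_centralizer_singleton_iff.2 hxc.symm⟩ ⟨k + 1, hc2⟩
    fun a ha => Subgroup.mem_centralizer_singleton_iff.1 ha.1.2
  have hDA : D ≤ cen B c := fun d hd => (hDC hd).1
  have hDx : D ≤ Subgroup.centralizer {x} := fun d hd => (hDC hd).2
  have fin : ∀ y ∈ D, (∀ d ∈ D, d * y * d⁻¹ = y ∨ d * y * d⁻¹ = -y) →
      (h * y * h⁻¹ = y⁻¹ ∨ h * y * h⁻¹ = -y⁻¹) →
      (∃ h' ∈ orth B, h' * h' = 1 ∧ h' * c * h'⁻¹ = c⁻¹ ∧ h' * y * h'⁻¹ = y⁻¹ ∧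
        NoSkew (cen B c ⊓ Subgroup.centralizer {y}) h' ∧
        HasSym (cen B c ⊓ Subgroup.centralizer {y}) h') →
      ∃ (h : (Module.End F V)ˣ) (D K : Subgroup (Module.End F V)ˣ), h * h = 1 ∧
        h * h₀⁻¹ ∈ cen B c ∧ h * x * h⁻¹ = x⁻¹ ∧ IsPGroup 2 D ∧
        Odd (D.relIndex (cen B c ⊓ Subgroup.centralizer {x})) ∧
        Nrm h D ∧ K ≤ cen B c ∧ x ∈ K ∧ D ≤ K ⊓ Subgroup.centralizer {x} ∧ Nrm h K ∧
        NoSkew K h := by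
    rintro y hy hyD hyh ⟨h', hh', hh'2, hh'c, hh'y, H, HS⟩
    have hxy : x * y * x⁻¹ = y := by
      rw [mul_inv_eq_iff_eq_mul]
      exact (Subgroup.mem_centralizer_singleton_iff.1 (hDx hy)).symm
    exact ⟨h, D, twCen (cen B c) y, hhh, mul_inv_mem_cen hh hh₀ hhc hh₀c, hhx, hD2, hDo, hhD,
      fun a ha => ha.1, ⟨hx, Or.inl hxy⟩, fun d hd => ⟨⟨hDA hd, hyD d hd⟩, hDx hd⟩,
      nrm_twCen hnA hhh hyh, H.twCen hnA (nrm_cen hh' hh'c) hhh hh'2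
      (mul_inv_mem_cen hh' hh hh'c hhc) hyh hh'y HS⟩
  rcases sylow_refine hD2 hhh hhD hcD hck hne hneg
    (fun d hd => Subgroup.mem_centralizer_singleton_iff.1 (hDA hd).2) hhc with
    hle | ⟨z, hzD, hzz, hz1, hz2, hzd, hhz⟩ | ⟨b, hbD, hbb, hbd, hhb⟩
  · have hclA : Subgroup.closure {x, c} ≤ cen B c := by
      rw [Subgroup.closure_le]
      rintro a (ha | ha)
      · rwa [ha]
      · rwa [Set.mem_singleton_iff.1 ha]
    refine ⟨h, D, Subgroup.closure {x, c}, hhh, mul_inv_mem_cen hh hh₀ hhc hh₀c, hhx, hD2, hDo, hhD,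
      hclA, Subgroup.subset_closure (by simp), fun d hd => ⟨?_, hDx hd⟩, nrm_closure_pair hhx hhc,
      noSkew_closure_pair hxc h⟩
    exact (Subgroup.zpowers_le).2 (Subgroup.subset_closure (by simp)) (hle hd)
  · simp only [neg_mul, one_mul] at hzd hhz
    have hzi : z⁻¹ = z := inv_eq_of_mul_eq_one_right hzz
    refine fin z hzD hzd (by rwa [hzi]) ?_
    have hzB : z ∈ orth B := (hDA hzD).1
    have hzc := Subgroup.mem_centralizer_singleton_iff.1 (hDA hzD).2
    have hc := isCompl_fixSp h2 hzz
    have ho := fixSp_orth h2 hzB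
    obtain ⟨p, rfl⟩ := exists_glueU hc hzc.symm
    have hp := (glueU_mem_orth hc hB ho p).1 hcB
    have hk := glueU_pow_eq_neg_one hc hck
    have hB1 := hB.restrict (hB.nonDegOn_of_isCompl hc ho)
    have hB2 := hB.restrict (hB.nonDegOn_of_isCompl hc.symm fun x hx y hy => by
      rw [hB.symm]; exact ho y hy x hx)
    obtain ⟨a, haB, haa, hac, -⟩ := exists_reversing_pair h2 _ _ _ p.1 p.1 k rfl hB1 hp.1 hp.1
      hk.1 rfl
    obtain ⟨b, hbB, hbb, hbc, -⟩ := exists_reversing_pair h2 _ _ _ p.2 p.2 k rfl hB2 hp.2 hp.2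
      hk.2 rfl
    have H1 := ihn _ (hn ▸ Submodule.finrank_lt (fixSp_ne_top hz1)) _ _ rfl hB1 _ k p.1 a rfl
      hp.1 hk.1 haB haa hac
    have H2 := ihn _ (hn ▸ Submodule.finrank_lt
      (fixSp_ne_top (z := -z) fun h => hz2 (neg_eq_iff_eq_neg.1 h))) _ _ rfl hB2 _ k p.2 b rfl
      hp.2 hk.2 hbB hbb hbc
    have hs := noSkew_split hc hB ho (p := p) (h := (a, b)) haB hbB hac hbc
      (cen_hasSym h2 hB1 hp.1 hk.1 haB haa hac H1) H2
    have habB : glueU hc (a, b) ∈ orth B := (glueU_mem_orth hc hB ho _).2 ⟨haB, hbB⟩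
    have hab2 : glueU hc (a, b) * glueU hc (a, b) = 1 := by
      rw [← map_mul, Prod.mk_mul_mk, haa, hbb]
      exact map_one _
    have habz : glueU hc (a, b) * z * (glueU hc (a, b))⁻¹ = z := by
      rw [mul_inv_eq_iff_eq_mul]
      exact glueU_commute hc _
    refine ⟨glueU hc (a, b), habB, hab2, glueU_inverts hc hac hbc, by rw [habz, hzi], hs,
      hs.hasSym ?_ hab2 ?_⟩
    · intro g hg
      rw [cen_inf_centralizer hc hB ho] at hg ⊢
      obtain ⟨r, rfl, hr1, hr2⟩ := hg
      refine ⟨(a, b) * r * (a, b)⁻¹, by rw [map_mul, map_mul, map_inv], ?_, ?_⟩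
      · exact nrm_cen haB hac _ hr1
      · exact nrm_cen hbB hbc _ hr2
    · intro g hg
      obtain ⟨r, rfl, hr1, hr2⟩ := (cen_inf_centralizer hc hB ho).1 hg
      obtain ⟨d, hd, -, hdc, hdr⟩ := exists_reversing_pair h2 _ _ _ p.1 r.1 k rfl hB1 hp.1 hr1.1
        hk.1 (Subgroup.mem_centralizer_singleton_iff.1 hr1.2).symm
      obtain ⟨d', hd', -, hdc', hdr'⟩ := exists_reversing_pair h2 _ _ _ p.2 r.2 k rfl hB2 hp.2 hr2.1
        hk.2 (Subgroup.mem_centralizer_singleton_iff.1 hr2.2).symm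
      refine ⟨glueU hc (d, d'), ?_, glueU_inverts hc hdr hdr'⟩
      rw [cen_inf_centralizer hc hB ho]
      exact ⟨(d, d') * (a, b)⁻¹, by rw [map_mul, map_inv], mul_inv_mem_cen hd haB hdc hac,
        mul_inv_mem_cen hd' hbB hdc' hbc⟩
  · simp only [neg_mul, one_mul] at hbd hhb
    refine fin b hbD hbd hhb ?_
    have hbB : b ∈ orth B := (hDA hbD).1
    have hbk : b ^ 2 ^ (k + 1) = -1 := by rw [pow_succ', _root_.pow_mul, pow_two, hbb, hck]
    obtain ⟨h', hh', hh'2, hh'b, -⟩ := exists_reversing_pair h2 _ _ _ b b (k + 1) rfl hB hbB hbB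
      hbk rfl
    have hord : k < Nat.card (Module.End F V)ˣ := by
      have h1 : orderOf c = 2 ^ (k + 1) := orderOf_eq_prime_pow (by rwa [hck]) hc2
      have h3 : orderOf c ≤ Nat.card (Module.End F V)ˣ := orderOf_le_card
      have h4 : k + 1 < 2 ^ (k + 1) := Nat.lt_two_pow_self
      omega
    have H := ihm _ (by omega) (k + 1) b h' rfl hbB hbk hh' hh'2 hh'b
    have e : cen B c ⊓ Subgroup.centralizer {b} = cen B b := by
      refine le_antisymm (fun g hg => ⟨hg.1.1, hg.2⟩) fun g hg => ⟨⟨hg.1, ?_⟩, hg.2⟩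
      have h1 := Subgroup.mem_centralizer_singleton_iff.1 hg.2
      refine Subgroup.mem_centralizer_singleton_iff.2 ?_
      rw [← hbb]
      exact (Commute.mul_right (show Commute g b from h1) h1).eq
    refine ⟨h', hh', hh'2, ?_, hh'b, e ▸ H, e ▸ cen_hasSym h2 hB hbB hbk hh' hh'2 hh'b H⟩
    rw [← hbb, ← conj_mul, hh'b, _root_.mul_inv_rev]

end Main

section FS

variable {G : Type} [Group G]

lemma repOn_top {W : Type} [AddCommGroup W] [Module ℂ W] (ρ : Representation ℂ G W) :
    RepOn (⊤ : Subgroup G) ρ := ⟨map_one ρ, fun a _ b _ => map_mul ρ a b⟩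

lemma repOn_sum_conj [Fintype G] {W : Type} [AddCommGroup W] [Module ℂ W] {ρ : G → W →ₗ[ℂ] W}
    (hρ : RepOn ⊤ ρ) {f : G → ℂ} (hf : ∀ a g, f (a * g * a⁻¹) = f g) (a : G) (v : W) :
    (∑ g, f g • ρ g) (ρ a v) = ρ a ((∑ g, f g • ρ g) v) := by
  simp only [LinearMap.sum_apply, LinearMap.smul_apply, map_sum, map_smul]
  rw [← Equiv.sum_comp (MulAut.conj a).toEquiv]
  refine Finset.sum_congr rfl fun g _ => ?_
  change f (a * g * a⁻¹) • _ = _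
  rw [hf, ← hρ.mul_apply (Subgroup.mem_top _) (Subgroup.mem_top _),
    ← hρ.mul_apply (Subgroup.mem_top _) (Subgroup.mem_top _)]
  change f g • ρ (a * g * a⁻¹ * a) v = _
  rw [inv_mul_cancel_right]

/-- The left regular representation. -/
def regRep (G : Type) [Group G] (g : G) : (G → ℂ) →ₗ[ℂ] (G → ℂ) :=
  LinearMap.funLeft ℂ ℂ fun x => g⁻¹ * x

lemma regRep_apply (g : G) (u : G → ℂ) (x : G) : regRep G g u x = u (g⁻¹ * x) := rfl

lemma repOn_regRep : RepOn (⊤ : Subgroup G) (regRep G) where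
  one := by ext1 u; ext x; simp [regRep_apply]
  mul a _ b _ := by ext1 u; ext x; simp [regRep_apply, mul_assoc]

variable [Fintype G]

/-- A class function orthogonal to all irreducible characters vanishes. -/
lemma class_fun_eq_zero {f : G → ℂ} (hf : ∀ a g, f (a * g * a⁻¹) = f g)
    (h : ∀ (W : Type) [AddCommGroup W] [Module ℂ W] [FiniteDimensional ℂ W] (ρ : G → W →ₗ[ℂ] W),
      IrrOn ⊤ ρ → ∑ g, f g * chr ρ g = 0) : f = 0 := by
  have hr := repOn_regRep (G := G)
  set T : (G → ℂ) →ₗ[ℂ] (G → ℂ) := ∑ g, f g • regRep G g with hT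
  have hTc := fun a v => repOn_sum_conj hr hf a v
  have hk : Stable ⊤ (regRep G) (LinearMap.ker T) := fun k _ x hx => by
    rw [LinearMap.mem_ker] at hx ⊢
    rw [hT, hTc, ← hT, hx, map_zero]
  obtain ⟨Y, hY, hc⟩ := hr.exists_compl hk
  have hY0 : Y = ⊥ := by
    by_contra hY0
    obtain ⟨X, hXY, hX0, hX, hXi⟩ := hr.exists_irr hY hY0
    apply hX0
    obtain ⟨c, hcs⟩ := hXi.scalar (∑ g, f g • subRep (regRep G) X g)
      fun k _ v => repOn_sum_conj hXi.toRepOn hf k v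
    have htr := h X _ hXi
    have h1 : LinearMap.trace ℂ X (∑ g, f g • subRep (regRep G) X g) = 0 := by
      rw [map_sum, ← htr]
      exact Finset.sum_congr rfl fun g _ => by rw [map_smul]; rfl
    have h2 : (∑ g, f g • subRep (regRep G) X g) = c • LinearMap.id := by
      ext1 v; rw [hcs]; rfl
    have := hXi.nontriv
    have hc0 : c = 0 := by
      rw [h2, map_smul, LinearMap.trace_id, smul_eq_mul] at h1
      refine (mul_eq_zero.1 h1).resolve_right (Nat.cast_ne_zero.2 Module.finrank_pos.ne')
    rw [← le_bot_iff, ← hc.inf_eq_bot]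
    refine le_inf (fun x hx => ?_) hXY
    have h3 := congrArg Subtype.val (hcs ⟨x, hx⟩)
    rw [hc0, zero_smul, LinearMap.sum_apply] at h3
    rw [LinearMap.mem_ker, hT, LinearMap.sum_apply]
    rw [Submodule.coe_zero, Submodule.coe_sum] at h3
    rw [← h3]
    refine Finset.sum_congr rfl fun g _ => ?_
    rw [LinearMap.smul_apply, LinearMap.smul_apply, Submodule.coe_smul,
      hX.coe_subRep (Subgroup.mem_top g)]
  have hT0 : T = 0 := by
    rw [← LinearMap.ker_eq_top, ← hc.sup_eq_top, hY0, sup_bot_eq]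
  ext x
  have h1 := congrFun (LinearMap.congr_fun hT0 (Pi.single 1 1)) x
  rw [hT, LinearMap.sum_apply, Finset.sum_apply, Finset.sum_eq_single x] at h1
  · simpa [regRep_apply] using h1
  · intro g _ hg
    rw [LinearMap.smul_apply, Pi.smul_apply, regRep_apply, Pi.single_eq_of_ne, smul_zero]
    rw [Ne, inv_mul_eq_one]; exact hg
  · intro hx; exact absurd (Finset.mem_univ x) hx

/-- Without skew invariant forms, `∑ χ(g)² = ∑ χ(g²)`. -/
lemma NoSkew.sum_chr_sq {W : Type} [AddCommGroup W] [Module ℂ W] [FiniteDimensional ℂ W]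
    {ρ : G → W →ₗ[ℂ] W} (hρ : IrrOn (⊤ : Subgroup G) ρ) (H : NoSkew (⊤ : Subgroup G) 1) :
    ∑ g, chr ρ g * chr ρ g = ∑ g, chr ρ (g * g) := by
  have key : ∀ (φ ψ : W →ₗ[ℂ] ℂ) (v w : W),
      ∑ g, φ (ρ g v) * ψ (ρ g w) = ∑ g, φ (ρ g w) * ψ (ρ g v) := by
    intro φ ψ v w
    let b : W →ₗ[ℂ] W →ₗ[ℂ] ℂ := ∑ g, ((LinearMap.mul ℂ ℂ).compl₁₂ (φ ∘ₗ ρ g) (ψ ∘ₗ ρ g) -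
      ((LinearMap.mul ℂ ℂ).compl₁₂ (ψ ∘ₗ ρ g) (φ ∘ₗ ρ g)))
    have hb : ∀ v w, b v w = ∑ g, (φ (ρ g v) * ψ (ρ g w) - ψ (ρ g v) * φ (ρ g w)) := by
      intro v w; simp [b, LinearMap.sum_apply]
    have h0 : b = 0 := by
      refine H W ρ hρ b ?_ ?_
      · intro k hk v w
        rw [one_mul, inv_one, mul_one, hb, hb]
        refine Fintype.sum_equiv (Equiv.mulRight k) _ _ fun g => ?_
        rw [Equiv.coe_mulRight, hρ.toRepOn.mul_apply (Subgroup.mem_top g) hk,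
          hρ.toRepOn.mul_apply (Subgroup.mem_top g) hk]
      · intro v w
        rw [hb, hb, ← Finset.sum_neg_distrib]
        exact Finset.sum_congr rfl fun g _ => by ring
    have h1 := hb v w
    rw [h0, LinearMap.zero_apply, LinearMap.zero_apply, Finset.sum_sub_distrib, eq_comm,
      sub_eq_zero] at h1
    rw [h1]
    exact Finset.sum_congr rfl fun g _ => mul_comm _ _
  let e := Module.finBasis ℂ W
  have ht : ∀ f : W →ₗ[ℂ] W, LinearMap.trace ℂ W f = ∑ i, e.coord i (f (e i)) := by
    intro f
    rw [LinearMap.trace_eq_matrix_trace ℂ e, Matrix.trace]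
    simp [LinearMap.toMatrix_apply]
  have h1 : ∀ g, chr ρ g * chr ρ g
      = ∑ i, ∑ j, e.coord i (ρ g (e i)) * e.coord j (ρ g (e j)) := by
    intro g
    rw [chr, ht, Finset.sum_mul_sum]
  have h2 : ∀ g, chr ρ (g * g)
      = ∑ i, ∑ j, e.coord i (ρ g (e j)) * e.coord j (ρ g (e i)) := by
    intro g
    rw [chr, ht]
    refine Finset.sum_congr rfl fun i _ => ?_
    rw [hρ.toRepOn.mul_apply (Subgroup.mem_top g) (Subgroup.mem_top g)]
    conv_lhs => rw [← e.sum_repr (ρ g (e i))]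
    rw [map_sum, map_sum]
    refine Finset.sum_congr rfl fun j _ => ?_
    rw [map_smul, map_smul, smul_eq_mul, mul_comm]; rfl
  simp only [h1, h2]
  rw [Finset.sum_comm]
  conv_rhs => rw [Finset.sum_comm]
  refine Finset.sum_congr rfl fun i _ => ?_
  rw [Finset.sum_comm]
  conv_rhs => rw [Finset.sum_comm]
  exact Finset.sum_congr rfl fun j _ => key _ _ _ _

open scoped ComplexOrder in
/-- `χ(g⁻¹)` is the complex conjugate of `χ(g)`. -/
lemma chr_inv_eq_conj {W : Type} [AddCommGroup W] [Module ℂ W] [FiniteDimensional ℂ W]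
    {ρ : G → W →ₗ[ℂ] W} (hρ : RepOn (⊤ : Subgroup G) ρ) (g : G) :
    chr ρ g⁻¹ = starRingEnd ℂ (chr ρ g) := by
  let e := Module.finBasis ℂ W
  let A : G → Matrix _ _ ℂ := fun g => LinearMap.toMatrix e e (ρ g)
  have hA : ∀ a b, A (a * b) = A a * A b := fun a b => by
    change LinearMap.toMatrix e e _ = _
    rw [hρ.mul a (Subgroup.mem_top a) b (Subgroup.mem_top b), LinearMap.toMatrix_mul]
  have hA1 : A 1 = 1 := by
    change LinearMap.toMatrix e e _ = _
    rw [hρ.one, LinearMap.toMatrix_one]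
  have ht : ∀ g, chr ρ g = (A g).trace := fun g => LinearMap.trace_eq_matrix_trace ℂ e _
  let H := ∑ a, (A a)ᴴ * A a
  have hH : H.PosDef := by
    change (∑ a, (A a)ᴴ * A a).PosDef
    rw [← Finset.add_sum_erase _ _ (Finset.mem_univ (1 : G))]
    refine Matrix.PosDef.add_posSemidef ?_ ?_
    · rw [hA1, conjTranspose_one, one_mul]; exact Matrix.PosDef.one
    · exact Matrix.posSemidef_sum _ fun a _ => Matrix.posSemidef_conjTranspose_mul_self _
  have hinv : (A g)ᴴ * H * A g = H := by
    change (A g)ᴴ * (∑ a, (A a)ᴴ * A a) * A g = _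
    rw [Finset.mul_sum, Finset.sum_mul]
    refine Fintype.sum_equiv (Equiv.mulRight g) _ _ fun a => ?_
    rw [Equiv.coe_mulRight, hA, conjTranspose_mul]
    simp only [Matrix.mul_assoc]
  have hu := hH.isUnit
  obtain ⟨u, hu⟩ := hu
  have h1 : (A g)ᴴ = u * A g⁻¹ * (u⁻¹ : (Matrix _ _ ℂ)ˣ) := by
    rw [← Units.mul_inv_eq_iff_eq_mul, inv_inv, hu]
    conv_rhs => rw [← hinv]
    rw [Matrix.mul_assoc _ (A g), ← hA, mul_inv_cancel, hA1, mul_one]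
  rw [ht, ht, starRingEnd_apply, ← Matrix.trace_conjTranspose, h1, Matrix.trace_units_conj]

lemma isRealValued_iff {W : Type} [AddCommGroup W] [Module ℂ W] [FiniteDimensional ℂ W]
    {ρ : G → W →ₗ[ℂ] W} (hρ : RepOn (⊤ : Subgroup G) ρ) :
    IsRealValued (chr ρ) ↔ ∀ g, chr ρ g⁻¹ = chr ρ g := by
  refine forall_congr' fun g => ?_
  rw [chr_inv_eq_conj hρ, Complex.conj_eq_iff_real]

end FS

section FSCount

variable {G : Type} [Group G] [Fintype G]

lemma irrOn_of_simple (V : FDRep ℂ G) (hV : Simple V) :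
    IrrOn (⊤ : Subgroup G) (fun g => V.ρ g) := by
  have hr : RepOn (⊤ : Subgroup G) (fun g => V.ρ g) := repOn_top V.ρ
  have hne : (Nat.card G : ℂ) ≠ 0 := Nat.cast_ne_zero.2 Nat.card_pos.ne'
  let _ : Invertible (Nat.card G : ℂ) := invertibleOfNonzero hne
  have h1 := (FDRep.simple_iff_char_is_norm_one V).1 hV
  have h2 := Representation.card_inv_mul_sum_char_mul_char_eq_finrank V.ρ V.ρ
  have h3 : ∑ g, Representation.character V.ρ g * Representation.character V.ρ g⁻¹ = (Nat.card G : ℂ) := h1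
  rw [h3, inv_mul_cancel₀ hne, eq_comm, Nat.cast_eq_one] at h2
  have hnt : Nontrivial V := by
    by_contra hnt
    rw [not_nontrivial_iff_subsingleton] at hnt
    have : Subsingleton (Representation.IntertwiningMap V.ρ V.ρ) :=
      ⟨fun f g => DFunLike.ext _ _ fun x => Subsingleton.elim _ _⟩
    rw [Module.finrank_zero_of_subsingleton] at h2
    exact one_ne_zero h2.symm
  refine ⟨hr, hnt, fun X hX => ?_⟩
  obtain ⟨Y, hY, hc⟩ := hr.exists_compl hX
  let P : V →ₗ[ℂ] V := X.subtype ∘ₗ X.projectionOnto Y hc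
  have hPX : ∀ x ∈ X, P x = x := fun x hx => by
    change ((X.projectionOnto Y hc x : X) : V) = x
    exact congrArg Subtype.val (Submodule.projectionOnto_apply_left hc ⟨x, hx⟩)
  have hPY : ∀ x ∈ Y, P x = 0 := fun x hx => by
    change ((X.projectionOnto Y hc x : X) : V) = 0
    rw [(Submodule.projectionOnto_apply_eq_zero_iff hc).2 hx]; rfl
  let f : Representation.IntertwiningMap V.ρ V.ρ :=
    P.intertwiningMap_of_isIntertwiningMap V.ρ V.ρ (by
      intro g v
      obtain ⟨x, hx, y, hy, rfl⟩ : ∃ x ∈ X, ∃ y ∈ Y, x + y = v :=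
        Submodule.mem_sup.1 (hc.sup_eq_top ▸ Submodule.mem_top)
      rw [map_add, map_add, map_add, hPX _ (hX g (Subgroup.mem_top g) x hx),
        hPY _ (hY g (Subgroup.mem_top g) y hy), hPX x hx, hPY y hy, add_zero, add_zero])
  have hid : (1 : Representation.IntertwiningMap V.ρ V.ρ) ≠ 0 := by
    obtain ⟨v, hv⟩ := exists_ne (0 : V)
    intro h
    exact hv (DFunLike.congr_fun h v)
  obtain ⟨c, hcf⟩ := (finrank_eq_one_iff_of_nonzero' _ hid).1 h2 f
  have hP : ∀ v, P v = c • v := fun v => (DFunLike.congr_fun hcf v).symm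
  by_cases hc0 : c = 0
  · left
    rw [Submodule.eq_bot_iff]
    intro x hx
    rw [← hPX x hx, hP, hc0, zero_smul]
  · right
    have : Y = ⊥ := by
      rw [Submodule.eq_bot_iff]
      intro y hy
      exact (smul_eq_zero.1 ((hP y).symm.trans (hPY y hy))).resolve_left hc0
    rw [← hc.sup_eq_top, this, sup_bot_eq]

lemma IrrOn.sum_chr_top {W : Type} [AddCommGroup W] [Module ℂ W] [FiniteDimensional ℂ W]
    {ρ : G → W →ₗ[ℂ] W} (hρ : IrrOn (⊤ : Subgroup G) ρ) :
    ∑ g, chr ρ g * chr ρ g⁻¹ = Nat.card G := by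
  have h := hρ.sum_chr_mul
  rw [Nat.card_congr Subgroup.topEquiv.toEquiv] at h
  rw [← h]
  exact (Fintype.sum_equiv Subgroup.topEquiv.toEquiv _ _ fun _ => rfl).symm

lemma IrrOn.exists_fdRep {W : Type} [AddCommGroup W] [Module ℂ W] [FiniteDimensional ℂ W]
    {ρ : G → W →ₗ[ℂ] W} (hρ : IrrOn (⊤ : Subgroup G) ρ) :
    ∃ V : FDRep ℂ G, Simple V ∧ V.character = chr ρ := by
  let r : Representation ℂ G W :=
    ⟨⟨ρ, hρ.one⟩, fun a b => hρ.mul a (Subgroup.mem_top a) b (Subgroup.mem_top b)⟩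
  have h : (FDRep.of r).character = chr ρ := rfl
  refine ⟨FDRep.of r, ?_, h⟩
  rw [FDRep.simple_iff_char_is_norm_one, h]
  exact hρ.sum_chr_top

/-- The number of square roots of one, for groups without skew invariant forms. -/
theorem NoSkew.sum_finrank (H : NoSkew (⊤ : Subgroup G) 1) {ι : Type} [Fintype ι]
    (R : ι → FDRep ℂ G) (hs : ∀ i, Simple (R i))
    (hd : ∀ i j : ι, Nonempty (R i ≅ R j) → i = j)
    (hc : ∀ ρ : FDRep ℂ G, Simple ρ → ∃ i, Nonempty (ρ ≅ R i)) :
    ∑ i ∈ Finset.univ.filter (fun i => IsRealValued (R i).character),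
        (Module.finrank ℂ (R i) : ℝ) = Nat.card {g : G // g * g = 1} := by
  have hne : (Nat.card G : ℂ) ≠ 0 := Nat.cast_ne_zero.2 Nat.card_pos.ne'
  let _ : Invertible (Nat.card G : ℂ) := invertibleOfNonzero hne
  have hi : ∀ i, IrrOn (⊤ : Subgroup G) (fun g => (R i).ρ g) := fun i => irrOn_of_simple _ (hs i)
  let χ : ι → G → ℂ := fun i => (R i).character
  have ho : ∀ i j, ∑ g, χ j g * χ i g⁻¹ = if i = j then (Nat.card G : ℂ) else 0 := by
    intro i j
    have := hs i
    have := hs j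
    have h := FDRep.char_orthonormal (R j) (R i)
    rw [inv_mul_eq_iff_eq_mul₀ hne] at h
    rw [show (∑ g, χ j g * χ i g⁻¹) = _ from h]
    by_cases hij : i = j
    · subst hij
      rw [if_pos ⟨Iso.refl _⟩, if_pos rfl, mul_one]
    · rw [if_neg, if_neg hij, mul_zero]
      exact fun h => hij (hd j i h).symm
  have hreal : ∀ i, IsRealValued (χ i) ↔ ∀ g, χ i g⁻¹ = χ i g := fun i =>
    isRealValued_iff (hi i).toRepOn
  have hind : ∀ i, ∑ g, χ i (g * g) = if IsRealValued (χ i) then (Nat.card G : ℂ) else 0 := by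
    intro i
    have h1 : ∑ g, χ i g * χ i g = ∑ g, χ i (g * g) := NoSkew.sum_chr_sq (hi i) H
    rw [← h1]
    split_ifs with hr
    · have h2 := ho i i
      rw [if_pos rfl] at h2
      rw [← h2]
      exact Finset.sum_congr rfl fun g _ => by rw [(hreal i).1 hr g]
    · have hds : Simple (FDRep.of (Representation.dual (R i).ρ)) := by
        rw [FDRep.simple_iff_char_is_norm_one]
        simp only [FDRep.char_dual, inv_inv]
        have h2 := ho i i
        rw [if_pos rfl] at h2
        rw [← h2]
        exact Finset.sum_congr rfl fun g _ => mul_comm _ _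
      obtain ⟨j, ⟨f⟩⟩ := hc _ hds
      have hj : ∀ g, χ j g = χ i g⁻¹ := fun g => by
        exact (congrFun (FDRep.char_iso f).symm g).trans (FDRep.char_dual (R i) g)
      have hij : j ≠ i := by
        rintro rfl
        exact hr ((hreal _).2 fun g => (hj g).symm)
      have h2 := ho j i
      rw [if_neg hij] at h2
      rw [← h2]
      exact Finset.sum_congr rfl fun g _ => by rw [hj, inv_inv]
  let f : G → ℂ := fun g => (Nat.card {h : G // h * h = g} : ℂ) -
    ∑ i ∈ Finset.univ.filter (fun i => IsRealValued (χ i)), χ i g⁻¹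
  have hf0 : f = 0 := by
    refine class_fun_eq_zero ?_ ?_
    · intro a g
      have h1 : Nat.card {h : G // h * h = a * g * a⁻¹} = Nat.card {h : G // h * h = g} := by
        refine Nat.card_congr ((MulAut.conj a⁻¹).toEquiv.subtypeEquiv fun h => ?_)
        change _ ↔ (a⁻¹ * h * a⁻¹⁻¹) * (a⁻¹ * h * a⁻¹⁻¹) = g
        constructor
        · intro hh
          rw [show (a⁻¹ * h * a⁻¹⁻¹) * (a⁻¹ * h * a⁻¹⁻¹) = a⁻¹ * (h * h) * a by group, hh]
          group
        · intro hh
          rw [← hh]; group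
      have h2 : ∀ i, χ i (a * g * a⁻¹)⁻¹ = χ i g⁻¹ := fun i => by
        rw [show (a * g * a⁻¹)⁻¹ = a * g⁻¹ * a⁻¹ by group]
        exact FDRep.char_conj _ _ _
      simp only [f, h1, h2]
    · intro W _ _ _ ρ hρ
      obtain ⟨V, hV, hVc⟩ := hρ.exists_fdRep
      obtain ⟨j, ⟨e⟩⟩ := hc V hV
      rw [← hVc, FDRep.char_iso e]
      change ∑ g, f g * χ j g = 0
      simp only [f, sub_mul, Finset.sum_sub_distrib, Finset.sum_mul]
      rw [sub_eq_zero]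
      trans ∑ g, χ j (g * g)
      · have h1 : ∀ g, (Nat.card {h : G // h * h = g} : ℂ) * χ j g
            = ∑ h, if h * h = g then χ j (h * h) else 0 := by
          intro g
          rw [Nat.card_eq_fintype_card, Fintype.card_subtype, ← Finset.sum_filter,
            ← nsmul_eq_mul, ← Finset.sum_const]
          exact Finset.sum_congr rfl fun h hh => by rw [(Finset.mem_filter.1 hh).2]
        simp only [h1]
        rw [Finset.sum_comm]
        exact Finset.sum_congr rfl fun h _ => by rw [Finset.sum_ite_eq, if_pos (Finset.mem_univ _)]
      · rw [Finset.sum_comm, hind]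
        have h2 : ∀ i, ∑ g, χ i g⁻¹ * χ j g = if i = j then (Nat.card G : ℂ) else 0 := by
          intro i
          rw [← ho i j]
          exact Finset.sum_congr rfl fun g _ => mul_comm _ _
        simp only [h2]
        rw [Finset.sum_ite_eq']
        simp
  have h1 := congrFun hf0 1
  simp only [f, inv_one, Pi.zero_apply] at h1
  rw [sub_eq_zero] at h1
  have h2 : ∀ i, χ i 1 = Module.finrank ℂ (R i) := fun i => FDRep.char_one _
  simp only [h2] at h1
  have h3 := h1.symm
  norm_cast at h3 ⊢

end FSCount

/-- Extension of the absence of skew forms through a subgroup which has index at most two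
modulo central elements. -/
lemma NoSkew.of_central {M : Type} [Group M] [Fintype M] {A K Z : Subgroup M}
    (H : NoSkew K 1) (HS : HasSym K 1) (hKA : K ≤ A) (hZA : Z ≤ A) (hZ : Z ≤ Subgroup.center M)
    {w : M} (hw : w ∈ A) (hind : ∀ a ∈ A, a ∈ K ⊔ Z ∨ w⁻¹ * a ∈ K ⊔ Z) : NoSkew A 1 := by
  intro W _ _ _ ρ hρ b hb hs
  have hn : Nrm 1 K := fun k hk => by simpa using hk
  have hsc : ∀ a ∈ K ⊔ Z, ∃ k ∈ K, ∃ c : ℂ, ∀ v, ρ a v = c • ρ k v := by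
    intro a ha
    have hZn : Z.Normal := ⟨fun z hz g => by
      rw [Subgroup.mem_center_iff.1 (hZ hz) g, mul_inv_cancel_right]; exact hz⟩
    obtain ⟨k, hk, z, hz, rfl⟩ := Subgroup.mem_sup_of_normal_right.1 ha
    obtain ⟨c, hc⟩ := hρ.scalar (ρ z) fun k hk v => by
      rw [← hρ.toRepOn.mul_apply (hZA hz) hk, ← hρ.toRepOn.mul_apply hk (hZA hz),
        Subgroup.mem_center_iff.1 (hZ hz) k]
    refine ⟨k, hk, c, fun v => ?_⟩
    rw [hρ.toRepOn.mul_apply (hKA hk) (hZA hz), hc, map_smul]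
  have hirr : ∀ X, Stable (K ⊔ Z) ρ X → IrrOn (K ⊔ Z) (subRep ρ X) →
      Stable K ρ X ∧ IrrOn K (subRep ρ X) := by
    intro X hX hXi
    refine ⟨fun k hk => hX k (Subgroup.mem_sup_left hk), hXi.toRepOn.mono le_sup_left, hXi.nontriv,
      fun Y hY => hXi.eq_bot_or_top Y fun a ha x hx => ?_⟩
    obtain ⟨k, hk, c, hc⟩ := hsc a ha
    have : subRep ρ X a x = c • subRep ρ X k x := by
      ext
      rw [Submodule.coe_smul, hX.coe_subRep ha, hX.coe_subRep (Subgroup.mem_sup_left hk), hc]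
    rw [this]
    exact Y.smul_mem _ (hY k hk x hx)
  refine skew_eq_zero_of_index_two (sup_le hKA hZA) hw hind hρ b hs ?_ ?_
  · intro X hX hXi
    obtain ⟨h1, h2⟩ := hirr X hX hXi
    exact H.isotropic hn (hb.mono hKA) hs h1 h2
  · intro X Y hX hXi hY hYi x hx y hy hxy
    obtain ⟨h1, h2⟩ := hirr X hX hXi
    obtain ⟨h3, h4⟩ := hirr Y hY hYi
    obtain ⟨φ, hφ, hφi, hφr⟩ := HS.exists_iso hn (hb.mono hKA) h1 h2 h3 h4 hx hy hxy
    refine ⟨φ, fun a ha x => ?_, hφi, hφr⟩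
    obtain ⟨k, hk, c, hc⟩ := hsc a ha
    have : subRep ρ X a x = c • subRep ρ X k x := by
      ext
      rw [Submodule.coe_smul, hX.coe_subRep ha, hX.coe_subRep (Subgroup.mem_sup_left hk), hc]
    rw [this, map_smul, hφ k hk, hc]

/-- The absence of skew forms as a property of the abstract group. -/
lemma NoSkew.top {M : Type} [Group M] {K : Subgroup M} (H : NoSkew K 1) :
    NoSkew (⊤ : Subgroup K) 1 := by
  intro W _ _ _ ρ hρ b hb hs
  let r : M → W →ₗ[ℂ] W := fun g => if h : g ∈ K then ρ ⟨g, h⟩ else 0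
  have hr : ∀ g (h : g ∈ K), r g = ρ ⟨g, h⟩ := fun g h => dif_pos h
  refine H W r ⟨⟨?_, ?_⟩, hρ.nontriv, ?_⟩ b ?_ hs
  · rw [hr 1 K.one_mem]; exact hρ.one
  · intro a ha c hc
    rw [hr _ (K.mul_mem ha hc), hr _ ha, hr _ hc]
    exact hρ.mul ⟨a, ha⟩ (Subgroup.mem_top _) ⟨c, hc⟩ (Subgroup.mem_top _)
  · intro X hX
    refine hρ.eq_bot_or_top X fun k _ x hx => ?_
    have := hX k k.2 x hx
    rwa [hr _ k.2] at this
  · intro k hk v w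
    have := hb ⟨k, hk⟩ (Subgroup.mem_top _) v w
    simp only [one_mul, inv_one, mul_one] at this ⊢
    rwa [hr _ hk]

section MatrixForm

variable {N F : Type} [Fintype N] [DecidableEq N] [Field F] {J : Matrix N N F}

lemma symForm_toBilin' (hs : Jᵀ = J) (hu : IsUnit J) : SymForm (Matrix.toBilin' J) where
  symm x y := by
    rw [Matrix.toBilin'_apply', Matrix.toBilin'_apply', Matrix.dotProduct_mulVec,
      ← Matrix.mulVec_transpose, hs, dotProduct_comm]
  nondeg x h := by
    have h1 : x ᵥ* J = 0 := by
      rw [← dotProduct_eq_zero_iff]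
      intro y
      rw [← Matrix.dotProduct_mulVec, ← Matrix.toBilin'_apply']
      exact h y
    obtain ⟨u, rfl⟩ := hu
    have := congrArg (· ᵥ* ((u⁻¹ : (Matrix N N F)ˣ) : Matrix N N F)) h1
    simpa [Matrix.vecMul_vecMul] using this

/-- Invertible endomorphisms as invertible matrices. -/
def endGL (N F : Type) [Fintype N] [DecidableEq N] [Field F] :
    (Module.End F (N → F))ˣ ≃* GL N F :=
  Units.mapEquiv (LinearMap.toMatrixAlgEquiv' (R := F) (n := N)).toMulEquiv

lemma endGL_mulVec (g : (Module.End F (N → F))ˣ) (x : N → F) :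
    (endGL N F g : Matrix N N F) *ᵥ x = (g : Module.End F (N → F)) x := by
  change (LinearMap.toMatrix' (g : Module.End F (N → F))) *ᵥ x = _
  rw [LinearMap.toMatrix'_mulVec]

lemma toBilin'_mulVec (A : Matrix N N F) (x y : N → F) :
    Matrix.toBilin' J (A *ᵥ x) (A *ᵥ y) = Matrix.toBilin' (Aᵀ * J * A) x y := by
  simp only [Matrix.toBilin'_apply']
  rw [Matrix.dotProduct_mulVec, Matrix.dotProduct_mulVec, Matrix.dotProduct_mulVec,
    ← Matrix.vecMul_transpose]
  simp only [Matrix.vecMul_vecMul]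

lemma endGL_mem_fixGroup (g : (Module.End F (N → F))ˣ) :
    endGL N F g ∈ fixGroup J ↔ g ∈ orth (Matrix.toBilin' J) := by
  change (_ : Matrix N N F)ᵀ * J * _ = J ↔ _
  rw [mem_orth]
  simp only [← endGL_mulVec, toBilin'_mulVec]
  constructor
  · intro h x y; rw [h]
  · intro h
    apply Matrix.toBilin'.injective
    exact LinearMap.ext₂ h

lemma orth_map_endGL : (orth (Matrix.toBilin' J)).map (endGL N F).toMonoidHom = fixGroup J := by
  ext g
  obtain ⟨a, rfl⟩ := (endGL N F).surjective g
  rw [endGL_mem_fixGroup]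
  exact Subgroup.mem_map_iff_mem (f := (endGL N F).toMonoidHom) (endGL N F).injective

lemma fixGroup_exists_conj [Finite F] (h2 : (2 : F) ≠ 0) (hs : Jᵀ = J) (hu : IsUnit J)
    {g : GL N F} (hg : g ∈ fixGroup J) :
    ∃ h ∈ fixGroup J, h * g * h⁻¹ = g⁻¹ := by
  obtain ⟨a, rfl⟩ := (endGL N F).surjective g
  rw [endGL_mem_fixGroup] at hg
  obtain ⟨h, hh, -, hr⟩ := exists_reversing h2 (symForm_toBilin' hs hu) hg
  refine ⟨endGL N F h, (endGL_mem_fixGroup h).2 hh, ?_⟩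
  rw [← map_inv, ← map_inv, ← map_mul, ← map_mul, hr]

lemma noSkew_orth {V : Type} [AddCommGroup V] [Module F V] [Finite V] (h2 : (2 : F) ≠ 0)
    {B : LinearMap.BilinForm F V} (hB : SymForm B) : NoSkew (orth B) 1 := by
  have h1 : (-1 : (Module.End F V)ˣ) ∈ orth B := by rw [mem_orth]; simp
  have key := noSkew_cen h2 _ V B rfl hB _ 0 (-1) 1 rfl h1 (by simp) (one_mem _) (one_mul 1)
    (by simp)
  have e : cen B (-1) = orth B := by
    refine inf_eq_left.2 fun g _ => Subgroup.mem_centralizer_singleton_iff.2 (by simp)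
  rwa [e] at key

lemma noSkew_fixGroup [Finite F] (h2 : (2 : F) ≠ 0) (hs : Jᵀ = J) (hu : IsUnit J) :
    NoSkew (fixGroup J) 1 := by
  rw [← orth_map_endGL]
  exact NoSkew.map _ (h₁ := 1) (by simp) (noSkew_orth h2 (symForm_toBilin' hs hu))

lemma hasSym_fixGroup [Finite F] (h2 : (2 : F) ≠ 0) (hs : Jᵀ = J) (hu : IsUnit J) :
    HasSym (fixGroup J) 1 := by
  let := Fintype.ofFinite (GL N F)
  refine (noSkew_fixGroup h2 hs hu).hasSym (fun k hk => by simpa using hk) (one_mul 1)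
    fun g hg => ?_
  obtain ⟨h, hh, hr⟩ := fixGroup_exists_conj h2 hs hu hg
  exact ⟨h, by simpa using hh, hr⟩

lemma fixGroup_le : fixGroup J ≤ similitudeGroup J := by
  intro g hg
  refine ⟨1, ?_⟩
  rw [Units.val_one, one_smul]; exact hg

/-- Scalar matrices. -/
def scalars (N F : Type) [Fintype N] [DecidableEq N] [Field F] : Subgroup (GL N F) :=
  (Units.map (Matrix.scalar N).toMonoidHom : Fˣ →* GL N F).range

lemma scalars_le : scalars N F ≤ similitudeGroup J := by
  rintro _ ⟨c, rfl⟩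
  refine ⟨c * c, ?_⟩
  change (Matrix.scalar N (c : F))ᵀ * J * (Matrix.scalar N (c : F)) = _
  simp [Matrix.scalar_apply, ← Matrix.smul_one_eq_diagonal, smul_smul]

lemma scalars_le_center : scalars N F ≤ Subgroup.center (GL N F) := by
  rintro _ ⟨c, rfl⟩
  rw [Subgroup.mem_center_iff]
  intro g
  ext1
  change (g : Matrix N N F) * Matrix.scalar N (c : F) = Matrix.scalar N (c : F) * g
  simp [Matrix.scalar_apply, ← Matrix.smul_one_eq_diagonal]

/-- A similitude with square multiplier is an isometry times a scalar. -/
lemma mem_sup_of_square {g : GL N F} {c d : Fˣ} (hc : c = d * d)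
    (hg : (g : Matrix N N F)ᵀ * J * (g : Matrix N N F) = (c : F) • J) :
    g ∈ fixGroup J ⊔ scalars N F := by
  let s : GL N F := Units.map (Matrix.scalar N).toMonoidHom d
  have hs : s ∈ scalars N F := ⟨d, rfl⟩
  have h1 : (s : Matrix N N F)ᵀ * J * (s : Matrix N N F) = ((d * d : Fˣ) : F) • J := by
    change (Matrix.scalar N (d : F))ᵀ * J * (Matrix.scalar N (d : F)) = _
    simp [Matrix.scalar_apply, ← Matrix.smul_one_eq_diagonal, smul_smul]
  have h2 := sim_mul g s⁻¹ _ _ hg (sim_inv s _ h1)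
  rw [hc, mul_inv_cancel, Units.val_one, one_smul] at h2
  rw [← inv_mul_cancel_right g s]
  exact Subgroup.mul_mem_sup h2 hs

lemma noSkew_similitudeGroup [Finite F] (h2 : (2 : F) ≠ 0) (hs : Jᵀ = J) (hu : IsUnit J) :
    NoSkew (similitudeGroup J) 1 := by
  let := Fintype.ofFinite (GL N F)
  let := Fintype.ofFinite F
  have hsq : ∀ a b : Fˣ, ¬ IsSquare a → ¬ IsSquare b → IsSquare (a⁻¹ * b) := by
    intro a b ha hb
    have hu : ∀ a : Fˣ, IsSquare (a : F) → IsSquare a := by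
      rintro a ⟨x, hx⟩
      have hx0 : x ≠ 0 := by rintro rfl; simp at hx
      exact ⟨Units.mk0 x hx0, Units.ext hx⟩
    have h1 : quadraticChar F ((a : F) * b) = 1 := by
      rw [map_mul, quadraticChar_neg_one_iff_not_isSquare.2 fun h => ha (hu a h),
        quadraticChar_neg_one_iff_not_isSquare.2 fun h => hb (hu b h)]; rfl
    obtain ⟨x, hx⟩ := hu (a * b) ((quadraticChar_one_iff_isSquare (by simp)).1 h1)
    refine ⟨a⁻¹ * x, ?_⟩
    rw [mul_mul_mul_comm, ← hx, mul_assoc, inv_mul_cancel_left]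
  have hN := noSkew_fixGroup h2 hs hu
  have hS := hasSym_fixGroup h2 hs hu
  by_cases hw : ∃ w : GL N F, ∃ c : Fˣ, (w : Matrix N N F)ᵀ * J * (w : Matrix N N F) = (c : F) • J
      ∧ ¬ IsSquare c
  · obtain ⟨w, c, hwc, hc⟩ := hw
    refine hN.of_central hS fixGroup_le scalars_le scalars_le_center (w := w) ⟨c, hwc⟩ ?_
    rintro a ⟨d, hd⟩
    by_cases hdq : IsSquare d
    · obtain ⟨e, he⟩ := hdq
      exact Or.inl (mem_sup_of_square he hd)
    · obtain ⟨e, he⟩ := hsq c d hc hdq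
      exact Or.inr (mem_sup_of_square he (sim_mul _ _ _ _ (sim_inv w c hwc) hd))
  · push Not at hw
    refine hN.of_central hS fixGroup_le scalars_le scalars_le_center (w := 1) (one_mem _) ?_
    rintro a ⟨d, hd⟩
    obtain ⟨e, he⟩ := hw a d hd
    exact Or.inl (mem_sup_of_square he hd)

end MatrixForm

section Count

lemma natCard_sigma_ite {X : Type} [Finite X] {Y : X → Type} [∀ x, Finite (Y x)] {p : X → Prop}
    {a b : ℕ} (ha : ∀ x, p x → Nat.card (Y x) = a) (hb : ∀ x, ¬ p x → Nat.card (Y x) = b) :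
    Nat.card (Σ x, Y x) = Nat.card {x // p x} * a + Nat.card {x // ¬ p x} * b := by
  let := Fintype.ofFinite X
  rw [Nat.card_sigma, Finset.sum_congr rfl fun x _ =>
    show Nat.card (Y x) = if p x then a else b by
      split_ifs with h
      · exact ha x h
      · exact hb x h, Finset.sum_ite, Finset.sum_const, Finset.sum_const,
    Nat.card_eq_fintype_card, Nat.card_eq_fintype_card, Fintype.card_subtype, Fintype.card_subtype,
    smul_eq_mul, smul_eq_mul]

lemma natCard_subtype_add_not {X : Type} [Finite X] (p : X → Prop) :
    Nat.card {x // p x} + Nat.card {x // ¬ p x} = Nat.card X := by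
  rw [← Nat.card_sum, Nat.card_congr (Equiv.sumCompl p)]

variable {F V : Type} [Field F] [AddCommGroup V] [Module F V]

/-- The fibres of a nonzero functional. -/
lemma natCard_fiber_mul {φ : V →ₗ[F] F} (hφ : φ ≠ 0) (c : F) :
    Nat.card {x // φ x = c} * Nat.card F = Nat.card V := by
  obtain ⟨u, hu⟩ : ∃ u, φ u = 1 := by
    obtain ⟨x, hx⟩ := DFunLike.ne_iff.1 hφ
    have hx' : φ x ≠ 0 := hx
    exact ⟨(φ x)⁻¹ • x, by rw [map_smul, smul_eq_mul, inv_mul_cancel₀ hx']⟩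
  rw [← Nat.card_prod]
  refine Nat.card_congr
    { toFun := fun p => p.1 + (p.2 - c) • u
      invFun := fun x => (⟨x - (φ x - c) • u, by
        rw [map_sub, map_smul, hu, smul_eq_mul]; ring⟩, φ x)
      left_inv := ?_
      right_inv := fun x => by simp }
  rintro ⟨⟨x, hx⟩, t⟩
  have h1 : φ (x + (t - c) • u) = t := by
    rw [map_add, map_smul, hu, hx, smul_eq_mul]; ring
  refine Prod.ext (Subtype.ext ?_) ?_
  · change x + (t - c) • u - (φ (x + (t - c) • u) - c) • u = x
    rw [h1, add_sub_cancel_right]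
  · exact h1

lemma natCard_fiber [Finite F] [FiniteDimensional F V] {φ : V →ₗ[F] F} (hφ : φ ≠ 0) (c : F)
    {m : ℕ} (hm : Module.finrank F V = m + 1) : Nat.card {x // φ x = c} = Nat.card F ^ m := by
  have h := natCard_fiber_mul hφ c
  rw [Module.natCard_eq_pow_finrank (K := F) (V := V), hm, pow_succ] at h
  exact Nat.eq_of_mul_eq_mul_right Nat.card_pos h

variable {B : LinearMap.BilinForm F V}

/-- Totally isotropic subspaces. -/
def TotIso (B : LinearMap.BilinForm F V) (L : Submodule F V) : Prop :=
  ∀ x ∈ L, ∀ y ∈ L, B x y = 0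

lemma SymForm.finrank_orthogonal [FiniteDimensional F V] (hB : SymForm B) (L : Submodule F V) :
    Module.finrank F L + Module.finrank F (B.orthogonal L) = Module.finrank F V := by
  rw [LinearMap.BilinForm.finrank_add_finrank_orthogonal hB.isRefl]
  have : B.orthogonal ⊤ = ⊥ := by
    rw [Submodule.eq_bot_iff]
    intro x hx
    refine hB.nondeg x fun y => ?_
    rw [hB.symm]
    exact LinearMap.BilinForm.mem_orthogonal_iff.1 hx y Submodule.mem_top
  rw [this, inf_bot_eq, finrank_bot, add_zero]

lemma TotIso.le_orthogonal {L : Submodule F V} (hL : TotIso B L) : L ≤ B.orthogonal L :=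
  fun x hx => LinearMap.BilinForm.mem_orthogonal_iff.2 fun y hy => hL y hy x hx

lemma TotIso.finrank_le [FiniteDimensional F V] (hB : SymForm B) {L : Submodule F V}
    (hL : TotIso B L) : 2 * Module.finrank F L ≤ Module.finrank F V := by
  have h1 := hB.finrank_orthogonal L
  have h2 := Submodule.finrank_mono hL.le_orthogonal
  omega

/-- The number of isotropic vectors of a split form. -/
lemma natCard_isotropic [Finite F] [FiniteDimensional F V] (h2 : (2 : F) ≠ 0) (hB : SymForm B)
    {L : Submodule F V} (hL : TotIso B L) {m : ℕ} (hV : Module.finrank F V = 2 * (m + 1))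
    (hm : Module.finrank F L = m + 1) :
    Nat.card {x // B x x = 0} + Nat.card F ^ m
      = Nat.card F ^ (m + 1) + Nat.card F ^ (2 * m + 1) := by
  have : Finite V := Module.finite_of_finite F
  have hLo : B.orthogonal L = L := by
    refine (Submodule.eq_of_le_of_finrank_eq hL.le_orthogonal ?_).symm
    have := hB.finrank_orthogonal L
    omega
  have hLc : Nat.card L = Nat.card F ^ (m + 1) := by
    rw [Module.natCard_eq_pow_finrank (K := F), hm]
  have e : {x // B x x = 0} × L ≃ {p : V × L // B (p.1 + p.2) (p.1 + p.2) = 0} :=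
    { toFun := fun p => ⟨(p.1 - p.2, p.2), by
        dsimp only; rw [sub_add_cancel]; exact p.1.2⟩
      invFun := fun p => (⟨p.1.1 + p.1.2, p.2⟩, p.1.2)
      left_inv := fun p => by simp
      right_inv := fun p => by simp }
  have h1 : ∀ x ∈ L, Nat.card {l : L // B (x + l) (x + l) = 0} = Nat.card F ^ (m + 1) := by
    intro x hx
    rw [← hLc]
    exact Nat.card_congr (Equiv.subtypeUnivEquiv fun l =>
      hL _ (L.add_mem hx l.2) _ (L.add_mem hx l.2))
  have h3 : ∀ x ∉ L, Nat.card {l : L // B (x + l) (x + l) = 0} = Nat.card F ^ m := by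
    intro x hx
    have hφ : (B x) ∘ₗ L.subtype ≠ 0 := by
      intro h
      apply hx
      rw [← hLo, LinearMap.BilinForm.mem_orthogonal_iff]
      intro y hy
      rw [hB.symm]
      exact LinearMap.congr_fun h ⟨y, hy⟩
    rw [← natCard_fiber hφ (-(B x x) / 2) hm]
    refine Nat.card_congr (Equiv.subtypeEquivRight fun l => ?_)
    have : B (x + l) (x + l) = B x x + 2 * B x l := by
      simp only [map_add, LinearMap.add_apply]
      rw [hL _ l.2 _ l.2, hB.symm (l : V) x]; ring
    rw [this]
    change _ ↔ B x l = _
    rw [eq_div_iff h2, add_comm, ← eq_neg_iff_add_eq_zero, mul_comm]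
  have h6 : Nat.card {x // x ∈ L} = Nat.card F ^ (m + 1) := hLc
  have h4 := Nat.card_congr (e.trans (Equiv.subtypeProdEquivSigmaSubtype
    fun (x : V) (l : L) => B (x + l) (x + l) = 0))
  rw [Nat.card_prod, natCard_sigma_ite h1 h3, hLc] at h4
  have h5 := natCard_subtype_add_not (fun x : V => x ∈ L)
  rw [h6, Module.natCard_eq_pow_finrank (K := F) (V := V), hV] at h5
  have hq : 0 < Nat.card F := Nat.card_pos
  set q := Nat.card F
  set a := Nat.card {x // B x x = 0}
  set d := Nat.card {x // x ∉ L}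
  refine Nat.eq_of_mul_eq_mul_right (pow_pos hq (m + 1)) ?_
  zify at *
  have e1 : (q : ℤ) ^ (2 * (m + 1)) = q ^ (m + 1) * q ^ (m + 1) := by ring
  have e2 : (q : ℤ) ^ (2 * m + 1) = q ^ (m + 1) * q ^ m := by ring
  rw [e1] at h5
  rw [e2]
  linear_combination h4 + (q : ℤ) ^ m * h5

end Count

section AntiInvolutions

variable {F V : Type} [Field F] [AddCommGroup V] [Module F V] {B : LinearMap.BilinForm F V}

/-- Involutions which negate the form. -/
def AntiInv (B : LinearMap.BilinForm F V) (g : Module.End F V) : Prop :=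
  (∀ x, g (g x) = x) ∧ ∀ x y, B (g x) (g y) = - B x y

/-- Hyperbolic pairs. -/
structure HypPair (B : LinearMap.BilinForm F V) (v w : V) : Prop where
  left : B v v = 0
  right : B w w = 0
  pair : B v w = 1

/-- The orthogonal complement of a pair of vectors. -/
def perp (B : LinearMap.BilinForm F V) (v w : V) : Submodule F V :=
  LinearMap.ker (B v) ⊓ LinearMap.ker (B w)

lemma mem_perp {v w x : V} : x ∈ perp B v w ↔ B v x = 0 ∧ B w x = 0 := Iff.rfl

variable {v w : V}

/-- The projection to the orthogonal complement of a hyperbolic pair. -/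
def toPerp (hB : SymForm B) (h : HypPair B v w) : V →ₗ[F] perp B v w :=
  LinearMap.codRestrict _ (LinearMap.id - (B w).smulRight v - (B v).smulRight w) fun x => by
    rw [mem_perp]
    have h1 : B w v = 1 := by rw [hB.symm, h.pair]
    simp [h.left, h.right, h.pair, h1]

lemma toPerp_apply (hB : SymForm B) (h : HypPair B v w) (x : V) :
    (toPerp hB h x : V) = x - B w x • v - B v x • w := rfl

lemma HypPair.decomp (hB : SymForm B) (h : HypPair B v w) (x : V) :
    ∃ (p : perp B v w) (a b : F), x = p + a • v + b • w :=
  ⟨toPerp hB h x, B w x, B v x, by rw [toPerp_apply]; abel⟩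

lemma HypPair.nonDegOn_perp (hB : SymForm B) (h : HypPair B v w) : NonDegOn B (perp B v w) := by
  intro x hx hx'
  refine hB.nondeg x fun y => ?_
  obtain ⟨p, a, b, rfl⟩ := h.decomp hB y
  rw [map_add, map_add, map_smul, map_smul, hx' _ p.2, hB.symm x v, hB.symm x w, hx.1, hx.2]
  simp

lemma HypPair.finrank_perp [FiniteDimensional F V] (hB : SymForm B) (h : HypPair B v w) :
    Module.finrank F (perp B v w) + 2 = Module.finrank F V := by
  have h1 : B w v = 1 := by rw [hB.symm, h.pair]
  have hs : Function.Surjective ((B v).prod (B w)) := by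
    rintro ⟨a, b⟩
    refine ⟨b • v + a • w, ?_⟩
    simp [h.left, h.right, h.pair, h1]
  have := LinearMap.finrank_range_add_finrank_ker ((B v).prod (B w))
  rw [LinearMap.range_eq_top.2 hs, finrank_top, LinearMap.ker_prod, Module.finrank_prod,
    Module.finrank_self] at this
  change 2 + Module.finrank F (perp B v w) = _ at this
  omega

lemma HypPair.apply_decomp (hB : SymForm B) (h : HypPair B v w) (p p' : perp B v w)
    (a b a' b' : F) :
    B (p + a • v + b • w) (p' + a' • v + b' • w) = B p p' + (a * b' + b * a') := by
  have h1 : B w v = 1 := by rw [hB.symm, h.pair]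
  have h2 : B p v = 0 := by rw [hB.symm]; exact p.2.1
  have h3 : B p w = 0 := by rw [hB.symm]; exact p.2.2
  simp only [map_add, map_smul, LinearMap.add_apply, LinearMap.smul_apply, smul_eq_mul,
    (mem_perp.1 p'.2).1, (mem_perp.1 p'.2).2, h1, h2, h3, h.left, h.right, h.pair]
  ring

/-- Extend an endomorphism of the orthogonal complement of a hyperbolic pair. -/
def extendPerp (hB : SymForm B) (h : HypPair B v w) (g : Module.End F (perp B v w)) :
    Module.End F V :=
  (perp B v w).subtype ∘ₗ g ∘ₗ toPerp hB h + (B w).smulRight v - (B v).smulRight w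

lemma extendPerp_apply (hB : SymForm B) (h : HypPair B v w) (g : Module.End F (perp B v w))
    (p : perp B v w) (a b : F) :
    extendPerp hB h g (p + a • v + b • w) = g p + a • v + (-b) • w := by
  have h1 : B w v = 1 := by rw [hB.symm, h.pair]
  have e1 : B w (p + a • v + b • w) = a := by simp [h1, h.right, (mem_perp.1 p.2).2]
  have e2 : B v (p + a • v + b • w) = b := by simp [h.pair, h.left, (mem_perp.1 p.2).1]
  have e3 : toPerp hB h (p + a • v + b • w) = p := by
    apply Subtype.ext
    rw [toPerp_apply, e1, e2]; abel
  rw [neg_smul, ← sub_eq_add_neg]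
  simp only [extendPerp, LinearMap.sub_apply, LinearMap.add_apply, LinearMap.comp_apply,
    LinearMap.smulRight_apply, e1, e2, e3, Submodule.subtype_apply]

lemma AntiInv.mapsTo_perp {g : Module.End F V} (hg : AntiInv B g) (hv : g v = v)
    (hw : g w = -w) : ∀ x ∈ perp B v w, g x ∈ perp B v w := by
  intro x hx
  constructor
  · change B v (g x) = 0
    rw [← hv, hg.2, (mem_perp.1 hx).1, neg_zero]
  · change B w (g x) = 0
    have := hg.2 w x
    rw [hw, (mem_perp.1 hx).2, neg_zero, map_neg, LinearMap.neg_apply, neg_eq_zero] at this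
    exact this

/-- Negating involutions adapted to a hyperbolic pair. -/
def antiInvEquiv (hB : SymForm B) (h : HypPair B v w) :
    {g : Module.End F V // AntiInv B g ∧ g v = v ∧ g w = -w} ≃
      {g : Module.End F (perp B v w) // AntiInv (B.restrict (perp B v w)) g} where
  toFun g := ⟨g.1.restrict (g.2.1.mapsTo_perp g.2.2.1 g.2.2.2),
    fun x => Subtype.ext (g.2.1.1 x), fun x y => g.2.1.2 x y⟩
  invFun g := by
    refine ⟨extendPerp hB h g.1, ⟨fun x => ?_, fun x y => ?_⟩, ?_, ?_⟩
    · obtain ⟨p, a, b, rfl⟩ := h.decomp hB x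
      rw [extendPerp_apply, extendPerp_apply, g.2.1, neg_neg]
    · obtain ⟨p, a, b, rfl⟩ := h.decomp hB x
      obtain ⟨p', a', b', rfl⟩ := h.decomp hB y
      rw [extendPerp_apply, extendPerp_apply, h.apply_decomp hB, h.apply_decomp hB]
      have := g.2.2 p p'
      change B (g.1 p) (g.1 p') = - B p p' at this
      rw [this]; ring
    · have := extendPerp_apply hB h g.1 0 1 0
      simpa using this
    · have := extendPerp_apply hB h g.1 0 0 1
      simpa using this
  left_inv g := by
    apply Subtype.ext
    ext x
    obtain ⟨p, a, b, rfl⟩ := h.decomp hB x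
    have e : g.1 (p + a • v + b • w) = g.1 p + a • v + b • -w := by
      rw [map_add, map_add, map_smul, map_smul, g.2.2.1, g.2.2.2]
    dsimp only
    rw [extendPerp_apply, e, smul_neg, neg_smul]
    rfl
  right_inv g := by
    apply Subtype.ext
    ext p
    have := extendPerp_apply hB h g.1 p 0 0
    simp only [zero_smul, add_zero, neg_zero] at this
    exact this

lemma finrank_le_inf_ker [FiniteDimensional F V] (L : Submodule F V) (φ : V →ₗ[F] F) :
    Module.finrank F L ≤ Module.finrank F (L ⊓ LinearMap.ker φ : Submodule F V) + 1 := by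
  have h1 := Submodule.finrank_sup_add_finrank_inf_eq L (LinearMap.ker φ)
  have h2 := LinearMap.finrank_range_add_finrank_ker φ
  have h3 := Submodule.finrank_le (L ⊔ LinearMap.ker φ)
  have h4 := Submodule.finrank_le (LinearMap.range φ)
  rw [Module.finrank_self] at h4
  omega

/-- The orthogonal complement of a hyperbolic pair in a split space is split. -/
lemma HypPair.exists_totIso [FiniteDimensional F V] (hB : SymForm B) (h : HypPair B v w)
    {L : Submodule F V} (hL : TotIso B L) {m : ℕ} (hV : Module.finrank F V = 2 * (m + 1))
    (hm : Module.finrank F L = m + 1) :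
    ∃ L' : Submodule F (perp B v w), TotIso (B.restrict (perp B v w)) L' ∧
      Module.finrank F L' = m := by
  have hv0 : v ≠ 0 := by
    rintro rfl
    have := h.pair
    simp at this
  set A : Submodule F V := L ⊓ LinearMap.ker (B v) with hA
  set M : Submodule F V := A ⊔ Submodule.span F {v} with hM
  have hMm : ∀ x ∈ M, ∃ a ∈ L, B v a = 0 ∧ ∃ c : F, x = a + c • v := by
    intro x hx
    obtain ⟨a, ha, y, hy, rfl⟩ := Submodule.mem_sup.1 hx
    obtain ⟨c, rfl⟩ := Submodule.mem_span_singleton.1 hy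
    exact ⟨a, ha.1, ha.2, c, rfl⟩
  have hMt : TotIso B M := by
    intro x hx y hy
    obtain ⟨a, ha, ha', c, rfl⟩ := hMm x hx
    obtain ⟨b, hb, hb', d, rfl⟩ := hMm y hy
    have : B a v = 0 := by rw [hB.symm, ha']
    simp [this, hb', h.left, hL a ha b hb]
  have hMd : m + 1 ≤ Module.finrank F M := by
    by_cases hvL : v ∈ L
    · rw [← hm]
      exact Submodule.finrank_mono fun x hx =>
        Submodule.mem_sup_left ⟨hx, hL v hvL x hx⟩
    · have h1 := Submodule.finrank_sup_add_finrank_inf_eq A (Submodule.span F {v})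
      have h2 : A ⊓ Submodule.span F {v} = ⊥ := by
        rw [Submodule.eq_bot_iff]
        rintro x ⟨hx, hx'⟩
        obtain ⟨c, rfl⟩ := Submodule.mem_span_singleton.1 hx'
        by_cases hc : c = 0
        · rw [hc, zero_smul]
        · exact absurd ((L.smul_mem_iff hc).1 hx.1) hvL
      have h3 := finrank_le_inf_ker L (B v)
      rw [h2, finrank_bot, finrank_span_singleton hv0, ← hM] at h1
      rw [← hA] at h3
      omega
  have hMv : M ⊓ LinearMap.ker (B w) ≤ perp B v w := by
    rintro x ⟨hx, hx'⟩
    refine ⟨?_, hx'⟩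
    obtain ⟨a, ha, ha', c, rfl⟩ := hMm x hx
    change B v _ = 0
    rw [map_add, map_smul, ha', h.left, smul_zero, add_zero]
  refine ⟨(M ⊓ LinearMap.ker (B w)).comap (perp B v w).subtype, ?_, ?_⟩
  · intro x hx y hy
    exact hMt x hx.1 y hy.1
  · have ht : TotIso (B.restrict (perp B v w))
        ((M ⊓ LinearMap.ker (B w)).comap (perp B v w).subtype) :=
      fun x hx y hy => hMt x hx.1 y hy.1
    have h1 := ht.finrank_le (hB.restrict (h.nonDegOn_perp hB))
    have h2 := h.finrank_perp hB
    have h3 := finrank_le_inf_ker M (B w)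
    rw [(Submodule.comapSubtypeEquivOfLe hMv).finrank_eq] at h1 ⊢
    omega

end AntiInvolutions

section AntiCount

instance finite_end {F V : Type} [Field F] [AddCommGroup V] [Module F V] [Finite V] :
    Finite (Module.End F V) :=
  Finite.of_injective (fun g : Module.End F V => (g : V → V)) DFunLike.coe_injective

lemma natCard_and_ne {X : Type} [Finite X] {p : X → Prop} {x₀ : X} (h : p x₀) :
    Nat.card {x // p x ∧ x ≠ x₀} + 1 = Nat.card {x // p x} := by
  rw [← natCard_subtype_add_not (fun x : {x // p x} => x.1 = x₀), add_comm]
  congr 1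
  · symm
    rw [Nat.card_eq_one_iff_unique]
    exact ⟨⟨fun a b => Subtype.ext (Subtype.ext (a.2.trans b.2.symm))⟩, ⟨⟨⟨x₀, h⟩, rfl⟩⟩⟩
  · exact Nat.card_congr (Equiv.subtypeSubtypeEquivSubtypeInter _ (fun x => x ≠ x₀)).symm

/-- Count a set of pairs by its nonempty fibres. -/
lemma natCard_pairs {X Y : Type} [Finite X] [Finite Y] {P : X → Y → Prop} (p : X → Prop) {a : ℕ}
    (ha : ∀ x, p x → Nat.card {y // P x y} = a) (hb : ∀ x y, P x y → p x) :
    Nat.card {t : X × Y // P t.1 t.2} = Nat.card {x // p x} * a := by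
  rw [Nat.card_congr (Equiv.subtypeProdEquivSigmaSubtype P),
    natCard_sigma_ite (p := p) (b := 0) ha fun x hx => ?_, mul_zero, add_zero]
  have : IsEmpty {y // P x y} := ⟨fun y => hx (hb x y.1 y.2)⟩
  exact Nat.card_of_isEmpty

lemma natCard_pairs_swap {X Y : Type} (P : X → Y → Prop) :
    Nat.card {t : X × Y // P t.1 t.2} = Nat.card {t : Y × X // P t.2 t.1} :=
  Nat.card_congr ((Equiv.prodComm X Y).subtypeEquiv fun _ => Iff.rfl)

variable {F V : Type} [Field F] [AddCommGroup V] [Module F V]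
  {B : LinearMap.BilinForm F V}

lemma AntiInv.finrank_eq [FiniteDimensional F V] (h2 : (2 : F) ≠ 0) (hB : SymForm B) {g : Module.End F V}
    (hg : AntiInv B g) {m : ℕ} (hV : Module.finrank F V = 2 * m) :
    Module.finrank F (LinearMap.ker (g - 1)) = m ∧
      Module.finrank F (LinearMap.ker (g + 1)) = m := by
  have key : ∀ t : F, t = -t → t = 0 := by
    intro t ht
    have : 2 * t = 0 := by linear_combination ht
    exact (mul_eq_zero.1 this).resolve_left h2
  have e1 : ∀ x ∈ LinearMap.ker (g - 1), g x = x := fun x hx => sub_eq_zero.1 hx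
  have e2 : ∀ x ∈ LinearMap.ker (g + 1), g x = -x := fun x hx => eq_neg_of_add_eq_zero_left hx
  have t1 : TotIso B (LinearMap.ker (g - 1)) := fun x hx y hy => key _ (by
    rw [← hg.2, e1 x hx, e1 y hy])
  have t2 : TotIso B (LinearMap.ker (g + 1)) := fun x hx y hy => key _ (by
    rw [← hg.2, e2 x hx, e2 y hy]; simp)
  have h3 : LinearMap.ker (g - 1) ⊔ LinearMap.ker (g + 1) = ⊤ := by
    rw [eq_top_iff]
    intro x _
    rw [show x = (2 : F)⁻¹ • (x + g x) + (2 : F)⁻¹ • (x - g x) by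
      rw [← smul_add, add_add_sub_cancel, ← two_smul F, inv_smul_smul₀ h2]]
    refine Submodule.add_mem_sup (Submodule.smul_mem _ _ ?_) (Submodule.smul_mem _ _ ?_)
    · rw [LinearMap.mem_ker, LinearMap.sub_apply, map_add, hg.1, Module.End.one_apply]; abel
    · rw [LinearMap.mem_ker, LinearMap.add_apply, map_sub, hg.1, Module.End.one_apply]; abel
  have h4 := Submodule.finrank_add_le_finrank_add_finrank (LinearMap.ker (g - 1))
    (LinearMap.ker (g + 1))
  rw [h3, finrank_top] at h4
  have h5 := t1.finrank_le hB
  have h6 := t2.finrank_le hB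
  omega

lemma AntiInv.self_eq_zero (h2 : (2 : F) ≠ 0) {g : Module.End F V} (hg : AntiInv B g) {x : V}
    (hx : g x = x ∨ g x = -x) : B x x = 0 := by
  have : B x x = - B x x := by
    rw [← hg.2]
    rcases hx with hx | hx <;> simp [hx]
  have : 2 * B x x = 0 := by linear_combination this
  exact (mul_eq_zero.1 this).resolve_left h2

/-- The number of hyperbolic pairs adapted to a negating involution. -/
lemma AntiInv.natCard_pairs [Finite F] [FiniteDimensional F V] (h2 : (2 : F) ≠ 0) (hB : SymForm B) {g : Module.End F V}
    (hg : AntiInv B g) {m : ℕ} (hV : Module.finrank F V = 2 * (m + 1)) :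
    Nat.card {t : V × V // g t.1 = t.1 ∧ g t.2 = -t.2 ∧ B t.1 t.2 = 1}
      = (Nat.card F ^ (m + 1) - 1) * Nat.card F ^ m := by
  have : Finite V := Module.finite_of_finite F
  obtain ⟨d1, d2⟩ := hg.finrank_eq h2 hB hV
  rw [OrthSim.natCard_pairs (P := fun v w => g v = v ∧ g w = -w ∧ B v w = 1)
    (fun v => g v = v ∧ v ≠ 0) (a := Nat.card F ^ m)]
  · congr 1
    have h := natCard_and_ne (p := fun v => g v = v) (x₀ := 0) (map_zero g)
    have h' : Nat.card {v // g v = v} = Nat.card F ^ (m + 1) := by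
      rw [← d1, ← Module.natCard_eq_pow_finrank (K := F)]
      exact Nat.card_congr (Equiv.subtypeEquivRight fun x => sub_eq_zero.symm)
    rw [← h', ← h, Nat.add_sub_cancel]
  · rintro v ⟨hv, hv0⟩
    have hφ : B v ∘ₗ (LinearMap.ker (g + 1)).subtype ≠ 0 := by
      intro h
      refine hv0 (hB.nondeg v fun y => ?_)
      have e : B v (y - g y) = 0 := LinearMap.congr_fun h ⟨y - g y, by
        rw [LinearMap.mem_ker, LinearMap.add_apply, map_sub, hg.1, Module.End.one_apply]; abel⟩
      have e' := hg.2 v y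
      rw [hv] at e'
      rw [map_sub, e'] at e
      have : 2 * B v y = 0 := by linear_combination e
      exact (mul_eq_zero.1 this).resolve_left h2
    rw [← natCard_fiber hφ 1 d2]
    refine Nat.card_congr ((Equiv.subtypeEquivRight fun w => ?_).trans
      (Equiv.subtypeSubtypeEquivSubtypeInter (fun w => w ∈ LinearMap.ker (g + 1))
        (fun w => B v w = 1)).symm)
    rw [LinearMap.mem_ker, LinearMap.add_apply, Module.End.one_apply, add_eq_zero_iff_eq_neg]
    exact ⟨fun h => h.2, fun h => ⟨hv, h⟩⟩
  · rintro v w ⟨hv, -, hvw⟩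
    refine ⟨hv, ?_⟩
    rintro rfl
    simp at hvw

/-- The number of hyperbolic pairs in a split space. -/
lemma natCard_hypPair [Finite F] [FiniteDimensional F V] (h2 : (2 : F) ≠ 0) (hB : SymForm B)
    {L : Submodule F V} (hL : TotIso B L) {m : ℕ}
    (hV : Module.finrank F V = 2 * (m + 1)) (hm : Module.finrank F L = m + 1) :
    Nat.card {t : V × V // HypPair B t.1 t.2}
      = (Nat.card F ^ (m + 1) - 1) * (Nat.card F ^ m + 1) * Nat.card F ^ (2 * m) := by
  have : Finite V := Module.finite_of_finite F
  rw [natCard_pairs (P := fun v w => HypPair B v w) (fun v => B v v = 0 ∧ v ≠ 0)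
    (a := Nat.card F ^ (2 * m))]
  · congr 1
    have h := natCard_and_ne (p := fun v => B v v = 0) (x₀ := 0) (by simp)
    have h' := natCard_isotropic h2 hB hL hV hm
    have hq : 0 < Nat.card F := Nat.card_pos
    have hq' := Nat.one_le_pow (m + 1) _ hq
    rw [← h] at h'
    zify [hq'] at *
    linear_combination h'
  · rintro v ⟨hv, hv0⟩
    have hφ : B v ≠ 0 := by
      intro h
      exact hv0 (hB.nondeg v fun y => by rw [h]; rfl)
    refine Nat.eq_of_mul_eq_mul_right (Nat.card_pos (α := F)) ?_
    rw [← pow_succ, ← natCard_fiber hφ 1 (m := 2 * m + 1) (by omega), ← Nat.card_prod]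
    have e : ∀ (w : V) (s : F), B v w = 1 →
        B (w + s • v) (w + s • v) = B w w + 2 * s ∧ B v (w + s • v) = 1 := by
      intro w s h
      have h' : B w v = 1 := by rw [hB.symm, h]
      simp only [map_add, map_smul, LinearMap.add_apply, LinearMap.smul_apply, smul_eq_mul, h, h',
        hv]
      exact ⟨by ring, by ring⟩
    refine Nat.card_congr
      { toFun := fun t => ⟨t.1.1 + t.2 • v, (e _ _ t.1.2.pair).2⟩
        invFun := fun w => (⟨w.1 + (-(B w.1 w.1 / 2)) • v, hv, by
          rw [(e _ _ w.2).1]; field_simp; ring, (e _ _ w.2).2⟩, B w.1 w.1 / 2)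
        left_inv := fun t => ?_
        right_inv := fun w => ?_ }
    · have h1 : B (t.1.1 + t.2 • v) (t.1.1 + t.2 • v) / 2 = t.2 := by
        rw [(e _ _ t.1.2.pair).1, t.1.2.right]; field_simp; ring
      refine Prod.ext (Subtype.ext ?_) h1
      dsimp only
      rw [h1, neg_smul, add_neg_cancel_right]
    · apply Subtype.ext
      dsimp only
      rw [neg_smul, neg_add_cancel_right]
  · intro v w h
    refine ⟨h.left, ?_⟩
    rintro rfl
    have := h.pair
    simp at this

/-- The number of negating involutions of a split space. -/
theorem natCard_antiInv [Finite F] (h2 : (2 : F) ≠ 0) (n : ℕ) : ∀ (V : Type) [AddCommGroup V] [Module F V]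
    [FiniteDimensional F V] (B : LinearMap.BilinForm F V) (L : Submodule F V), SymForm B →
    TotIso B L → Module.finrank F V = 2 * n → Module.finrank F L = n →
    Nat.card {g : Module.End F V // AntiInv B g}
      = ∏ i ∈ Finset.range n, (Nat.card F ^ i + 1) * Nat.card F ^ i := by
  induction n with
  | zero =>
    intro V _ _ _ B L hB hL hV hm
    have : Subsingleton V := Module.finrank_zero_iff.1 hV
    rw [Finset.range_zero, Finset.prod_empty, Nat.card_eq_one_iff_unique]
    refine ⟨⟨fun a b => Subtype.ext (LinearMap.ext fun x => Subsingleton.elim _ _)⟩, ⟨⟨1, ?_, ?_⟩⟩⟩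
    · exact fun x => rfl
    · intro x y
      rw [Subsingleton.elim x 0]; simp
  | succ m ih =>
    intro V _ _ _ B L hB hL hV hm
    have : Finite V := Module.finite_of_finite F
    have c1 := natCard_pairs (X := Module.End F V) (Y := V × V)
      (P := fun g t => AntiInv B g ∧ g t.1 = t.1 ∧ g t.2 = -t.2 ∧ B t.1 t.2 = 1)
      (AntiInv B) (a := (Nat.card F ^ (m + 1) - 1) * Nat.card F ^ m)
      (fun g hg => by
        rw [← hg.natCard_pairs h2 hB hV]
        exact Nat.card_congr (Equiv.subtypeEquivRight fun t => and_iff_right hg))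
      (fun g t h => h.1)
    rw [natCard_pairs_swap (fun (g : Module.End F V) (t : V × V) =>
      AntiInv B g ∧ g t.1 = t.1 ∧ g t.2 = -t.2 ∧ B t.1 t.2 = 1), natCard_pairs (X := V × V) (Y := Module.End F V)
      (P := fun t g => AntiInv B g ∧ g t.1 = t.1 ∧ g t.2 = -t.2 ∧ B t.1 t.2 = 1)
      (fun t => HypPair B t.1 t.2)
      (a := ∏ i ∈ Finset.range m, (Nat.card F ^ i + 1) * Nat.card F ^ i)
      (fun t ht => by
        obtain ⟨L', hL', hm'⟩ := ht.exists_totIso hB hL hV hm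
        have hd := ht.finrank_perp hB
        rw [← ih (perp B t.1 t.2) (B.restrict _) L' (hB.restrict (ht.nonDegOn_perp hB)) hL'
          (by omega) hm', ← Nat.card_congr (antiInvEquiv hB ht)]
        refine Nat.card_congr (Equiv.subtypeEquivRight fun g => ?_)
        exact ⟨fun h => ⟨h.1, h.2.1, h.2.2.1⟩, fun h => ⟨h.1, h.2.1, h.2.2, ht.pair⟩⟩)
      (fun t g h => ⟨h.1.self_eq_zero h2 (Or.inl h.2.1), h.1.self_eq_zero h2 (Or.inr h.2.2.1),
        h.2.2.2⟩), natCard_hypPair h2 hB hL hV hm] at c1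
    have hq : 1 < Nat.card F := Finite.one_lt_card
    have hp : 0 < (Nat.card F ^ (m + 1) - 1) * Nat.card F ^ m :=
      Nat.mul_pos (Nat.sub_pos_of_lt (Nat.one_lt_pow (by omega) hq)) (pow_pos (by omega) _)
    refine Nat.eq_of_mul_eq_mul_right hp ?_
    rw [← c1, Finset.prod_range_succ]
    ring

end AntiCount

section Involutions

lemma natCard_involutions {G G' : Type} [Group G] [Group G'] (e : G' ≃* G) (K : Subgroup G) :
    Nat.card {g : K // g * g = 1} = Nat.card {u : G' // e u ∈ K ∧ u * u = 1} := by
  refine Nat.card_congr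
    { toFun := fun g => ⟨e.symm g.1.1, by rw [e.apply_symm_apply]; exact g.1.2, by
        rw [← map_mul, ← Subgroup.coe_mul, g.2, Subgroup.coe_one, map_one]⟩
      invFun := fun u => ⟨⟨e u.1, u.2.1⟩, Subtype.ext (by
        rw [Subgroup.coe_mul, ← map_mul, u.2.2, map_one, Subgroup.coe_one])⟩
      left_inv := fun g => ?_
      right_inv := fun u => ?_ }
  · exact Subtype.ext (Subtype.ext (e.apply_symm_apply _))
  · exact Subtype.ext (e.symm_apply_apply _)

variable {N F : Type} [Fintype N] [DecidableEq N] [Field F] {J : Matrix N N F}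

lemma endGL_mem_similitudeGroup (u : (Module.End F (N → F))ˣ) :
    endGL N F u ∈ similitudeGroup J ↔ ∃ c : Fˣ, ∀ x y,
      Matrix.toBilin' J (u.1 x) (u.1 y) = c * Matrix.toBilin' J x y := by
  change (∃ c : Fˣ, (_ : Matrix N N F)ᵀ * J * _ = (c : F) • J) ↔ _
  refine exists_congr fun c => ?_
  simp only [← endGL_mulVec, toBilin'_mulVec]
  constructor
  · intro h x y; rw [h, map_smul, LinearMap.smul_apply, LinearMap.smul_apply, smul_eq_mul]
  · intro h
    apply Matrix.toBilin'.injective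
    refine LinearMap.ext₂ fun x y => ?_
    rw [h, map_smul, LinearMap.smul_apply, LinearMap.smul_apply, smul_eq_mul]

/-- Involutive similitudes preserve or negate the form. -/
lemma natCard_similitude_involutions [Finite F] [Nonempty N] (h2 : (2 : F) ≠ 0) (hs : Jᵀ = J)
    (hu : IsUnit J) :
    Nat.card {g : similitudeGroup J // g * g = 1} = Nat.card {g : fixGroup J // g * g = 1} +
      Nat.card {g : Module.End F (N → F) // AntiInv (Matrix.toBilin' J) g} := by
  set B := Matrix.toBilin' J with hBd
  have hB : SymForm B := symForm_toBilin' hs hu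
  obtain ⟨x₀, y₀, h₀⟩ : ∃ x y, B x y ≠ 0 := by
    by_contra! h
    exact one_ne_zero (hB.nondeg 1 (h 1))
  rw [natCard_involutions (endGL N F) (similitudeGroup J),
    natCard_involutions (endGL N F) (fixGroup J), ← natCard_subtype_add_not
    (fun u : {u : (Module.End F (N → F))ˣ // endGL N F u ∈ similitudeGroup J ∧ u * u = 1} =>
      endGL N F u.1 ∈ fixGroup J)]
  congr 1
  · refine Nat.card_congr ((Equiv.subtypeSubtypeEquivSubtypeInter _
      (fun u => endGL N F u ∈ fixGroup J)).trans (Equiv.subtypeEquivRight fun u => ?_))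
    exact ⟨fun h => ⟨h.2, h.1.2⟩, fun h => ⟨⟨fixGroup_le h.1, h.2⟩, h.1⟩⟩
  · refine Nat.card_congr ((Equiv.subtypeSubtypeEquivSubtypeInter _
      (fun u => endGL N F u ∉ fixGroup J)).trans
      { toFun := fun u => ⟨u.1.1, fun x => ?_, ?_⟩
        invFun := fun a => ⟨⟨a.1, a.1, LinearMap.ext a.2.1, LinearMap.ext a.2.1⟩, ⟨?_, ?_⟩, ?_⟩
        left_inv := fun u => Subtype.ext (Units.ext rfl)
        right_inv := fun a => rfl })
    · exact LinearMap.congr_fun (congrArg Units.val u.2.1.2) x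
    · obtain ⟨u, ⟨hu1, hu2⟩, hu3⟩ := u
      obtain ⟨c, hc⟩ := (endGL_mem_similitudeGroup u).1 hu1
      rw [endGL_mem_fixGroup, mem_orth] at hu3
      have hi : ∀ x, u.1 (u.1 x) = x := fun x => LinearMap.congr_fun (congrArg Units.val hu2) x
      have hc2 : (c : F) * c = 1 := by
        have := hc (u.1 x₀) (u.1 y₀)
        rw [hi, hi, hc, ← mul_assoc] at this
        exact mul_right_cancel₀ h₀ (by rw [← this, one_mul])
      rcases mul_self_eq_one_iff.1 hc2 with h | h
      · exact absurd (fun x y => by rw [hc, h, one_mul]) hu3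
      · intro x y
        rw [hc, h, neg_one_mul]
    · refine (endGL_mem_similitudeGroup _).2 ⟨-1, fun x y => ?_⟩
      rw [Units.val_neg, Units.val_one, neg_one_mul]
      exact a.2.2 x y
    · exact Units.ext (LinearMap.ext a.2.1)
    · rw [endGL_mem_fixGroup, mem_orth]
      intro h
      have h1 := h x₀ y₀
      have h3 : B (a.1 x₀) (a.1 y₀) = B x₀ y₀ := h1
      rw [a.2.2] at h3
      have : 2 * B x₀ y₀ = 0 := by linear_combination -h3
      exact h₀ ((mul_eq_zero.1 this).resolve_left h2)

/-- A split form has a Lagrangian subspace. -/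
lemma exists_totIso_of_isSplit {n : ℕ} {J : Matrix (Fin n ⊕ Fin n) (Fin n ⊕ Fin n) F}
    (h : IsSplit J) : ∃ L : Submodule F (Fin n ⊕ Fin n → F),
      TotIso (Matrix.toBilin' J) L ∧ Module.finrank F L = n := by
  obtain ⟨P, hP⟩ := h
  let f : (Fin n → F) →ₗ[F] (Fin n ⊕ Fin n → F) :=
    (P : Matrix (Fin n ⊕ Fin n) (Fin n ⊕ Fin n) F).mulVecLin ∘ₗ
      (LinearEquiv.sumArrowLequivProdArrow (Fin n) (Fin n) F F).symm.toLinearMap ∘ₗ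
      LinearMap.inl F (Fin n → F) (Fin n → F)
  have hf : ∀ x, f x = (P : Matrix (Fin n ⊕ Fin n) (Fin n ⊕ Fin n) F) *ᵥ Sum.elim x 0 := by
    intro x
    refine congrArg ((P : Matrix (Fin n ⊕ Fin n) (Fin n ⊕ Fin n) F) *ᵥ ·) ?_
    ext (i | i) <;> rfl
  refine ⟨LinearMap.range f, ?_, ?_⟩
  · rintro _ ⟨x, rfl⟩ _ ⟨y, rfl⟩
    rw [hf, hf, toBilin'_mulVec, hP, Matrix.toBilin'_apply', Jsplit, Matrix.fromBlocks_mulVec]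
    simp
  · rw [LinearMap.finrank_range_of_inj, Module.finrank_fin_fun]
    intro x y hxy
    rw [hf, hf] at hxy
    have := Matrix.mulVec_injective_iff_isUnit.2 P.isUnit hxy
    exact funext fun i => congrFun this (Sum.inl i)

lemma isRealValued_fixGroup [Finite F] (h2 : (2 : F) ≠ 0) (hs : Jᵀ = J) (hu : IsUnit J)
    (V : FDRep ℂ (fixGroup J)) : IsRealValued V.character := by
  refine (isRealValued_iff (repOn_top V.ρ)).2 fun g => ?_
  obtain ⟨h, hh, hr⟩ := fixGroup_exists_conj h2 hs hu g.2
  have := FDRep.char_conj V g ⟨h, hh⟩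
  rwa [show (⟨h, hh⟩ : fixGroup J) * g * (⟨h, hh⟩ : fixGroup J)⁻¹ = g⁻¹ from
    Subtype.ext hr] at this

lemma prod_range_eq (q : ℝ) (m : ℕ) :
    ∏ i ∈ Finset.range (m + 1), (q ^ i + 1) * q ^ i
      = 2 * q ^ ((m + 1) * m / 2) * ∏ i ∈ Finset.Icc 1 m, (q ^ i + 1) := by
  have h : ∀ m, ∏ i ∈ Finset.range (m + 1), (q ^ i + 1)
      = 2 * ∏ i ∈ Finset.Icc 1 m, (q ^ i + 1) := by
    intro m
    induction m with
    | zero => norm_num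
    | succ k ih => rw [Finset.prod_range_succ, ih, Finset.prod_Icc_succ_top (by omega)]; ring
  rw [Finset.prod_mul_distrib, h, Finset.prod_pow_eq_pow_sum, Finset.sum_range_id,
    Nat.add_sub_cancel]
  ring

lemma two_ne_zero_of_card {F : Type} [Field F] [Fintype F] {p r : ℕ} (ho : Odd p)
    (h : Fintype.card F = p ^ r) : (2 : F) ≠ 0 := by
  intro h2
  have hc : CharP F 2 := CharTwo.of_one_ne_zero_of_two_eq_zero one_ne_zero h2
  have := (CharP.cast_eq_zero_iff F 2 (Fintype.card F)).1 (FiniteField.cast_card_eq_zero F)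
  rw [h] at this
  exact (Nat.not_even_iff_odd.2 (ho.pow)) (even_iff_two_dvd.2 this)

end Involutions

end OrthSim

theorem stmt_9 (n : ℕ) (hn : 1 ≤ n) (q : ℕ) (hq : ∃ p r : ℕ, p.Prime ∧ Odd p ∧ 0 < r ∧ q = p ^ r)
    (F : Type) [Field F] [Fintype F] [DecidableEq F] (hF : Fintype.card F = q)
    (J : Matrix (Fin n ⊕ Fin n) (Fin n ⊕ Fin n) F) (hJunit : IsUnit J) (hJsymm : Jᵀ = J)
    (hJsplit : IsSplit J)
    (ι : Type) [Fintype ι] (R : ι → FDRep ℂ ↥(similitudeGroup J))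
    (hRsimple : ∀ i, Simple (R i))
    (hRdistinct : ∀ i j : ι, Nonempty (R i ≅ R j) → i = j)
    (hRcomplete : ∀ ρ : FDRep ℂ ↥(similitudeGroup J), Simple ρ → ∃ i, Nonempty (ρ ≅ R i))
    (κ : Type) [Fintype κ] (S : κ → FDRep ℂ ↥(fixGroup J))
    (hSsimple : ∀ i, Simple (S i))
    (hSdistinct : ∀ i j : κ, Nonempty (S i ≅ S j) → i = j)
    (hScomplete : ∀ ρ : FDRep ℂ ↥(fixGroup J), Simple ρ → ∃ i, Nonempty (ρ ≅ S i)) :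
    ∑ i ∈ Finset.univ.filter (fun i => IsRealValued (R i).character),
        (Module.finrank ℂ (R i) : ℝ)
      = (∑ j : κ, (Module.finrank ℂ (S j) : ℝ))
        + 2 * (q : ℝ) ^ (n * (n - 1) / 2) * ∏ i ∈ Finset.Icc 1 (n - 1), ((q : ℝ) ^ i + 1) := by
  obtain ⟨p, r, -, ho, -, hqp⟩ := hq
  have h2 : (2 : F) ≠ 0 := OrthSim.two_ne_zero_of_card ho (hF.trans hqp)
  have : Nonempty (Fin n ⊕ Fin n) := ⟨Sum.inl ⟨0, hn⟩⟩
  have hH := (OrthSim.noSkew_fixGroup h2 hJsymm hJunit).top.sum_finrank S hSsimple hSdistinct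
    hScomplete
  rw [Finset.filter_true_of_mem fun j _ =>
    OrthSim.isRealValued_fixGroup h2 hJsymm hJunit (S j)] at hH
  obtain ⟨L, hL, hLn⟩ := OrthSim.exists_totIso_of_isSplit hJsplit
  have hA := OrthSim.natCard_antiInv h2 n (Fin n ⊕ Fin n → F) (Matrix.toBilin' J) L
    (OrthSim.symForm_toBilin' hJsymm hJunit) hL (by simp [two_mul]) hLn
  rw [(OrthSim.noSkew_similitudeGroup h2 hJsymm hJunit).top.sum_finrank R hRsimple hRdistinct
    hRcomplete, OrthSim.natCard_similitude_involutions h2 hJsymm hJunit, Nat.cast_add, hH, hA,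
    Nat.card_eq_fintype_card (α := F), hF]
  obtain ⟨m, rfl⟩ : ∃ m, n = m + 1 := ⟨n - 1, by omega⟩
  congr 1
  rw [Nat.add_sub_cancel, ← OrthSim.prod_range_eq]
  push_cast
  rfl

end
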